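/- In the killed Wright–Fisher setting, assume ρ_0 < ρ_α, where ρ_0 = −r(0) and ρ_α is the extinction rate of the unique QSD α on (0,1) for τ_{0,1,∂}. Then there exists C > 0 such that for every probability measure μ on [0,1] with μ ≠ δ_1, the law conditioned on survival and non-absorption at 1 converges to the Dirac mass at 0 at exponential rate ρ_α − ρ_0: ‖μA^1_t − δ_0‖_{TV} ≤ C e^{−(ρ_α − ρ_0) t}. -/

import Mathlib

open MeasureTheory ProbabilityTheory Filter Set
open scoped ENNReal NNReal Topology

noncomputable section

/-- The Wright–Fisher generator with selection `s` and diffusion parameter `σ`: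
`𝓛_WF f(x) = -s x (1-x) f'(x) + (σ²/2) x (1-x) f''(x)`. -/
def LWF (s σ : ℝ) (f : ℝ → ℝ) : ℝ → ℝ := fun x =>
  -s * x * (1 - x) * deriv f x + σ ^ 2 / 2 * (x * (1 - x)) * deriv (deriv f) x

/-- A (weak) solution of the Wright–Fisher SDE with selection
`dX_t = -s X_t (1-X_t) dt + σ √(X_t(1-X_t)) dB_t`, `X_0 ∼ μ₀`, characterized through
the associated martingale problem for the generator `LWF s σ`, enriched with an
independent standard exponential random variable `Tkill` used for the soft killing at
rate `-r ≥ 0`:  `τ_∂ = inf{t ≥ 0 : ∫₀ᵗ (-r(X_u)) du ≥ Tkill}`. -/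
structure WFKilled (s σ : ℝ) (r : ℝ → ℝ) (μ₀ : Measure ℝ) where
  (Ω : Type)
  [mΩ : MeasurableSpace Ω]
  (P : Measure Ω)
  (probP : IsProbabilityMeasure P)
  (X : ℝ → Ω → ℝ)
  (measX : ∀ t, Measurable (X t))
  (contX : ∀ ω, Continuous fun t => X t ω)
  (preZero : ∀ t ≤ (0:ℝ), X t = X 0)
  (range01 : ∀ t ω, X t ω ∈ Icc (0:ℝ) 1)
  (initLaw : P.map (X 0) = μ₀)
  (ℱ : Filtration ℝ mΩ)
  (adaptedX : Adapted ℱ X)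
  (martProblem : ∀ f : ℝ → ℝ, ContDiff ℝ 2 f →
    Martingale (fun t ω => f (X t ω) - ∫ u in Ioc (0:ℝ) t, LWF s σ f (X u ω)) ℱ P)
  (Tkill : Ω → ℝ)
  (measT : Measurable Tkill)
  (expLaw : ∀ t : ℝ, 0 ≤ t → P {ω | t < Tkill ω} = ENNReal.ofReal (Real.exp (-t)))
  (indepT : IndepFun (fun ω t => X t ω) Tkill P)

attribute [instance] WFKilled.mΩ WFKilled.probP

variable {s σ : ℝ} {r : ℝ → ℝ} {μ₀ : Measure ℝ}

/-- The survival event `{t < τ_∂}` for the soft killing at rate `-r`. -/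
def WFKilled.aliveSoft (W : WFKilled s σ r μ₀) (t : ℝ) : Set W.Ω :=
  {ω | ∫ u in Ioc (0:ℝ) t, (-(r (W.X u ω))) < W.Tkill ω}

/-- The event `{t < τ_0}`: the boundary point `0` has not been hit by time `t`. -/
def WFKilled.noHit0 (W : WFKilled s σ r μ₀) (t : ℝ) : Set W.Ω :=
  {ω | ∀ u ∈ Icc (0:ℝ) t, W.X u ω ≠ 0}

/-- The event `{t < τ_1}`: the boundary point `1` has not been hit by time `t`. -/
def WFKilled.noHit1 (W : WFKilled s σ r μ₀) (t : ℝ) : Set W.Ω :=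
  {ω | ∀ u ∈ Icc (0:ℝ) t, W.X u ω ≠ 1}

/-- The event `{t < τ_{0,1,∂}}`. -/
def WFKilled.aliveAll (W : WFKilled s σ r μ₀) (t : ℝ) : Set W.Ω :=
  W.aliveSoft t ∩ W.noHit0 t ∩ W.noHit1 t

/-- The law of `X_t` conditioned on an event `E` (e.g. survival up to time `t`). -/
def WFKilled.condLaw (W : WFKilled s σ r μ₀) (E : Set W.Ω) (t : ℝ) : Measure ℝ :=
  (W.P E)⁻¹ • (W.P.restrict E).map (W.X t)

/-- The hitting time of `0`, as an element of `ℝ≥0∞`. -/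
def WFKilled.hit0 (W : WFKilled s σ r μ₀) (ω : W.Ω) : ℝ≥0∞ :=
  sInf {t : ℝ≥0∞ | ∃ u : ℝ, 0 ≤ u ∧ t = ENNReal.ofReal u ∧ W.X u ω = 0}

/-- The hitting time of `1`, as an element of `ℝ≥0∞`. -/
def WFKilled.hit1 (W : WFKilled s σ r μ₀) (ω : W.Ω) : ℝ≥0∞ :=
  sInf {t : ℝ≥0∞ | ∃ u : ℝ, 0 ≤ u ∧ t = ENNReal.ofReal u ∧ W.X u ω = 1}

/-- The soft killing time `τ_∂`, as an element of `ℝ≥0∞`. -/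
def WFKilled.killT (W : WFKilled s σ r μ₀) (ω : W.Ω) : ℝ≥0∞ :=
  sInf {t : ℝ≥0∞ | ∃ u : ℝ, 0 ≤ u ∧ t = ENNReal.ofReal u ∧
    W.Tkill ω ≤ ∫ v in Ioc (0:ℝ) u, (-(r (W.X v ω)))}

/-- Quasi-stationary distribution on `(0,1)` for the extinction time `τ_{0,1,∂}`,
with extinction rate `ρ`: under any realization of the killed Wright–Fisher diffusion
started from `α`, one has `ℙ_α(X_t ∈ A ; t < τ_{0,1,∂}) = e^{-ρ t} α(A)`. -/
def IsQSD (s σ : ℝ) (r : ℝ → ℝ) (α : Measure ℝ) (ρ : ℝ) : Prop :=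
  IsProbabilityMeasure α ∧ α (Ioo (0:ℝ) 1)ᶜ = 0 ∧
  ∀ W : WFKilled s σ r α, ∀ t : ℝ, 0 < t → ∀ A : Set ℝ, MeasurableSet A →
    W.P ({ω | W.X t ω ∈ A} ∩ W.aliveAll t) = ENNReal.ofReal (Real.exp (-(ρ * t))) * α A

/-- Quasi-stationary distribution on `[0,1]` for the soft killing time `τ_∂` alone,
with extinction rate `ρ`. -/
def IsQSDsoft (s σ : ℝ) (r : ℝ → ℝ) (α : Measure ℝ) (ρ : ℝ) : Prop :=
  IsProbabilityMeasure α ∧ α (Icc (0:ℝ) 1)ᶜ = 0 ∧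
  ∀ W : WFKilled s σ r α, ∀ t : ℝ, 0 < t → ∀ A : Set ℝ, MeasurableSet A →
    W.P ({ω | W.X t ω ∈ A} ∩ W.aliveSoft t) = ENNReal.ofReal (Real.exp (-(ρ * t))) * α A

/-- Survival capacity `η` with extinction rate `ρ`:
`η(x) = e^{ρ t} 𝔼_x[η(X_t) ; t < τ_{0,1,∂}]`. -/
def IsSurvCap (s σ : ℝ) (r : ℝ → ℝ) (ρ : ℝ) (η : ℝ → ℝ) : Prop :=
  Measurable η ∧ ∀ x ∈ Icc (0:ℝ) 1, ∀ W : WFKilled s σ r (Measure.dirac x), ∀ t : ℝ, 0 < t →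
    η x = Real.exp (ρ * t) * ∫ ω in W.aliveAll t, η (W.X t ω) ∂W.P

/-- Total variation distance between two (finite) measures on `ℝ`. -/
def tvDist (μ ν : Measure ℝ) : ℝ :=
  ⨆ A : Set ℝ, |(μ A).toReal - (ν A).toReal|

/-- Existence of realizations of the killed Wright–Fisher diffusion from any initial law
on `[0,1]` (granted by the classical well-posedness of the Wright–Fisher SDE). -/
def WFExists (s σ : ℝ) (r : ℝ → ℝ) : Prop :=
  ∀ μ : Measure ℝ, IsProbabilityMeasure μ → μ (Icc (0:ℝ) 1)ᶜ = 0 →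
    Nonempty (WFKilled s σ r μ)


/-- scale function -/
def wp (b x : ℝ) : ℝ := ∫ z in (0:ℝ)..x, Real.exp (b * z)

/-- Wright-Fisher weight -/
def ww (x : ℝ) : ℝ := x * (1 - x)

/-- symmetric Green kernel -/
def wkS (b x y : ℝ) : ℝ := wp b (min x y) * (wp b 1 - wp b (max x y))

/-- constant -/
def wc (b σ : ℝ) : ℝ := 2 / (σ ^ 2 * wp b 1)

/-- Green kernel -/
def wk (b σ x y : ℝ) : ℝ := wc b σ * wkS b x y * Real.exp (-(b * y))

/-- Green operator -/
def wG (b σ : ℝ) (q : ℝ → ℝ≥0∞) (x : ℝ) : ℝ≥0∞ :=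
  ∫⁻ y in Ioc (0:ℝ) 1, ENNReal.ofReal (wk b σ x y) * q y

lemma wp_hasDeriv (b x : ℝ) : HasDerivAt (wp b) (Real.exp (b * x)) x := by
  have hc : Continuous fun z : ℝ => Real.exp (b * z) := by fun_prop
  exact intervalIntegral.integral_hasDerivAt_right (hc.intervalIntegrable _ _)
    (hc.stronglyMeasurableAtFilter _ _) hc.continuousAt

lemma wp_zero (b : ℝ) : wp b 0 = 0 := by simp [wp]

lemma wp_cont (b : ℝ) : Continuous (wp b) :=
  continuous_iff_continuousAt.2 fun x => (wp_hasDeriv b x).continuousAt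

lemma wp_sub (b x y : ℝ) : wp b y - wp b x = ∫ z in x..y, Real.exp (b * z) := by
  have hc : Continuous fun z : ℝ => Real.exp (b * z) := by fun_prop
  unfold wp
  rw [intervalIntegral.integral_interval_sub_left] <;> exact hc.intervalIntegrable _ _

lemma wp_sub_lower {b x y : ℝ} (hb : 0 ≤ b) (hx : 0 ≤ x) (hxy : x ≤ y) :
    y - x ≤ wp b y - wp b x := by
  have hc : Continuous fun z : ℝ => Real.exp (b * z) := by fun_prop
  rw [wp_sub]
  have := intervalIntegral.integral_mono_on (f := fun _ => (1:ℝ)) (g := fun z => Real.exp (b * z))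
    (μ := volume) hxy (by simp) (hc.intervalIntegrable _ _) (fun z hz => by
      apply Real.one_le_exp; exact mul_nonneg hb (hx.trans hz.1))
  simpa using this

lemma wp_sub_upper {b x y : ℝ} (hb : 0 ≤ b) (hy : y ≤ 1) (hxy : x ≤ y) :
    wp b y - wp b x ≤ Real.exp b * (y - x) := by
  have hc : Continuous fun z : ℝ => Real.exp (b * z) := by fun_prop
  rw [wp_sub]
  have := intervalIntegral.integral_mono_on (f := fun z => Real.exp (b * z))
    (g := fun _ => Real.exp b)
    (μ := volume) hxy (hc.intervalIntegrable _ _) (by simp) (fun z hz => by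
      apply Real.exp_le_exp.2; nlinarith [hz.2])
  simp at this
  linarith

lemma wp_mono (b : ℝ) : Monotone (wp b) :=
  monotone_of_deriv_nonneg (fun x => (wp_hasDeriv b x).differentiableAt)
    (fun x => by rw [(wp_hasDeriv b x).deriv]; positivity)

lemma wp_deriv (b : ℝ) : deriv (wp b) = fun x => Real.exp (b * x) :=
  funext fun x => (wp_hasDeriv b x).deriv

lemma wp_contDiff (b : ℝ) : ContDiff ℝ 2 (wp b) := by
  have : (2 : WithTop ℕ∞) = 1 + 1 := by norm_num
  rw [this, contDiff_succ_iff_deriv]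
  refine ⟨fun x => (wp_hasDeriv b x).differentiableAt, by simp, ?_⟩
  rw [wp_deriv]
  fun_prop

lemma wp_one_pos {b : ℝ} (hb : 0 ≤ b) : 1 ≤ wp b 1 := by
  have := wp_sub_lower hb le_rfl (zero_le_one)
  rw [wp_zero] at this; linarith

lemma wp_gen (s σ : ℝ) (hσ : 0 < σ) (x : ℝ) : LWF s σ (wp (2 * s / σ ^ 2)) x = 0 := by
  unfold LWF
  rw [wp_deriv]
  have : HasDerivAt (fun x => Real.exp (2 * s / σ ^ 2 * x))
    (Real.exp (2 * s / σ ^ 2 * x) * (2 * s / σ ^ 2)) x := by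
    have := ((hasDerivAt_id x).const_mul (2 * s / σ ^ 2)).exp
    simpa using this
  rw [this.deriv]
  field_simp
  ring

lemma wcp_gen (s σ c : ℝ) (hσ : 0 < σ) (x : ℝ) :
    LWF s σ (fun x => c - wp (2 * s / σ ^ 2) x) x = 0 := by
  have h := wp_gen s σ hσ x
  unfold LWF at *
  have h1 : deriv (fun x => c - wp (2 * s / σ ^ 2) x) =
      fun x => - deriv (wp (2 * s / σ ^ 2)) x := by
    funext y; simp
  rw [h1, deriv.fun_neg]
  linarith

/-- real Green potential, explicit -/
def wF (b σ : ℝ) (q : ℝ → ℝ) (x : ℝ) : ℝ :=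
  wc b σ * ((wp b 1 - wp b x) * (∫ y in (0:ℝ)..x, wp b y * Real.exp (-(b * y)) * q y) +
    wp b x * (∫ y in x..1, (wp b 1 - wp b y) * Real.exp (-(b * y)) * q y))

/-- derivative of `wF` -/
def wF' (b σ : ℝ) (q : ℝ → ℝ) (x : ℝ) : ℝ :=
  wc b σ * (Real.exp (b * x) * ((∫ y in x..1, (wp b 1 - wp b y) * Real.exp (-(b * y)) * q y) -
    (∫ y in (0:ℝ)..x, wp b y * Real.exp (-(b * y)) * q y)))

lemma wF_aux1 {g : ℝ → ℝ} (hg : Continuous g) (x : ℝ) :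
    HasDerivAt (fun x => ∫ y in (0:ℝ)..x, g y) (g x) x :=
  intervalIntegral.integral_hasDerivAt_right (hg.intervalIntegrable _ _)
    (hg.stronglyMeasurableAtFilter _ _) hg.continuousAt

lemma wF_aux2 {g : ℝ → ℝ} (hg : Continuous g) (x : ℝ) :
    HasDerivAt (fun x => ∫ y in x..1, g y) (- g x) x :=
  intervalIntegral.integral_hasDerivAt_left (hg.intervalIntegrable _ _)
    (hg.stronglyMeasurableAtFilter _ _) hg.continuousAt

lemma wF_hasDeriv (b σ : ℝ) {q : ℝ → ℝ} (hq : Continuous q) (x : ℝ) :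
    HasDerivAt (wF b σ q) (wF' b σ q x) x := by
  have hp := wp_cont b
  have h1 := wF_aux1 (g := fun y => wp b y * Real.exp (-(b * y)) * q y) (by fun_prop) x
  have h2 := wF_aux2 (g := fun y => (wp b 1 - wp b y) * Real.exp (-(b * y)) * q y) (by fun_prop) x
  have h3 := wp_hasDeriv b x
  have := ((((h3.const_sub (wp b 1)).mul h1).add (h3.mul h2)).const_mul (wc b σ))
  refine HasDerivAt.congr_deriv (f := wF b σ q) this ?_
  unfold wF'
  ring

lemma wF'_hasDeriv (b σ : ℝ) {q : ℝ → ℝ} (hq : Continuous q) (x : ℝ) :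
    HasDerivAt (wF' b σ q) (b * wF' b σ q x - wc b σ * wp b 1 * q x) x := by
  have hp := wp_cont b
  have h1 := wF_aux1 (g := fun y => wp b y * Real.exp (-(b * y)) * q y) (by fun_prop) x
  have h2 := wF_aux2 (g := fun y => (wp b 1 - wp b y) * Real.exp (-(b * y)) * q y) (by fun_prop) x
  have h3 : HasDerivAt (fun x => Real.exp (b * x)) (Real.exp (b * x) * b) x := by
    simpa using ((hasDerivAt_id x).const_mul b).exp
  have := ((h3.mul (h2.sub h1)).const_mul (wc b σ))
  refine HasDerivAt.congr_deriv (f := wF' b σ q) this ?_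
  have he : Real.exp (b * x) * Real.exp (-(b * x)) = 1 := by rw [← Real.exp_add]; simp
  unfold wF'
  simp only [Pi.sub_apply]
  linear_combination (-(wc b σ * wp b 1 * q x)) * he

lemma wF_contDiff (b σ : ℝ) {q : ℝ → ℝ} (hq : Continuous q) : ContDiff ℝ 2 (wF b σ q) := by
  have : (2 : WithTop ℕ∞) = 1 + 1 := by norm_num
  rw [this, contDiff_succ_iff_deriv]
  refine ⟨fun x => (wF_hasDeriv b σ hq x).differentiableAt, by simp, ?_⟩
  have h1 : deriv (wF b σ q) = wF' b σ q := funext fun x => (wF_hasDeriv b σ hq x).deriv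
  have h2 : deriv (wF' b σ q) = fun x => b * wF' b σ q x - wc b σ * wp b 1 * q x :=
    funext fun x => (wF'_hasDeriv b σ hq x).deriv
  have h3 : Continuous (wF' b σ q) :=
    continuous_iff_continuousAt.2 fun x => (wF'_hasDeriv b σ hq x).continuousAt
  rw [h1, contDiff_one_iff_deriv, h2]
  exact ⟨fun x => (wF'_hasDeriv b σ hq x).differentiableAt, by fun_prop⟩

lemma wF_gen (s σ : ℝ) (hs : 0 ≤ s) (hσ : 0 < σ) {q : ℝ → ℝ} (hq : Continuous q) (x : ℝ) :
    LWF s σ (wF (2 * s / σ ^ 2) σ q) x = - (ww x * q x) := by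
  have hp := wp_one_pos (b := 2 * s / σ ^ 2) (by positivity)
  set b := 2 * s / σ ^ 2 with hb
  have h1 : deriv (wF b σ q) = wF' b σ q := funext fun x => (wF_hasDeriv b σ hq x).deriv
  have h2 : deriv (wF' b σ q) = fun x => b * wF' b σ q x - wc b σ * wp b 1 * q x :=
    funext fun x => (wF'_hasDeriv b σ hq x).deriv
  unfold LWF
  rw [h1, h2]
  have h3 : σ ^ 2 / 2 * b = s := by rw [hb]; field_simp
  have h4 : σ ^ 2 / 2 * (wc b σ * wp b 1) = 1 := by
    unfold wc; field_simp
  unfold ww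
  linear_combination (x * (1 - x) * wF' b σ q x) * h3 - (x * (1 - x) * q x) * h4

lemma wkS_cont (b : ℝ) : Continuous fun z : ℝ × ℝ => wkS b z.1 z.2 := by
  have hp := wp_cont b
  unfold wkS; fun_prop

lemma wk_cont (b σ : ℝ) : Continuous fun z : ℝ × ℝ => wk b σ z.1 z.2 := by
  have hp := wkS_cont b
  unfold wk; fun_prop

lemma wkS_symm (b x y : ℝ) : wkS b x y = wkS b y x := by
  unfold wkS; rw [min_comm, max_comm]

lemma wF_eq (b σ : ℝ) {q : ℝ → ℝ} (hq : Continuous q) {x : ℝ} (hx : x ∈ Icc (0:ℝ) 1) :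
    wF b σ q x = ∫ y in Ioc (0:ℝ) 1, wk b σ x y * q y := by
  have hk := wk_cont b σ
  have hkx : Continuous fun y => wk b σ x y * q y :=
    (hk.comp (by fun_prop : Continuous fun y : ℝ => (x, y))).mul hq
  rw [← intervalIntegral.integral_of_le zero_le_one,
    ← intervalIntegral.integral_add_adjacent_intervals (b := x) (hkx.intervalIntegrable _ _)
      (hkx.intervalIntegrable _ _)]
  unfold wF
  rw [mul_add]
  congr 1
  · rw [← mul_assoc, ← intervalIntegral.integral_const_mul]
    apply intervalIntegral.integral_congr
    intro y hy
    rw [uIcc_of_le hx.1] at hy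
    simp only [wk, wkS, min_eq_right hy.2, max_eq_left hy.2]
    ring
  · rw [← mul_assoc, ← intervalIntegral.integral_const_mul]
    apply intervalIntegral.integral_congr
    intro y hy
    rw [uIcc_of_le hx.2] at hy
    simp only [wk, wkS, min_eq_left hy.1, max_eq_right hy.1]
    ring

lemma wkS_le {b x y : ℝ} (hb : 0 ≤ b) (hx : x ∈ Icc (0:ℝ) 1) (hy : y ∈ Icc (0:ℝ) 1) :
    wkS b x y ≤ Real.exp b * Real.exp b * (min x y * (1 - max x y)) := by
  have h1 := wp_sub_upper (b := b) (x := 0) (y := min x y) hb (min_le_of_left_le hx.2) (le_min hx.1 hy.1)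
  have h2 := wp_sub_upper (b := b) (x := max x y) (y := 1) hb le_rfl (max_le hx.2 hy.2)
  have h3 := wp_mono b (max_le hx.2 hy.2)
  rw [wp_zero] at h1
  have h4 : 0 ≤ min x y := le_min hx.1 hy.1
  unfold wkS
  calc _ ≤ (Real.exp b * (min x y)) * (Real.exp b * (1 - max x y)) := by
        apply mul_le_mul (by linarith) h2 (by linarith) (by positivity)
    _ = _ := by ring

lemma wkS_ge {b x y : ℝ} (hb : 0 ≤ b) (hx : x ∈ Icc (0:ℝ) 1) (hy : y ∈ Icc (0:ℝ) 1) :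
    (min x y * (1 - max x y)) ≤ wkS b x y := by
  have h1 := wp_sub_lower (b := b) (x := 0) (y := min x y) hb le_rfl (le_min hx.1 hy.1)
  have h2 := wp_sub_lower (b := b) (x := max x y) (y := 1) hb (le_max_of_le_left hx.1) (max_le hx.2 hy.2)
  have h3 : max x y ≤ 1 := (max_le hx.2 hy.2)
  rw [wp_zero] at h1
  have h4 : 0 ≤ min x y := le_min hx.1 hy.1
  unfold wkS
  exact mul_le_mul (by linarith) h2 (by linarith) (by linarith)

lemma kap_le_left {x y : ℝ} (hx : x ∈ Icc (0:ℝ) 1) (hy : y ∈ Icc (0:ℝ) 1) :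
    min x y * (1 - max x y) ≤ ww x := by
  unfold ww
  apply mul_le_mul (min_le_left _ _) (by linarith [le_max_left x y])
    (by linarith [max_le hx.2 hy.2]) hx.1

lemma kap_le_right {x y : ℝ} (hx : x ∈ Icc (0:ℝ) 1) (hy : y ∈ Icc (0:ℝ) 1) :
    min x y * (1 - max x y) ≤ ww y := by
  rw [min_comm, max_comm]; exact kap_le_left hy hx

lemma kap_nonneg {x y : ℝ} (hx : x ∈ Icc (0:ℝ) 1) (hy : y ∈ Icc (0:ℝ) 1) :
    0 ≤ min x y * (1 - max x y) :=
  mul_nonneg (le_min hx.1 hy.1) (by linarith [max_le hx.2 hy.2])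

lemma ww_nonneg {x : ℝ} (hx : x ∈ Icc (0:ℝ) 1) : 0 ≤ ww x :=
  mul_nonneg hx.1 (by linarith [hx.2])

lemma ww_le_one {x : ℝ} (hx : x ∈ Icc (0:ℝ) 1) : ww x ≤ 1 := by
  unfold ww; nlinarith [hx.1, hx.2]

lemma ww_pos {x : ℝ} (hx : x ∈ Ioo (0:ℝ) 1) : 0 < ww x :=
  mul_pos hx.1 (by linarith [hx.2])

lemma kap_ge {x y : ℝ} (hx : x ∈ Icc (0:ℝ) 1) (hy : y ∈ Icc (0:ℝ) 1) :
    ww x * ww y ≤ min x y * (1 - max x y) := by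
  have h1 : min x y * max x y = x * y := min_mul_max x y
  have h2 : (1 - min x y) * (1 - max x y) = (1 - x) * (1 - y) := by
    have : min x y + max x y = x + y := min_add_max x y
    linear_combination h1 - this
  have h3 : ww x * ww y = (max x y * (1 - min x y)) * (min x y * (1 - max x y)) := by
    unfold ww
    calc _ = (x * y) * ((1 - x) * (1 - y)) := by ring
      _ = _ := by rw [← h1, ← h2]; ring
  rw [h3]
  have h4 : 0 ≤ min x y := le_min hx.1 hy.1
  have h5 : min x y ≤ 1 := min_le_of_left_le hx.2
  have h6 : 0 ≤ max x y := le_max_of_le_left hx.1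
  have h7 : max x y ≤ 1 := max_le hx.2 hy.2
  apply mul_le_of_le_one_left (kap_nonneg hx hy)
  nlinarith

lemma kap_le_sqrt {x y : ℝ} (hx : x ∈ Icc (0:ℝ) 1) (hy : y ∈ Icc (0:ℝ) 1) :
    min x y * (1 - max x y) ≤ √(ww x) * √(ww y) := by
  rw [← Real.sqrt_mul (ww_nonneg hx)]
  apply Real.le_sqrt_of_sq_le
  rw [sq]
  exact mul_le_mul (kap_le_left hx hy) (kap_le_right hx hy) (kap_nonneg hx hy) (ww_nonneg hx)

/-- constant in kernel bound -/
def wK (b σ : ℝ) : ℝ := wc b σ * (Real.exp b * Real.exp b)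

lemma wc_pos {b σ : ℝ} (hb : 0 ≤ b) (hσ : 0 < σ) : 0 < wc b σ := by
  have := wp_one_pos hb
  unfold wc; positivity

lemma wK_pos {b σ : ℝ} (hb : 0 ≤ b) (hσ : 0 < σ) : 0 < wK b σ := by
  have := wc_pos hb hσ
  unfold wK; positivity

lemma wk_le {b σ x y : ℝ} (hb : 0 ≤ b) (hσ : 0 < σ) (hx : x ∈ Icc (0:ℝ) 1) (hy : y ∈ Icc (0:ℝ) 1) :
    wk b σ x y ≤ wK b σ * (min x y * (1 - max x y)) := by
  have h0 := wc_pos hb hσ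
  have h1 := wkS_le hb hx hy
  have h2 := (kap_nonneg hx hy).trans (wkS_ge hb hx hy)
  have h3 : Real.exp (-(b * y)) ≤ 1 := by
    apply Real.exp_le_one_iff.2; have := hy.1; simp; positivity
  unfold wk wK
  calc _ ≤ wc b σ * wkS b x y * 1 := by gcongr
    _ ≤ wc b σ * (Real.exp b * Real.exp b * (min x y * (1 - max x y))) * 1 := by gcongr
    _ = _ := by ring

lemma wk_nonneg {b σ x y : ℝ} (hb : 0 ≤ b) (hσ : 0 < σ) (hx : x ∈ Icc (0:ℝ) 1) (hy : y ∈ Icc (0:ℝ) 1) :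
    0 ≤ wk b σ x y := by
  have h0 := wc_pos hb hσ
  have h2 := (kap_nonneg hx hy).trans (wkS_ge hb hx hy)
  unfold wk; positivity

lemma wk_ge {b σ x y : ℝ} (hb : 0 ≤ b) (hσ : 0 < σ) (hx : x ∈ Icc (0:ℝ) 1) (hy : y ∈ Icc (0:ℝ) 1) :
    wc b σ * Real.exp (-b) * (ww x * ww y) ≤ wk b σ x y := by
  have h0 := wc_pos hb hσ
  have h1 := (kap_ge hx hy).trans (wkS_ge hb hx hy)
  have h2 := (kap_nonneg hx hy).trans (wkS_ge hb hx hy)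
  have h3 : Real.exp (-b) ≤ Real.exp (-(b * y)) := by
    apply Real.exp_le_exp.2; have := hy.2; nlinarith
  unfold wk
  calc _ ≤ wc b σ * Real.exp (-b) * wkS b x y := by gcongr
    _ ≤ wc b σ * Real.exp (-(b * y)) * wkS b x y := by gcongr
    _ = _ := by ring

lemma wk_zero_left {b σ x y : ℝ} (hx : x = 0 ∨ x = 1) (hy : y ∈ Icc (0:ℝ) 1) : wk b σ x y = 0 := by
  unfold wk wkS
  rcases hx with rfl | rfl
  · rw [min_eq_left hy.1, wp_zero]; ring
  · rw [max_eq_left hy.2]; ring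

/-- outside of the unit interval the kernel is nonpositive -/
lemma wk_nonpos {b σ x y : ℝ} (hb : 0 ≤ b) (hσ : 0 < σ) (hx : x ∉ Icc (0:ℝ) 1) (hy : y ∈ Icc (0:ℝ) 1) :
    wk b σ x y ≤ 0 := by
  have h0 := wc_pos hb hσ
  have h : wkS b x y ≤ 0 := by
    unfold wkS
    by_cases h1 : x < 0
    · rw [min_eq_left (h1.le.trans hy.1), max_eq_right (h1.le.trans hy.1)]
      have := wp_mono b h1.le
      rw [wp_zero] at this
      exact mul_nonpos_of_nonpos_of_nonneg this (by linarith [wp_mono b hy.2])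
    · have h2 : 1 < x := by
        by_contra h3; exact hx ⟨not_lt.1 h1, not_lt.1 h3⟩
      rw [min_eq_right (hy.2.trans h2.le), max_eq_left (hy.2.trans h2.le)]
      have := wp_mono b hy.1
      rw [wp_zero] at this
      exact mul_nonpos_of_nonneg_of_nonpos this (by linarith [wp_mono b h2.le])
  unfold wk
  exact mul_nonpos_of_nonpos_of_nonneg (mul_nonpos_of_nonneg_of_nonpos h0.le h) (Real.exp_nonneg _)

lemma meas_uncurry {Ω : Type*} {m : MeasurableSpace Ω} {X : ℝ → Ω → ℝ}
    (hc : ∀ ω, Continuous fun t => X t ω) (hm : ∀ t, Measurable (X t)) :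
    Measurable fun z : ℝ × Ω => X z.1 z.2 :=
  measurable_uncurry_of_continuous_of_measurable hc hm

lemma meas_J {Ω : Type*} {m : MeasurableSpace Ω} {X : ℝ → Ω → ℝ}
    (hc : ∀ ω, Continuous fun t => X t ω) (a t : ℝ) (hm : ∀ u ≤ t, Measurable (X u))
    {g : ℝ → ℝ} (hg : Measurable g) :
    Measurable fun ω => ∫ u in Ioc a t, g (X u ω) := by
  have h1 : Measurable fun z : ℝ × Ω => X (min z.1 t) z.2 :=
    meas_uncurry (X := fun u ω => X (min u t) ω)
      (fun ω => (hc ω).comp (continuous_id.min continuous_const)) (fun u => hm _ (min_le_right _ _))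
  have h2 : (fun ω => ∫ u in Ioc a t, g (X u ω)) =
      fun ω => ∫ u in Ioc a t, g (X (min u t) ω) := by
    funext ω
    apply setIntegral_congr_fun measurableSet_Ioc
    intro u hu
    simp only [min_eq_left hu.2]
  rw [h2]
  have h3 : StronglyMeasurable fun z : Ω × ℝ => g (X (min z.2 t) z.1) :=
    (hg.comp (h1.comp measurable_swap)).stronglyMeasurable
  exact (h3.integral_prod_right (ν := volume.restrict (Ioc a t))).measurable

lemma bound_J {Ω : Type*} {X : ℝ → Ω → ℝ} {a t : ℝ} (hat : a ≤ t) {g : ℝ → ℝ} {B : ℝ}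
    (hr : ∀ t ω, X t ω ∈ Icc (0:ℝ) 1) (hB : ∀ x ∈ Icc (0:ℝ) 1, |g x| ≤ B) (ω : Ω) :
    |∫ u in Ioc a t, g (X u ω)| ≤ B * (t - a) := by
  have := norm_setIntegral_le_of_norm_le_const (μ := volume) (s := Ioc a t) (C := B)
    (f := fun u => g (X u ω)) (by simp) (fun u _ => hB _ (hr u ω))
  simpa [Real.volume_real_Ioc_of_le hat] using this

lemma integrable_J {Ω : Type*} {X : ℝ → Ω → ℝ} (hc : ∀ ω, Continuous fun t => X t ω)
    {a t : ℝ} {g : ℝ → ℝ} {B : ℝ} (hg : Measurable g)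
    (hr : ∀ t ω, X t ω ∈ Icc (0:ℝ) 1) (hB : ∀ x ∈ Icc (0:ℝ) 1, |g x| ≤ B) (ω : Ω) :
    IntegrableOn (fun u => g (X u ω)) (Ioc a t) := by
  apply Measure.integrableOn_of_bounded (M := B) (by simp)
  · exact (hg.comp (hc ω).measurable).aestronglyMeasurable
  · exact ae_of_all _ fun u => hB _ (hr u ω)

lemma split_J {Ω : Type*} {X : ℝ → Ω → ℝ} (hc : ∀ ω, Continuous fun t => X t ω)
    {a b t : ℝ} (hab : a ≤ b) (hbt : b ≤ t) {g : ℝ → ℝ} {B : ℝ} (hg : Measurable g)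
    (hr : ∀ t ω, X t ω ∈ Icc (0:ℝ) 1) (hB : ∀ x ∈ Icc (0:ℝ) 1, |g x| ≤ B) (ω : Ω) :
    ∫ u in Ioc a t, g (X u ω) = (∫ u in Ioc a b, g (X u ω)) + ∫ u in Ioc b t, g (X u ω) := by
  rw [← setIntegral_union (Ioc_disjoint_Ioc_of_le le_rfl) measurableSet_Ioc
    (integrable_J hc hg hr hB ω) (integrable_J hc hg hr hB ω), Ioc_union_Ioc_eq_Ioc hab hbt]

lemma LWF_cont {f : ℝ → ℝ} (hf : ContDiff ℝ 2 f) : Continuous (LWF s σ f) := by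
  have h1 : Continuous (deriv f) := hf.continuous_deriv (by norm_num)
  have h2 : Continuous (deriv (deriv f)) := by
    have := hf.continuous_iteratedDeriv 2 le_rfl
    simpa [iteratedDeriv_succ, iteratedDeriv_zero] using this
  unfold LWF; fun_prop

lemma bdd_cont {f : ℝ → ℝ} (hf : Continuous f) : ∃ B, 0 ≤ B ∧ ∀ x ∈ Icc (0:ℝ) 1, |f x| ≤ B := by
  obtain ⟨B, hB⟩ := isCompact_Icc.exists_bound_of_continuousOn (s := Icc (0:ℝ) 1) hf.continuousOn
  exact ⟨B, (abs_nonneg _).trans (hB 0 (by simp)), hB⟩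

lemma integrable_of_bdd' {Ω : Type*} {m : MeasurableSpace Ω} {Q : Measure Ω} [IsFiniteMeasure Q]
    {f : Ω → ℝ} (hf : Measurable f) {B : ℝ} (hB : ∀ ω, |f ω| ≤ B) : Integrable f Q :=
  Integrable.of_bound hf.aestronglyMeasurable B (ae_of_all _ hB)

/-- good weighted measures from time `a` on -/
structure WGood (W : WFKilled s σ r μ₀) (Q : Measure W.Ω) (a : ℝ) : Prop where
  fin : IsFiniteMeasure Q
  ac : Q ≪ W.P
  gen : ∀ f : ℝ → ℝ, ContDiff ℝ 2 f → ∀ t u, a ≤ t → t ≤ u →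
    ∫ ω, f (W.X u ω) ∂Q = ∫ ω, f (W.X t ω) ∂Q +
      ∫ ω, (∫ v in Ioc t u, LWF s σ f (W.X v ω)) ∂Q

lemma gen_C2 (W : WFKilled s σ r μ₀) {f : ℝ → ℝ} (hf : ContDiff ℝ 2 f) {a t : ℝ} (ha : 0 ≤ a)
    (hat : a ≤ t) {Z : W.Ω → ℝ} (hZ : Measurable[W.ℱ a] Z) {K : ℝ} (hZb : ∀ ω, |Z ω| ≤ K) :
    ∫ ω, Z ω * f (W.X t ω) ∂W.P = ∫ ω, Z ω * f (W.X a ω) ∂W.P +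
      ∫ ω, Z ω * (∫ v in Ioc a t, LWF s σ f (W.X v ω)) ∂W.P := by
  have hM := W.martProblem f hf
  set M : ℝ → W.Ω → ℝ := fun t ω => f (W.X t ω) - ∫ u in Ioc (0:ℝ) t, LWF s σ f (W.X u ω) with hMdef
  have hZm : Measurable Z := hZ.mono (W.ℱ.le a) le_rfl
  have hLc := LWF_cont (s := s) (σ := σ) hf
  obtain ⟨B, hB0, hB⟩ := bdd_cont hLc
  obtain ⟨B', hB0', hB'⟩ := bdd_cont hf.continuous
  have hJm : ∀ a t, Measurable fun ω => ∫ u in Ioc a t, LWF s σ f (W.X u ω) := fun a t =>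
    meas_J W.contX a t (fun u _ => W.measX u) hLc.measurable
  have hfm : ∀ t, Measurable fun ω => f (W.X t ω) := fun t =>
    hf.continuous.measurable.comp (W.measX t)
  have hJi : ∀ a t, a ≤ t → Integrable (fun ω => Z ω * ∫ u in Ioc a t, LWF s σ f (W.X u ω)) W.P := by
    intro a t hat
    refine integrable_of_bdd' (hZm.mul (hJm a t)) (B := K * (B * (t - a))) fun ω => ?_
    rw [abs_mul]
    exact mul_le_mul (hZb ω) (bound_J hat W.range01 hB ω) (abs_nonneg _)
      ((abs_nonneg _).trans (hZb ω))
  have hfi : ∀ t, Integrable (fun ω => Z ω * f (W.X t ω)) W.P := by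
    intro t
    refine integrable_of_bdd' (hZm.mul (hfm t)) (B := K * B') fun ω => ?_
    rw [abs_mul]
    exact mul_le_mul (hZb ω) (hB' _ (W.range01 _ _)) (abs_nonneg _)
      ((abs_nonneg _).trans (hZb ω))
  have hZM : ∀ t, 0 ≤ t → Integrable (Z * M t) W.P := by
    intro t ht
    have := (hfi t).sub (hJi 0 t ht)
    refine this.congr (ae_of_all _ fun ω => ?_)
    simp only [Pi.mul_apply, Pi.sub_apply, hMdef]; ring
  have key : ∫ ω, (Z * M t) ω ∂W.P = ∫ ω, (Z * M a) ω ∂W.P := by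
    rw [← integral_condExp (W.ℱ.le a) (f := Z * M t)]
    apply integral_congr_ae
    have h1 := condExp_mul_of_stronglyMeasurable_left (μ := W.P) (m := W.ℱ a) hZ.stronglyMeasurable
      (hZM t (ha.trans hat)) (hM.integrable t)
    refine h1.trans ?_
    filter_upwards [hM.2 a t hat] with ω hω
    simp only [Pi.mul_apply, hω]
  have e1 : ∀ t, 0 ≤ t → ∫ ω, (Z * M t) ω ∂W.P = ∫ ω, Z ω * f (W.X t ω) ∂W.P -
      ∫ ω, Z ω * (∫ u in Ioc (0:ℝ) t, LWF s σ f (W.X u ω)) ∂W.P := by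
    intro t ht
    rw [← integral_sub (hfi t) (hJi 0 t ht)]
    apply integral_congr_ae (ae_of_all _ fun ω => ?_)
    simp only [Pi.mul_apply, hMdef]; ring
  rw [e1 t (ha.trans hat), e1 a ha] at key
  have e2 : ∫ ω, Z ω * (∫ u in Ioc (0:ℝ) t, LWF s σ f (W.X u ω)) ∂W.P =
      ∫ ω, Z ω * (∫ u in Ioc (0:ℝ) a, LWF s σ f (W.X u ω)) ∂W.P +
      ∫ ω, Z ω * (∫ u in Ioc a t, LWF s σ f (W.X u ω)) ∂W.P := by
    rw [← integral_add (hJi 0 a ha) (hJi a t hat)]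
    apply integral_congr_ae (ae_of_all _ fun ω => ?_)
    rw [split_J W.contX ha hat hLc.measurable W.range01 hB ω]; ring
  linarith

lemma wgood_of_Z (W : WFKilled s σ r μ₀) {a : ℝ} (ha : 0 ≤ a)
    {Z : W.Ω → ℝ} (hZ : Measurable[W.ℱ a] Z) {K : ℝ} (hZ0 : ∀ ω, 0 ≤ Z ω) (hZb : ∀ ω, Z ω ≤ K) :
    WGood W (W.P.withDensity fun ω => ENNReal.ofReal (Z ω)) a := by
  have hZm : Measurable Z := hZ.mono (W.ℱ.le a) le_rfl
  have hconv : ∀ g : W.Ω → ℝ, ∫ ω, g ω ∂(W.P.withDensity fun ω => ENNReal.ofReal (Z ω)) =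
      ∫ ω, Z ω * g ω ∂W.P := by
    intro g
    rw [integral_withDensity_eq_integral_toReal_smul hZm.ennreal_ofReal
      (ae_of_all _ fun _ => ENNReal.ofReal_lt_top)]
    apply integral_congr_ae (ae_of_all _ fun ω => ?_)
    simp [ENNReal.toReal_ofReal (hZ0 ω)]
  refine ⟨?_, withDensity_absolutelyContinuous _ _, ?_⟩
  · apply isFiniteMeasure_withDensity_ofReal
    exact (integrable_of_bdd' hZm (B := K)
      (fun ω => by rw [abs_of_nonneg (hZ0 ω)]; exact hZb ω)).hasFiniteIntegral
  · intro f hf t u hat htu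
    rw [hconv, hconv, hconv]
    exact gen_C2 W hf (ha.trans hat) htu (hZ.mono (W.ℱ.mono hat) le_rfl)
      (fun ω => by rw [abs_of_nonneg (hZ0 ω)]; exact hZb ω)

lemma wgood_P (W : WFKilled s σ r μ₀) {a : ℝ} (ha : 0 ≤ a) : WGood W W.P a := by
  have := wgood_of_Z W ha (Z := fun _ => 1) measurable_const (K := 1) (by simp) (by simp)
  simpa using this

/-- push a measure through the Green kernel -/
def wN (b σ : ℝ) (m : Measure ℝ) : Measure ℝ :=
  (volume.restrict (Ioc (0:ℝ) 1)).withDensity fun y => ∫⁻ x, ENNReal.ofReal (wk b σ x y) ∂m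

lemma wk_meas (b σ : ℝ) : Measurable fun z : ℝ × ℝ => ENNReal.ofReal (wk b σ z.1 z.2) :=
  (wk_cont b σ).measurable.ennreal_ofReal

lemma wk_meas2 (b σ : ℝ) : Measurable fun z : ℝ × ℝ => ENNReal.ofReal (wk b σ z.2 z.1) :=
  ((wk_cont b σ).comp continuous_swap).measurable.ennreal_ofReal

lemma wk_meas_left (b σ y : ℝ) : Measurable fun x => ENNReal.ofReal (wk b σ x y) :=
  ((wk_cont b σ).comp (by fun_prop : Continuous fun x : ℝ => (x, y))).measurable.ennreal_ofReal

lemma wN_dens_meas (b σ : ℝ) (m : Measure ℝ) [SFinite m] :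
    Measurable fun y => ∫⁻ x, ENNReal.ofReal (wk b σ x y) ∂m :=
  Measurable.lintegral_prod_right' (f := fun z : ℝ × ℝ => ENNReal.ofReal (wk b σ z.2 z.1))
    (wk_meas2 b σ)

lemma wN_lintegral (b σ : ℝ) (m : Measure ℝ) [SFinite m] {q : ℝ → ℝ≥0∞} (hq : Measurable q) :
    ∫⁻ y, q y ∂(wN b σ m) = ∫⁻ x, wG b σ q x ∂m := by
  have h2 : Measurable fun z : ℝ × ℝ => ENNReal.ofReal (wk b σ z.2 z.1) * q z.1 :=
    (wk_meas2 b σ).mul (hq.comp measurable_fst)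
  calc ∫⁻ y, q y ∂(wN b σ m) = ∫⁻ y in Ioc (0:ℝ) 1, ((fun y => ∫⁻ x, ENNReal.ofReal (wk b σ x y) ∂m) * q) y := by
        unfold wN
        exact lintegral_withDensity_eq_lintegral_mul _ (wN_dens_meas b σ m) hq
    _ = ∫⁻ y in Ioc (0:ℝ) 1, ∫⁻ x, ENNReal.ofReal (wk b σ x y) * q y ∂m := by
        apply lintegral_congr
        intro y
        rw [lintegral_mul_const _ (wk_meas_left b σ y), Pi.mul_apply]
    _ = ∫⁻ x, (∫⁻ y in Ioc (0:ℝ) 1, ENNReal.ofReal (wk b σ x y) * q y) ∂m :=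
        lintegral_lintegral_swap (f := fun y x => ENNReal.ofReal (wk b σ x y) * q y)
          h2.aemeasurable

lemma wG_meas (b σ : ℝ) {q : ℝ → ℝ≥0∞} (hq : Measurable q) : Measurable (wG b σ q) := by
  unfold wG
  exact ((wk_meas b σ).mul (hq.comp measurable_snd)).lintegral_prod_right'

lemma wG_le_const {b σ : ℝ} (hb : 0 ≤ b) (hσ : 0 < σ) {q : ℝ → ℝ≥0∞} {c : ℝ≥0∞}
    (hq : ∀ y ∈ Icc (0:ℝ) 1, q y ≤ c) (x : ℝ) : wG b σ q x ≤ ENNReal.ofReal (wK b σ * ww x) * c := by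
  unfold wG
  by_cases hx : x ∈ Icc (0:ℝ) 1
  · calc _ ≤ ∫⁻ y in Ioc (0:ℝ) 1, ENNReal.ofReal (wK b σ * ww x) * c := by
          apply setLIntegral_mono measurable_const
          intro y hy
          have hy' : y ∈ Icc (0:ℝ) 1 := ⟨hy.1.le, hy.2⟩
          gcongr
          · refine (wk_le hb hσ hx hy').trans ?_
            have := wK_pos hb hσ
            have := kap_le_left hx hy'
            gcongr
          · exact hq y hy'
      _ = _ := by simp
  · calc _ ≤ ∫⁻ y in Ioc (0:ℝ) 1, 0 := by
          apply setLIntegral_mono measurable_const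
          intro y hy
          rw [ENNReal.ofReal_of_nonpos (wk_nonpos hb hσ hx ⟨hy.1.le, hy.2⟩)]
          simp
      _ ≤ _ := by simp

lemma wN_finite {b σ : ℝ} (hb : 0 ≤ b) (hσ : 0 < σ) (m : Measure ℝ) [IsFiniteMeasure m]
    : IsFiniteMeasure (wN b σ m) := by
  constructor
  rw [← lintegral_one, wN_lintegral b σ m measurable_const]
  calc _ ≤ ∫⁻ x, ENNReal.ofReal (wK b σ) ∂m := by
        apply lintegral_mono
        intro x
        by_cases hx : x ∈ Icc (0:ℝ) 1
        · refine (wG_le_const (c := 1) hb hσ (by simp) x).trans ?_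
          simp only [mul_one]
          apply ENNReal.ofReal_le_ofReal
          exact mul_le_of_le_one_right (wK_pos hb hσ).le (ww_le_one hx)
        · refine (wG_le_const (c := 1) hb hσ (by simp) x).trans ?_
          rw [ENNReal.ofReal_of_nonpos]
          · simp
          · apply mul_nonpos_of_nonneg_of_nonpos (wK_pos hb hσ).le
            unfold ww
            by_contra h
            push Not at h
            apply hx
            constructor <;> nlinarith
    _ < ⊤ := by simp; exact ENNReal.mul_lt_top (by simp) (by simp)

open BoundedContinuousFunction in
lemma wG_eq_wF {b σ : ℝ} (hb : 0 ≤ b) (hσ : 0 < σ) (q : ℝ →ᵇ ℝ≥0) {x : ℝ} (hx : x ∈ Icc (0:ℝ) 1) :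
    wG b σ (fun y => (q y : ℝ≥0∞)) x = ENNReal.ofReal (wF b σ (fun y => (q y : ℝ)) x) := by
  have hqc : Continuous fun y => (q y : ℝ) := by fun_prop
  have hkx : Continuous fun y => wk b σ x y * (q y : ℝ) :=
    ((wk_cont b σ).comp (by fun_prop : Continuous fun y : ℝ => (x, y))).mul hqc
  rw [wF_eq b σ hqc hx, ofReal_integral_eq_lintegral_ofReal]
  · unfold wG
    apply setLIntegral_congr_fun measurableSet_Ioc
    intro y hy
    simp only []
    rw [ENNReal.ofReal_mul (wk_nonneg hb hσ hx ⟨hy.1.le, hy.2⟩)]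
    simp
  · exact (hkx.integrableOn_Icc).mono_set Ioc_subset_Icc_self
  · refine (ae_restrict_iff' measurableSet_Ioc).2 (ae_of_all _ fun y hy => ?_)
    exact mul_nonneg (wk_nonneg hb hσ hx ⟨hy.1.le, hy.2⟩) (by positivity)

lemma wF_nonneg {b σ : ℝ} (hb : 0 ≤ b) (hσ : 0 < σ) {q : ℝ → ℝ} (hqc : Continuous q)
    (hq : ∀ x, 0 ≤ q x) {x : ℝ} (hx : x ∈ Icc (0:ℝ) 1) : 0 ≤ wF b σ q x := by
  rw [wF_eq b σ hqc hx]
  exact setIntegral_nonneg measurableSet_Ioc fun y hy =>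
    mul_nonneg (wk_nonneg hb hσ hx ⟨hy.1.le, hy.2⟩) (hq y)

open BoundedContinuousFunction in
/-- the core identity -/
lemma core (hs : 0 ≤ s) (hσ : 0 < σ) (W : WFKilled s σ r μ₀) {Q : Measure W.Ω} {a : ℝ}
    (hQ : WGood W Q a) {t u : ℝ} (hat : a ≤ t) (htu : t ≤ u) {q : ℝ → ℝ≥0∞} (hq : Measurable q) :
    ∫⁻ ω, wG (2 * s / σ ^ 2) σ q (W.X u ω) ∂Q +
      ∫⁻ v in Ioc t u, ∫⁻ ω, ENNReal.ofReal (ww (W.X v ω)) * q (W.X v ω) ∂Q =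
    ∫⁻ ω, wG (2 * s / σ ^ 2) σ q (W.X t ω) ∂Q := by
  have hb : 0 ≤ 2 * s / σ ^ 2 := by positivity
  set b := 2 * s / σ ^ 2 with hbdef
  have := hQ.fin
  have hXm := meas_uncurry W.contX W.measX
  have hwm : Measurable fun x => ENNReal.ofReal (ww x) := by unfold ww; fun_prop
  let O : Measure ℝ := (((volume.restrict (Ioc t u)).prod Q).map
    (fun z : ℝ × W.Ω => W.X z.1 z.2)).withDensity (fun x => ENNReal.ofReal (ww x))
  have hO : ∀ q : ℝ → ℝ≥0∞, Measurable q → ∫⁻ x, q x ∂O =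
      ∫⁻ v in Ioc t u, ∫⁻ ω, ENNReal.ofReal (ww (W.X v ω)) * q (W.X v ω) ∂Q := by
    intro q hq
    simp only [O]
    rw [lintegral_withDensity_eq_lintegral_mul _ hwm hq, lintegral_map (hwm.mul hq) hXm,
      lintegral_prod]
    · rfl
    · exact ((hwm.mul hq).comp hXm).aemeasurable
  have hN : ∀ t, ∀ q : ℝ → ℝ≥0∞, Measurable q → ∫⁻ x, q x ∂(wN b σ (Q.map (W.X t))) =
      ∫⁻ ω, wG b σ q (W.X t ω) ∂Q := by
    intro t q hq
    rw [wN_lintegral b σ _ hq, lintegral_map (wG_meas b σ hq) (W.measX t)]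
  have hfin : ∀ t, IsFiniteMeasure (wN b σ (Q.map (W.X t))) := fun t =>
    wN_finite hb hσ _
  have hfinR : IsFiniteMeasure (wN b σ (Q.map (W.X t))) := hfin t
  have main : wN b σ (Q.map (W.X t)) = wN b σ (Q.map (W.X u)) + O := by
    apply ext_of_forall_lintegral_eq_of_IsFiniteMeasure
    intro q
    have hqc : Continuous fun y => (q y : ℝ) := by fun_prop
    have hqm : Measurable fun y => (q y : ℝ≥0∞) := by fun_prop
    have hq0 : ∀ y, (0:ℝ) ≤ q y := fun y => by positivity
    rw [lintegral_add_measure, hN t _ hqm, hN u _ hqm, hO _ hqm]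
    have hF := wF_contDiff b σ hqc
    obtain ⟨B, hB0, hB⟩ := bdd_cont hF.continuous
    have hFi : ∀ t, Integrable (fun ω => wF b σ (fun y => (q y : ℝ)) (W.X t ω)) Q := fun t =>
      integrable_of_bdd' (hF.continuous.measurable.comp (W.measX t)) (B := B)
        fun ω => hB _ (W.range01 _ _)
    have e1 : ∀ t, ∫⁻ ω, wG b σ (fun y => (q y : ℝ≥0∞)) (W.X t ω) ∂Q =
        ENNReal.ofReal (∫ ω, wF b σ (fun y => (q y : ℝ)) (W.X t ω) ∂Q) := by
      intro t
      rw [ofReal_integral_eq_lintegral_ofReal (hFi t)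
        (ae_of_all _ fun ω => wF_nonneg hb hσ hqc hq0 (W.range01 _ _))]
      exact lintegral_congr fun ω => wG_eq_wF hb hσ q (W.range01 _ _)
    have hwq : Continuous fun x => ww x * (q x : ℝ) := by unfold ww; fun_prop
    obtain ⟨B', hB0', hB'⟩ := bdd_cont hwq
    have e2 : ∫⁻ v in Ioc t u, ∫⁻ ω, ENNReal.ofReal (ww (W.X v ω)) * (q (W.X v ω) : ℝ≥0∞) ∂Q =
        ENNReal.ofReal (∫ ω, (∫ v in Ioc t u, ww (W.X v ω) * (q (W.X v ω) : ℝ)) ∂Q) := by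
      rw [ofReal_integral_eq_lintegral_ofReal]
      · rw [lintegral_lintegral_swap]
        · apply lintegral_congr
          intro ω
          rw [ofReal_integral_eq_lintegral_ofReal]
          · apply lintegral_congr
            intro v
            rw [ENNReal.ofReal_mul (ww_nonneg (W.range01 _ _))]
            simp
          · exact integrable_J (g := fun x => ww x * (q x : ℝ)) W.contX hwq.measurable W.range01 hB' ω
          · exact ae_of_all _ fun v => mul_nonneg (ww_nonneg (W.range01 _ _)) (hq0 _)
        · exact ((hwm.mul hqm).comp hXm).aemeasurable
      · exact integrable_of_bdd' (meas_J W.contX t u (fun v _ => W.measX v) hwq.measurable)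
          (bound_J htu W.range01 hB')
      · exact ae_of_all _ fun ω => integral_nonneg fun v =>
          mul_nonneg (ww_nonneg (W.range01 _ _)) (hq0 _)
    rw [e1, e1, e2, ← ENNReal.ofReal_add]
    · congr 1
      have := hQ.gen _ hF t u hat htu
      have hg : ∀ x, LWF s σ (wF b σ (fun y => (q y : ℝ))) x = -(ww x * (q x : ℝ)) :=
        wF_gen s σ hs hσ hqc
      simp only [hg, integral_neg] at this
      linarith
    · exact integral_nonneg fun ω => wF_nonneg hb hσ hqc hq0 (W.range01 _ _)
    · exact integral_nonneg fun ω => integral_nonneg fun v =>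
          mul_nonneg (ww_nonneg (W.range01 _ _)) (hq0 _)
  rw [← hN u q hq, ← hO q hq, ← hN t q hq, main, lintegral_add_measure]

lemma setInt_mart (W : WFKilled s σ r μ₀) {f : ℝ → ℝ} (hf : ContDiff ℝ 2 f)
    (hL : ∀ x ∈ Icc (0:ℝ) 1, LWF s σ f x = 0) {a t : ℝ} (ha : 0 ≤ a) (hat : a ≤ t)
    {A : Set W.Ω} (hA : MeasurableSet[W.ℱ a] A) :
    ∫ ω in A, f (W.X t ω) ∂W.P = ∫ ω in A, f (W.X a ω) ∂W.P := by
  have hA' : MeasurableSet A := W.ℱ.le a A hA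
  have h := gen_C2 W hf ha hat (Z := A.indicator fun _ => 1) (K := 1)
    (measurable_const.indicator hA) (fun ω => by
      by_cases h : ω ∈ A <;> simp [h])
  have h0 : ∀ ω, ∫ v in Ioc a t, LWF s σ f (W.X v ω) = 0 := fun ω => by
    simp [hL _ (W.range01 _ _)]
  simp only [h0, mul_zero, integral_zero, add_zero] at h
  rw [← integral_indicator hA', ← integral_indicator hA']
  have e : ∀ t, (fun ω => A.indicator (fun _ => (1:ℝ)) ω * f (W.X t ω)) =
      A.indicator fun ω => f (W.X t ω) := by
    intro t; funext ω
    by_cases h : ω ∈ A <;> simp [h]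
  rw [e, e] at h
  exact h

lemma grid_bound (W : WFKilled s σ r μ₀) {f : ℝ → ℝ} (hf : ContDiff ℝ 2 f)
    (hL : ∀ x ∈ Icc (0:ℝ) 1, LWF s σ f x = 0) (hf0 : ∀ x ∈ Icc (0:ℝ) 1, 0 ≤ f x)
    {t ε : ℝ} (hε : 0 < ε) (g : ℕ → ℝ) (hg : Monotone g) (hg0 : ∀ k, 0 ≤ g k) (n : ℕ)
    (hgt : ∀ k ≤ n, g k ≤ t) :
    ∫⁻ ω in {ω | ∃ k ≤ n, f (W.X (g k) ω) < ε}, ENNReal.ofReal (f (W.X t ω)) ∂W.P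
      ≤ ENNReal.ofReal ε := by
  let A : ℕ → Set W.Ω := fun k => {ω | f (W.X (g k) ω) < ε} ∩ ⋂ j ∈ Finset.range k, {ω | ε ≤ f (W.X (g j) ω)}
  have hYm : ∀ k, ∀ j ≤ k, Measurable[W.ℱ (g k)] fun ω => f (W.X (g j) ω) := fun k j hj =>
    hf.continuous.measurable.comp ((W.adaptedX (g j)).mono (W.ℱ.mono (hg hj)) le_rfl)
  have hAm : ∀ k, MeasurableSet[W.ℱ (g k)] (A k) := by
    intro k
    refine MeasurableSet.inter ?_ ?_
    · exact hYm k k le_rfl measurableSet_Iio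
    · refine Finset.measurableSet_biInter _ fun j hj => ?_
      exact hYm k j (Finset.mem_range.1 hj).le measurableSet_Ici
  have hAm' : ∀ k, MeasurableSet (A k) := fun k => W.ℱ.le _ _ (hAm k)
  have hdisj : ∀ i j, i < j → Disjoint (A i) (A j) := by
    intro i j hij
    rw [Set.disjoint_left]
    rintro ω ⟨h1, _⟩ ⟨_, h2⟩
    simp only [mem_iInter] at h2
    have := h2 i (Finset.mem_range.2 hij)
    simp only [mem_setOf_eq] at this h1
    linarith
  have hsub : {ω | ∃ k ≤ n, f (W.X (g k) ω) < ε} ⊆ ⋃ k ∈ Finset.range (n + 1), A k := by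
    rintro ω ⟨k, hk, hω⟩
    have hex : ∃ k, f (W.X (g k) ω) < ε := ⟨k, hω⟩
    classical
    simp only [mem_iUnion]
    refine ⟨Nat.find hex, ?_, Nat.find_spec hex, ?_⟩
    · exact Finset.mem_range.2 (Nat.lt_succ_of_le ((Nat.find_min' hex hω).trans hk))
    · simp only [mem_iInter]
      intro j hj
      exact not_lt.1 (Nat.find_min hex (Finset.mem_range.1 hj))
  obtain ⟨B, hB0, hB⟩ := bdd_cont hf.continuous
  have hfi : ∀ t, Integrable (fun ω => f (W.X t ω)) W.P := fun t =>
    integrable_of_bdd' (hf.continuous.measurable.comp (W.measX t)) fun ω => hB _ (W.range01 _ _)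
  calc _ ≤ ∫⁻ ω in ⋃ k ∈ Finset.range (n + 1), A k, ENNReal.ofReal (f (W.X t ω)) ∂W.P :=
        lintegral_mono_set hsub
    _ ≤ ∑ k ∈ Finset.range (n + 1), ∫⁻ ω in A k, ENNReal.ofReal (f (W.X t ω)) ∂W.P := by
        rw [lintegral_biUnion_finset]
        · intro i _ j _ hij
          rcases lt_or_gt_of_ne hij with h | h
          · exact hdisj i j h
          · exact (hdisj j i h).symm
        · exact fun k _ => hAm' k
    _ ≤ ∑ k ∈ Finset.range (n + 1), ENNReal.ofReal ε * W.P (A k) := by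
        apply Finset.sum_le_sum
        intro k hk
        rw [← ofReal_integral_eq_lintegral_ofReal (hfi t).integrableOn
          (ae_of_all _ fun ω => hf0 _ (W.range01 _ _)),
          setInt_mart W hf hL (hg0 k) (hgt k (Nat.lt_succ_iff.1 (Finset.mem_range.1 hk))) (hAm k),
          ofReal_integral_eq_lintegral_ofReal (hfi _).integrableOn
          (ae_of_all _ fun ω => hf0 _ (W.range01 _ _)), ← setLIntegral_const]
        apply setLIntegral_mono measurable_const
        intro ω hω
        exact ENNReal.ofReal_le_ofReal hω.1.le
    _ = ENNReal.ofReal ε * W.P (⋃ k ∈ Finset.range (n + 1), A k) := by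
        rw [← Finset.mul_sum, measure_biUnion_finset]
        · intro i _ j _ hij
          rcases lt_or_gt_of_ne hij with h | h
          · exact hdisj i j h
          · exact (hdisj j i h).symm
        · exact fun k _ => hAm' k
    _ ≤ ENNReal.ofReal ε * 1 := by gcongr; exact prob_le_one
    _ = _ := mul_one _

lemma absorb (W : WFKilled s σ r μ₀) {f : ℝ → ℝ} (hf : ContDiff ℝ 2 f)
    (hL : ∀ x ∈ Icc (0:ℝ) 1, LWF s σ f x = 0) (hf0 : ∀ x ∈ Icc (0:ℝ) 1, 0 ≤ f x)
    {t : ℝ} (ht : 0 ≤ t) :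
    ∀ᵐ ω ∂W.P, (∃ u ∈ Icc (0:ℝ) t, f (W.X u ω) = 0) → f (W.X t ω) = 0 := by
  have hfm : ∀ t, Measurable fun ω => f (W.X t ω) := fun t =>
    hf.continuous.measurable.comp (W.measX t)
  let H : ℕ → ℕ → Set W.Ω := fun m n =>
    {ω | ∃ k ≤ n + 1, f (W.X (t * k / (n + 1)) ω) < 1 / ((m:ℝ) + 1)}
  have hHm : ∀ m n, MeasurableSet (H m n) := by
    intro m n
    have : H m n = ⋃ k ∈ Finset.range (n + 2), {ω | f (W.X (t * k / (n + 1)) ω) < 1 / ((m:ℝ) + 1)} := by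
      ext ω; simp [H, Nat.lt_succ_iff]
    rw [this]
    exact Finset.measurableSet_biUnion _ fun k _ => hfm _ measurableSet_Iio
  let F : ℕ → ℕ → W.Ω → ℝ≥0∞ := fun m n => (H m n).indicator fun ω => ENNReal.ofReal (f (W.X t ω))
  have hFm : ∀ m n, Measurable (F m n) := fun m n => (hfm t).ennreal_ofReal.indicator (hHm m n)
  let G : ℕ → W.Ω → ℝ≥0∞ := fun m ω => liminf (fun n => F m n ω) atTop
  have hGm : ∀ m, Measurable (G m) := fun m => Measurable.liminf (hFm m)
  have hG : ∀ m, ∫⁻ ω, G m ω ∂W.P ≤ ENNReal.ofReal (1 / ((m:ℝ) + 1)) := by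
    intro m
    refine (lintegral_liminf_le (hFm m)).trans ?_
    refine liminf_le_of_le (by isBoundedDefault) ?_
    intro b hb
    obtain ⟨n, hn⟩ := hb.exists
    refine hn.trans ?_
    simp only [F]
    rw [lintegral_indicator (hHm m n)]
    refine grid_bound W hf hL hf0 (by positivity) (fun k : ℕ => t * k / (n + 1)) ?_ ?_ (n + 1) ?_
    · intro i j hij
      have : (i:ℝ) ≤ j := by exact_mod_cast hij
      simp only []
      gcongr
    · intro k; positivity
    · intro k hk
      have : (k:ℝ) ≤ n + 1 := by exact_mod_cast hk
      rw [div_le_iff₀ (by positivity)]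
      gcongr
  have hinf : ∫⁻ ω, (⨅ m, G m ω) ∂W.P = 0 := by
    apply le_antisymm _ (zero_le)
    have hlim : Tendsto (fun m : ℕ => ENNReal.ofReal (1 / ((m:ℝ) + 1))) atTop (𝓝 0) := by
      have := ENNReal.tendsto_ofReal (tendsto_one_div_add_atTop_nhds_zero_nat (𝕜 := ℝ))
      simpa using this
    refine ge_of_tendsto' hlim fun m => ?_
    refine le_trans ?_ (hG m)
    exact lintegral_mono fun ω => iInf_le _ m
  rw [lintegral_eq_zero_iff (Measurable.iInf hGm)] at hinf
  filter_upwards [hinf] with ω hω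
  rintro ⟨u, hu, hfu⟩
  have hge : ∀ m, ENNReal.ofReal (f (W.X t ω)) ≤ G m ω := by
    intro m
    refine le_liminf_of_le (by isBoundedDefault) ?_
    have hc : Continuous fun u => f (W.X u ω) := hf.continuous.comp (W.contX ω)
    have hev : ∀ᶠ v in 𝓝 u, f (W.X v ω) < 1 / ((m:ℝ) + 1) := by
      apply hc.continuousAt.eventually_lt continuousAt_const
      rw [hfu]; positivity
    obtain ⟨δ, hδ, hball⟩ := Metric.eventually_nhds_iff.1 hev
    obtain ⟨N, hN⟩ := exists_nat_gt (t / δ)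
    filter_upwards [eventually_ge_atTop N] with n hn
    have hmem : ω ∈ H m n := by
      have hn' : (N:ℝ) ≤ n := by exact_mod_cast hn
      rcases ht.eq_or_lt with h0 | htpos
      · refine ⟨0, by omega, ?_⟩
        apply hball
        have : u = 0 := le_antisymm (h0 ▸ hu.2) hu.1
        simp [this, hδ]
      · refine ⟨⌊u * (n + 1) / t⌋₊, ?_, ?_⟩
        · apply Nat.floor_le_of_le
          rw [div_le_iff₀ htpos]
          push_cast
          nlinarith [hu.2, hu.1]
        · apply hball
          have h1 := Nat.floor_le (show 0 ≤ u * (n + 1) / t by have := hu.1; positivity)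
          have h2 := Nat.lt_floor_add_one (u * (n + 1) / t)
          set k := ⌊u * (n + 1) / t⌋₊
          have hnp : (0:ℝ) < n + 1 := by positivity
          rw [le_div_iff₀ htpos] at h1
          rw [div_lt_iff₀ htpos] at h2
          have h3 : t * k / (n + 1) ≤ u := by rw [div_le_iff₀ hnp]; linarith
          have h4 : u < t * k / (n + 1) + δ := by
            have : t / δ < n + 1 := by linarith
            rw [div_lt_iff₀ hδ] at this
            have h5 : u < t * (k + 1) / (n + 1) := by rw [lt_div_iff₀ hnp]; linarith
            have h6 : t / (n + 1) < δ := by rw [div_lt_iff₀ hnp]; linarith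
            have h7 : t * (k + 1) / (n + 1) = t * k / (n + 1) + t / (n + 1) := by ring
            linarith
          rw [Real.dist_eq, abs_lt]
          constructor <;> linarith
    simp [F, hmem]
  have h0 : ENNReal.ofReal (f (W.X t ω)) ≤ 0 := by
    have : (⨅ m, G m ω) = 0 := hω
    rw [← this]
    exact le_iInf hge
  exact le_antisymm (ENNReal.ofReal_eq_zero.1 (le_antisymm h0 zero_le)) (hf0 _ (W.range01 _ _))

lemma abs0 (hs : 0 ≤ s) (hσ : 0 < σ) (W : WFKilled s σ r μ₀) {t : ℝ} (ht : 0 ≤ t) :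
    ∀ᵐ ω ∂W.P, (∃ u ∈ Icc (0:ℝ) t, W.X u ω = 0) → W.X t ω = 0 := by
  have hb : 0 ≤ 2 * s / σ ^ 2 := by positivity
  have hlow : ∀ x ∈ Icc (0:ℝ) 1, x ≤ wp (2 * s / σ ^ 2) x := fun x hx => by
    have := wp_sub_lower hb le_rfl hx.1
    rw [wp_zero] at this; linarith
  filter_upwards [absorb W (wp_contDiff (2 * s / σ ^ 2)) (fun x _ => wp_gen s σ hσ x)
    (fun x hx => hx.1.trans (hlow x hx)) ht] with ω hω
  rintro ⟨u, hu, h⟩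
  have := hω ⟨u, hu, by rw [h, wp_zero]⟩
  exact le_antisymm (this ▸ hlow _ (W.range01 _ _)) (W.range01 _ _).1

lemma abs1 (hs : 0 ≤ s) (hσ : 0 < σ) (W : WFKilled s σ r μ₀) {t : ℝ} (ht : 0 ≤ t) :
    ∀ᵐ ω ∂W.P, (∃ u ∈ Icc (0:ℝ) t, W.X u ω = 1) → W.X t ω = 1 := by
  have hb : 0 ≤ 2 * s / σ ^ 2 := by positivity
  set b := 2 * s / σ ^ 2 with hbd
  have hlow : ∀ x ∈ Icc (0:ℝ) 1, 1 - x ≤ wp b 1 - wp b x := fun x hx =>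
    wp_sub_lower hb hx.1 hx.2
  filter_upwards [absorb W (f := fun x => wp b 1 - wp b x) (contDiff_const.sub (wp_contDiff b))
    (fun x _ => wcp_gen s σ _ hσ x)
    (fun x hx => (sub_nonneg.2 hx.2).trans (hlow x hx)) ht] with ω hω
  rintro ⟨u, hu, h⟩
  have := hω ⟨u, hu, by rw [h, sub_self]⟩
  have h2 := hlow _ (W.range01 t ω)
  rw [this] at h2
  linarith [(W.range01 t ω).2]

lemma Ioo_of_ne {x : ℝ} (hx : x ∈ Icc (0:ℝ) 1) : x ∈ Ioo (0:ℝ) 1 ↔ x ≠ 0 ∧ x ≠ 1 := by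
  constructor
  · intro h; exact ⟨h.1.ne', h.2.ne⟩
  · rintro ⟨h1, h2⟩; exact ⟨lt_of_le_of_ne hx.1 h1.symm, lt_of_le_of_ne hx.2 h2⟩

lemma mono_Ioo (hs : 0 ≤ s) (hσ : 0 < σ) (W : WFKilled s σ r μ₀) {Q : Measure W.Ω} (hQ : Q ≪ W.P)
    {u t : ℝ} (hu : 0 ≤ u) (hut : u ≤ t) :
    Q {ω | W.X t ω ∈ Ioo (0:ℝ) 1} ≤ Q {ω | W.X u ω ∈ Ioo (0:ℝ) 1} := by
  apply measure_mono_ae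
  filter_upwards [hQ.ae_le (abs0 hs hσ W (hu.trans hut)), hQ.ae_le (abs1 hs hσ W (hu.trans hut))] with ω h0 h1
  intro h
  have h' : W.X t ω ∈ Ioo (0:ℝ) 1 := h
  rw [Ioo_of_ne (W.range01 _ _)] at h'
  change W.X u ω ∈ Ioo (0:ℝ) 1
  rw [Ioo_of_ne (W.range01 _ _)]
  exact ⟨fun h => h'.1 (h0 ⟨u, ⟨hu, hut⟩, h⟩), fun h => h'.2 (h1 ⟨u, ⟨hu, hut⟩, h⟩)⟩

/-- the integral of `1/√(x(1-x))` -/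
def wS : ℝ≥0∞ := ∫⁻ y in Ioc (0:ℝ) 1, ENNReal.ofReal ((√(ww y))⁻¹)

lemma wS_ne_top : wS ≠ ⊤ := by
  have h1 : IntegrableOn (fun y : ℝ => y ^ (-(1/2) : ℝ)) (Ioc 0 1) := by
    have := (intervalIntegral.intervalIntegrable_rpow' (r := -(1/2)) (a := 0) (b := 1) (by norm_num))
    rwa [intervalIntegrable_iff_integrableOn_Ioc_of_le zero_le_one] at this
  have h2 : IntegrableOn (fun y : ℝ => (1 - y) ^ (-(1/2) : ℝ)) (Ioc 0 1) := by
    have := (intervalIntegral.intervalIntegrable_rpow' (r := -(1/2)) (a := 0) (b := 1) (by norm_num)).comp_sub_left 1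
    simp only [sub_zero, sub_self] at this
    have := this.symm
    rwa [intervalIntegrable_iff_integrableOn_Ioc_of_le zero_le_one] at this
  have h3 := (h1.add h2).lintegral_lt_top
  refine ne_top_of_le_ne_top h3.ne ?_
  apply setLIntegral_mono_ae' measurableSet_Ioc
  refine ae_of_all _ fun y hy => ENNReal.ofReal_le_ofReal ?_
  have hy0 := hy.1
  rcases hy.2.eq_or_lt with h | h
  · subst h; simp [ww]
  · have h' : 0 < 1 - y := by linarith
    simp only [Pi.add_apply]
    rw [Real.rpow_neg hy0.le, Real.rpow_neg h'.le, ← Real.sqrt_eq_rpow, ← Real.sqrt_eq_rpow]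
    unfold ww
    rw [Real.sqrt_mul hy0.le]
    have e1 : √y ≤ 1 := Real.sqrt_le_one.2 hy.2
    have e2 : 0 < √y := Real.sqrt_pos.2 hy0
    have e3 : 0 < √(1-y) := Real.sqrt_pos.2 h'
    have e4 : √y ^ 2 = y := Real.sq_sqrt hy0.le
    have e5 : √(1-y) ^ 2 = 1 - y := Real.sq_sqrt h'.le
    have : (√y)⁻¹ + (√(1-y))⁻¹ = (√y + √(1-y)) * (√y * √(1-y))⁻¹ := by field_simp; ring
    rw [this]
    apply le_mul_of_one_le_left (by positivity)
    nlinarith [mul_pos e2 e3]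

/-- first test function -/
def wq1 : ℝ → ℝ≥0∞ := (Ioo (0:ℝ) 1).indicator fun y => ENNReal.ofReal ((ww y)⁻¹)

/-- second test function -/
def wq2 (b σ : ℝ) (y : ℝ) : ℝ≥0∞ := wq1 y * wG b σ wq1 y

lemma wq1_meas : Measurable wq1 := by
  unfold wq1 ww
  exact (by fun_prop : Measurable _).indicator measurableSet_Ioo

lemma wq2_meas (b σ : ℝ) : Measurable (wq2 b σ) := wq1_meas.mul (wG_meas b σ wq1_meas)

lemma ww_wq1 (x : ℝ) : ENNReal.ofReal (ww x) * wq1 x = (Ioo (0:ℝ) 1).indicator (fun _ => 1) x := by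
  unfold wq1
  by_cases h : x ∈ Ioo (0:ℝ) 1
  · have := ww_pos h
    simp only [h, indicator_of_mem]
    rw [← ENNReal.ofReal_mul this.le, mul_inv_cancel₀ this.ne']; simp
  · simp [h]

lemma wG_wq1_le {b σ : ℝ} (hb : 0 ≤ b) (hσ : 0 < σ) {x : ℝ} (hx : x ∈ Icc (0:ℝ) 1) :
    wG b σ wq1 x ≤ ENNReal.ofReal (wK b σ * √(ww x)) * wS := by
  have hK := wK_pos hb hσ
  unfold wG wS
  rw [← lintegral_const_mul' _ _ (by simp)]
  apply setLIntegral_mono_ae' measurableSet_Ioc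
  refine ae_of_all _ fun y hy => ?_
  by_cases h : y ∈ Ioo (0:ℝ) 1
  · have hw := ww_pos h
    have hy' : y ∈ Icc (0:ℝ) 1 := ⟨hy.1.le, hy.2⟩
    unfold wq1
    simp only [h, indicator_of_mem]
    rw [← ENNReal.ofReal_mul (wk_nonneg hb hσ hx hy'), ← ENNReal.ofReal_mul (by positivity)]
    apply ENNReal.ofReal_le_ofReal
    have h1 := (wk_le hb hσ hx hy').trans (mul_le_mul_of_nonneg_left (kap_le_sqrt hx hy') hK.le)
    have h2 : (ww y)⁻¹ = (√(ww y))⁻¹ * (√(ww y))⁻¹ := by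
      rw [← mul_inv, Real.mul_self_sqrt hw.le]
    have h3 : 0 < √(ww y) := Real.sqrt_pos.2 hw
    calc _ ≤ wK b σ * (√(ww x) * √(ww y)) * (ww y)⁻¹ := by gcongr
      _ = _ := by rw [h2]; field_simp
  · simp [wq1, h]

/-- constant of lemma D -/
def wCD (b σ : ℝ) : ℝ≥0∞ := ENNReal.ofReal (wK b σ) * (ENNReal.ofReal (wK b σ) * wS * wS)

lemma wCD_ne_top (b σ : ℝ) : wCD b σ ≠ ⊤ := by
  unfold wCD
  have := wS_ne_top
  finiteness

lemma wG_wq2_le {b σ : ℝ} (hb : 0 ≤ b) (hσ : 0 < σ) {x : ℝ} (hx : x ∈ Icc (0:ℝ) 1) :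
    wG b σ (wq2 b σ) x ≤ wCD b σ * ENNReal.ofReal (ww x) := by
  have hK := wK_pos hb hσ
  have hC : wCD b σ * ENNReal.ofReal (ww x) =
    (ENNReal.ofReal (wK b σ * ww x) * (ENNReal.ofReal (wK b σ) * wS)) * wS := by
    rw [ENNReal.ofReal_mul hK.le]; unfold wCD; ring
  rw [hC]
  unfold wG
  conv_rhs => rw [wS]
  have := wS_ne_top
  rw [← lintegral_const_mul' _ _ (by finiteness)]
  apply setLIntegral_mono_ae' measurableSet_Ioc
  refine ae_of_all _ fun y hy => ?_
  have hy' : y ∈ Icc (0:ℝ) 1 := ⟨hy.1.le, hy.2⟩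
  rw [mul_assoc]
  apply mul_le_mul'
  · apply ENNReal.ofReal_le_ofReal
    exact (wk_le hb hσ hx hy').trans (mul_le_mul_of_nonneg_left (kap_le_left hx hy') hK.le)
  · by_cases h : y ∈ Ioo (0:ℝ) 1
    · have hw := ww_pos h
      unfold wq2
      calc _ ≤ wq1 y * (ENNReal.ofReal (wK b σ * √(ww y)) * wS) := by
            gcongr; exact wG_wq1_le hb hσ hy'
        _ = ENNReal.ofReal ((ww y)⁻¹ * √(ww y)) * (ENNReal.ofReal (wK b σ) * wS) := by
            rw [ENNReal.ofReal_mul hK.le, ENNReal.ofReal_mul (by positivity)]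
            unfold wq1
            simp only [h, indicator_of_mem]
            ring
        _ = _ := by
            rw [mul_comm]
            congr 2
            have h3 : 0 < √(ww y) := Real.sqrt_pos.2 hw
            have h2 : (ww y)⁻¹ = (√(ww y))⁻¹ * (√(ww y))⁻¹ := by
              rw [← mul_inv, Real.mul_self_sqrt hw.le]
            rw [h2]; field_simp
    · simp [wq2, wq1, h]

lemma ww_wq2 {b σ x : ℝ} (hx : x ∈ Icc (0:ℝ) 1) :
    ENNReal.ofReal (ww x) * wq2 b σ x = wG b σ wq1 x := by
  unfold wq2
  rw [← mul_assoc, ww_wq1]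
  by_cases h : x ∈ Ioo (0:ℝ) 1
  · simp [h]
  · have hx' : x = 0 ∨ x = 1 := by
      by_contra h'
      push Not at h'
      exact h ((Ioo_of_ne hx).2 h')
    simp only [h, not_false_eq_true, indicator_of_notMem, zero_mul]
    unfold wG
    symm
    rw [← nonpos_iff_eq_zero]
    calc _ ≤ ∫⁻ y in Ioc (0:ℝ) 1, 0 := by
          apply setLIntegral_mono measurable_const
          intro y hy
          rw [wk_zero_left hx' ⟨hy.1.le, hy.2⟩]; simp
      _ = 0 := by simp

lemma lemmaD (hs : 0 ≤ s) (hσ : 0 < σ) (W : WFKilled s σ r μ₀) {Q : Measure W.Ω} {a : ℝ}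
    (ha : 0 ≤ a) (hQ : WGood W Q a) {T : ℝ} (hT : 0 ≤ T) :
    ENNReal.ofReal T * Q {ω | W.X (a + 1 + T) ω ∈ Ioo (0:ℝ) 1} ≤
      wCD (2 * s / σ ^ 2) σ * ∫⁻ ω, ENNReal.ofReal (ww (W.X a ω)) ∂Q := by
  have hb : 0 ≤ 2 * s / σ ^ 2 := by positivity
  set b := 2 * s / σ ^ 2 with hbdef
  calc _ = ∫⁻ v in Ioc (a + 1) (a + 1 + T), Q {ω | W.X (a + 1 + T) ω ∈ Ioo (0:ℝ) 1} := by
        rw [setLIntegral_const, Real.volume_Ioc, mul_comm]; congr 2; ring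
    _ ≤ ∫⁻ v in Ioc (a + 1) (a + 1 + T), ∫⁻ ω, ENNReal.ofReal (ww (W.X v ω)) * wq1 (W.X v ω) ∂Q := by
        apply setLIntegral_mono_ae' measurableSet_Ioc
        refine ae_of_all _ fun v hv => ?_
        refine (mono_Ioo hs hσ W hQ.ac (by linarith [hv.1]) hv.2).trans ?_
        simp_rw [ww_wq1]
        change Q (W.X v ⁻¹' Ioo (0:ℝ) 1) ≤ _
        rw [← lintegral_indicator_one (W.measX v measurableSet_Ioo)]
        exact le_of_eq rfl
    _ ≤ ∫⁻ ω, wG b σ wq1 (W.X (a + 1) ω) ∂Q := by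
        rw [← core hs hσ W hQ (t := a + 1) (u := a + 1 + T) (by linarith) (by linarith) wq1_meas]
        exact le_add_self
    _ = ∫⁻ v in Ioc a (a + 1), ∫⁻ ω, wG b σ wq1 (W.X (a + 1) ω) ∂Q := by
        rw [setLIntegral_const, Real.volume_Ioc]; simp
    _ ≤ ∫⁻ v in Ioc a (a + 1), ∫⁻ ω, ENNReal.ofReal (ww (W.X v ω)) * wq2 b σ (W.X v ω) ∂Q := by
        apply setLIntegral_mono_ae' measurableSet_Ioc
        refine ae_of_all _ fun v hv => ?_
        simp_rw [ww_wq2 (W.range01 _ _)]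
        rw [← core hs hσ W hQ (t := v) (u := a + 1) hv.1.le hv.2 wq1_meas]
        exact le_self_add
    _ ≤ ∫⁻ ω, wG b σ (wq2 b σ) (W.X a ω) ∂Q := by
        rw [← core hs hσ W hQ (t := a) (u := a + 1) le_rfl (by linarith) (wq2_meas b σ)]
        exact le_add_self
    _ ≤ ∫⁻ ω, wCD b σ * ENNReal.ofReal (ww (W.X a ω)) ∂Q :=
        lintegral_mono fun ω => wG_wq2_le hb hσ (W.range01 _ _)
    _ = _ := lintegral_const_mul' _ _ (wCD_ne_top b σ)

lemma bddInt {g : ℝ → ℝ} (hg : Measurable g) {B : ℝ} (hB : ∀ x, |g x| ≤ B) (a t : ℝ) :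
    IntegrableOn g (Ioc a t) :=
  Measure.integrableOn_of_bounded (M := B) (by simp) hg.aestronglyMeasurable (ae_of_all _ hB)

lemma Iprim_cont {g : ℝ → ℝ} (hg : Measurable g) {B : ℝ} (hB : ∀ x, |g x| ≤ B) :
    Continuous fun t => ∫ u in Ioc (0:ℝ) t, g u := by
  have h1 : (fun t => ∫ u in Ioc (0:ℝ) t, g u) = fun t => ∫ u in (0:ℝ)..(max t 0), g u := by
    funext t
    rw [intervalIntegral.integral_of_le (le_max_right _ _)]
    rcases le_total t 0 with h | h
    · simp [h]
    · simp [h]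
  rw [h1]
  have h2 : Continuous fun t => ∫ u in (0:ℝ)..t, g u :=
    intervalIntegral.continuous_primitive (fun a b => by
      rw [intervalIntegrable_iff]; exact bddInt hg hB _ _) 0
  exact h2.comp (by fun_prop)

lemma exp_path {g : ℝ → ℝ} (hg : Measurable g) {B : ℝ} (hB : ∀ x, |g x| ≤ B) {t : ℝ} (ht : 0 ≤ t) :
    Real.exp (∫ u in Ioc (0:ℝ) t, g u) =
      1 + ∫ u in Ioc (0:ℝ) t, g u * Real.exp (∫ v in Ioc (0:ℝ) u, g v) := by
  have hB0 : 0 ≤ B := (abs_nonneg _).trans (hB 0)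
  have hii : ∀ a b, IntervalIntegrable g volume a b := fun a b => by
    rw [intervalIntegrable_iff]; exact bddInt hg hB _ _
  set A : ℝ → ℝ := fun t => ∫ u in (0:ℝ)..t, g u with hA
  have hAe : ∀ u, 0 ≤ u → ∫ v in Ioc (0:ℝ) u, g v = A u := fun u hu => by
    rw [hA]; simp only []; rw [intervalIntegral.integral_of_le hu]
  have hLip : LipschitzWith (Real.toNNReal B) A := by
    apply LipschitzWith.of_dist_le_mul
    intro x y
    rw [Real.dist_eq, Real.dist_eq, Real.coe_toNNReal _ hB0, hA]
    simp only []
    rw [intervalIntegral.integral_interval_sub_left (hii _ _) (hii _ _)]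
    exact intervalIntegral.norm_integral_le_of_norm_le_const (f := g) (C := B) (fun z _ => hB z)
  have hAC : AbsolutelyContinuousOnInterval (fun u => Real.exp (A u)) 0 t := by
    have hexp : ∃ K, LipschitzOnWith K Real.exp (Icc (-(B*t)) (B*t)) := by
      have := (Real.contDiff_exp (n := 1)).contDiffOn (s := Icc (-(B*t)) (B*t))
      exact this.exists_lipschitzOnWith (by norm_num) (convex_Icc _ _) isCompact_Icc
    obtain ⟨K, hK⟩ := hexp
    apply LipschitzOnWith.absolutelyContinuousOnInterval (K := K * Real.toNNReal B)
    apply hK.comp (hLip.lipschitzOnWith)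
    intro u hu
    rw [uIcc_of_le ht] at hu
    have h0 : A 0 = 0 := by simp [hA]
    have := hLip.dist_le_mul u 0
    rw [h0, Real.dist_eq, Real.dist_eq, Real.coe_toNNReal _ hB0, sub_zero, sub_zero, abs_of_nonneg hu.1] at this
    have := this.trans (mul_le_mul_of_nonneg_left hu.2 hB0)
    exact abs_le.1 this
  have h1 := hAC.integral_deriv_eq_sub
  have h2 : ∫ u in (0:ℝ)..t, deriv (fun u => Real.exp (A u)) u =
      ∫ u in Ioc (0:ℝ) t, g u * Real.exp (∫ v in Ioc (0:ℝ) u, g v) := by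
    rw [intervalIntegral.integral_of_le ht]
    apply setIntegral_congr_ae measurableSet_Ioc
    filter_upwards [(hii 0 t).ae_hasDerivAt_integral] with u hu hu'
    have := hu (by rw [uIcc_of_le ht]; exact Ioc_subset_Icc_self hu') 0 (by simp)
    rw [(this.exp).deriv, hAe u hu'.1.le, mul_comm]
  rw [hAe t ht, ← h2, h1]
  simp [hA]

/-- exponential weight -/
def WFKilled.wE (W : WFKilled s σ r μ₀) (a : ℝ → ℝ) (t : ℝ) (ω : W.Ω) : ℝ :=
  Real.exp (∫ u in Ioc (0:ℝ) t, a (W.X u ω))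

lemma adX (W : WFKilled s σ r μ₀) (u : ℝ) : Measurable[W.ℱ u] (W.X u) := W.adaptedX u

lemma wE_measF (W : WFKilled s σ r μ₀) {a : ℝ → ℝ} (ha : Measurable a) (t : ℝ) :
    Measurable[W.ℱ t] (W.wE a t) :=
  Real.measurable_exp.comp (meas_J W.contX 0 t
    (fun u hu => (adX W u).mono (W.ℱ.mono hu) le_rfl) ha)

lemma wE_meas (W : WFKilled s σ r μ₀) {a : ℝ → ℝ} (ha : Measurable a) (t : ℝ) :
    Measurable (W.wE a t) := (wE_measF W ha t).mono (W.ℱ.le t) le_rfl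

lemma wE_pos (W : WFKilled s σ r μ₀) {a : ℝ → ℝ} (t : ℝ) (ω : W.Ω) : 0 < W.wE a t ω :=
  Real.exp_pos _

lemma wE_le (W : WFKilled s σ r μ₀) {a : ℝ → ℝ} {B : ℝ} (hB : ∀ x ∈ Icc (0:ℝ) 1, |a x| ≤ B)
    {t : ℝ} (ht : 0 ≤ t) (ω : W.Ω) : W.wE a t ω ≤ Real.exp (B * t) := by
  apply Real.exp_le_exp.2
  have := bound_J ht W.range01 hB ω
  rw [sub_zero] at this
  exact (le_abs_self _).trans this

lemma wE_ge (W : WFKilled s σ r μ₀) {a : ℝ → ℝ} {B : ℝ} (hB : ∀ x ∈ Icc (0:ℝ) 1, |a x| ≤ B)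
    {t : ℝ} (ht : 0 ≤ t) (ω : W.Ω) : Real.exp (-(B * t)) ≤ W.wE a t ω := by
  apply Real.exp_le_exp.2
  have := bound_J ht W.range01 hB ω
  rw [sub_zero] at this
  linarith [neg_abs_le (∫ u in Ioc (0:ℝ) t, a (W.X u ω))]

lemma wE_meas2 (W : WFKilled s σ r μ₀) {a : ℝ → ℝ} (ha : Measurable a) {B : ℝ}
    (hB : ∀ x ∈ Icc (0:ℝ) 1, |a x| ≤ B) : Measurable fun z : ℝ × W.Ω => W.wE a z.1 z.2 := by
  apply measurable_uncurry_of_continuous_of_measurable (u := fun t ω => W.wE a t ω)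
  · intro ω
    exact Real.continuous_exp.comp (Iprim_cont (ha.comp (W.contX ω).measurable)
      (fun u => hB _ (W.range01 u ω)))
  · intro t; exact wE_meas W ha t

lemma wE_path (W : WFKilled s σ r μ₀) {a : ℝ → ℝ} (ha : Measurable a) {B : ℝ}
    (hB : ∀ x ∈ Icc (0:ℝ) 1, |a x| ≤ B) {t : ℝ} (ht : 0 ≤ t) (ω : W.Ω) :
    W.wE a t ω = 1 + ∫ u in Ioc (0:ℝ) t, a (W.X u ω) * W.wE a u ω :=
  exp_path (ha.comp (W.contX ω).measurable) (fun u => hB _ (W.range01 u ω)) ht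

/-- generator pairs -/
structure GP (W : WFKilled s σ r μ₀) (f l : ℝ → ℝ) : Prop where
  mf : Measurable f
  ml : Measurable l
  bf : ∃ B, ∀ x ∈ Icc (0:ℝ) 1, |f x| ≤ B
  bl : ∃ B, ∀ x ∈ Icc (0:ℝ) 1, |l x| ≤ B
  gen : ∀ u t, 0 ≤ u → u ≤ t → ∀ Z : W.Ω → ℝ, Measurable[W.ℱ u] Z → (∃ K, ∀ ω, |Z ω| ≤ K) →
    ∫ ω, Z ω * f (W.X t ω) ∂W.P = ∫ ω, Z ω * f (W.X u ω) ∂W.P +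
      ∫ ω, Z ω * (∫ v in Ioc u t, l (W.X v ω)) ∂W.P

lemma triangle {p l : ℝ → ℝ} (hp : Measurable p) (hl : Measurable l) {B C : ℝ}
    {t : ℝ} (hB : ∀ x ∈ Ioc 0 t, |p x| ≤ B) (hC : ∀ x, |l x| ≤ C) :
    ∫ u in Ioc (0:ℝ) t, p u * ∫ v in Ioc u t, l v =
      ∫ v in Ioc (0:ℝ) t, l v * ∫ u in Ioc (0:ℝ) v, p u := by
  let F : ℝ → ℝ → ℝ := fun u v => if u < v then p u * l v else 0
  have hFm : Measurable (Function.uncurry F) := by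
    apply Measurable.ite (measurableSet_lt measurable_fst measurable_snd)
    · exact (hp.comp measurable_fst).mul (hl.comp measurable_snd)
    · exact measurable_const
  have hsw := integral_integral_swap (f := F) (μ := volume.restrict (Ioc (0:ℝ) t))
    (ν := volume.restrict (Ioc (0:ℝ) t)) (by
      apply Integrable.of_bound hFm.aestronglyMeasurable (B * C)
      rw [Measure.prod_restrict]
      refine (ae_restrict_iff' (measurableSet_Ioc.prod measurableSet_Ioc)).2 (ae_of_all _ ?_)
      rintro ⟨u, v⟩ ⟨hu, hv⟩
      simp only [Function.uncurry, F]
      have hB0 : 0 ≤ B := (abs_nonneg _).trans (hB u hu)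
      have hC0 : 0 ≤ C := (abs_nonneg _).trans (hC v)
      split_ifs
      · rw [Real.norm_eq_abs, abs_mul]
        exact mul_le_mul (hB u hu) (hC v) (abs_nonneg _) hB0
      · simp; positivity)
  have e1 : ∫ u in Ioc (0:ℝ) t, p u * ∫ v in Ioc u t, l v =
      ∫ u in Ioc (0:ℝ) t, ∫ v in Ioc (0:ℝ) t, F u v := by
    apply setIntegral_congr_fun measurableSet_Ioc
    intro u hu
    simp only []
    rw [← integral_const_mul]
    have : Ioc u t = Ioc 0 t ∩ Ioi u := by
      ext v; simp only [mem_Ioc, mem_inter_iff, mem_Ioi]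
      constructor
      · rintro ⟨h1, h2⟩; exact ⟨⟨hu.1.trans h1, h2⟩, h1⟩
      · rintro ⟨⟨_, h2⟩, h1⟩; exact ⟨h1, h2⟩
    rw [this, ← setIntegral_indicator measurableSet_Ioi]
    apply integral_congr_ae (ae_of_all _ fun v => ?_)
    simp [F, indicator]
  have e2 : ∫ v in Ioc (0:ℝ) t, l v * ∫ u in Ioc (0:ℝ) v, p u =
      ∫ v in Ioc (0:ℝ) t, ∫ u in Ioc (0:ℝ) t, F u v := by
    apply setIntegral_congr_fun measurableSet_Ioc
    intro v hv
    simp only []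
    rw [← integral_const_mul, integral_Ioc_eq_integral_Ioo]
    have : Ioo 0 v = Ioc 0 t ∩ Iio v := by
      ext u; simp only [mem_Ioo, mem_Ioc, mem_inter_iff, mem_Iio]
      constructor
      · rintro ⟨h1, h2⟩; exact ⟨⟨h1, h2.le.trans hv.2⟩, h2⟩
      · rintro ⟨⟨h1, _⟩, h2⟩; exact ⟨h1, h2⟩
    rw [this, ← setIntegral_indicator measurableSet_Iio]
    apply integral_congr_ae (ae_of_all _ fun u => ?_)
    simp [F, indicator, mul_comm]
  rw [e1, e2, hsw]

lemma FK (W : WFKilled s σ r μ₀) {f l a : ℝ → ℝ} (h : GP W f l) (ha : Measurable a) {B : ℝ}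
    (hB : ∀ x ∈ Icc (0:ℝ) 1, |a x| ≤ B) {t : ℝ} (ht : 0 ≤ t) :
    ∫ ω, W.wE a t ω * f (W.X t ω) ∂W.P = ∫ ω, f (W.X 0 ω) ∂W.P +
      ∫ v in Ioc (0:ℝ) t, ∫ ω, W.wE a v ω * (l (W.X v ω) + a (W.X v ω) * f (W.X v ω)) ∂W.P := by
  obtain ⟨Bf, hBf⟩ := h.bf
  obtain ⟨Bl, hBl⟩ := h.bl
  have hXm := meas_uncurry W.contX W.measX
  have hEm := wE_meas2 W ha hB
  have hB0 : 0 ≤ B := (abs_nonneg _).trans (hB 0 (by simp))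
  have hBf0 : 0 ≤ Bf := (abs_nonneg _).trans (hBf 0 (by simp))
  have hBl0 : 0 ≤ Bl := (abs_nonneg _).trans (hBl 0 (by simp))
  set K := Real.exp (B * t) with hK
  have hK0 : 0 < K := Real.exp_pos _
  have hEle : ∀ u ∈ Icc 0 t, ∀ ω, |W.wE a u ω| ≤ K := by
    intro u hu ω
    rw [abs_of_pos (wE_pos W u ω)]
    refine (wE_le W hB hu.1 ω).trans (Real.exp_le_exp.2 ?_)
    exact mul_le_mul_of_nonneg_left hu.2 hB0
  -- integrability on the product
  have hprod : ∀ G : ℝ × W.Ω → ℝ, Measurable G → ∀ C, (∀ u ∈ Ioc 0 t, ∀ ω, |G (u, ω)| ≤ C) →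
      Integrable G ((volume.restrict (Ioc (0:ℝ) t)).prod W.P) := by
    intro G hG C hC
    apply Integrable.of_bound hG.aestronglyMeasurable C
    have : (volume.restrict (Ioc (0:ℝ) t)).prod W.P = (volume.prod W.P).restrict (Ioc 0 t ×ˢ univ) := by
      rw [← Measure.prod_restrict, Measure.restrict_univ]
    rw [this]
    refine (ae_restrict_iff' (measurableSet_Ioc.prod MeasurableSet.univ)).2 (ae_of_all _ ?_)
    rintro ⟨u, ω⟩ ⟨hu, -⟩
    exact hC u hu ω
  have hap : Measurable fun z : ℝ × W.Ω => a (W.X z.1 z.2) := ha.comp hXm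
  have hfp : Measurable fun z : ℝ × W.Ω => f (W.X z.1 z.2) := h.mf.comp hXm
  have hlp : Measurable fun z : ℝ × W.Ω => l (W.X z.1 z.2) := h.ml.comp hXm
  have hft : Measurable fun z : ℝ × W.Ω => f (W.X t z.2) := h.mf.comp ((W.measX t).comp measurable_snd)
  have hap' := fun u => ha.comp (W.measX u)
  have hp : Measurable fun z : ℝ × W.Ω => a (W.X z.1 z.2) * W.wE a z.1 z.2 := hap.mul hEm
  have hpb : ∀ u ∈ Icc 0 t, ∀ ω, |a (W.X u ω) * W.wE a u ω| ≤ B * K := fun u hu ω => by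
    rw [abs_mul]
    exact mul_le_mul (hB _ (W.range01 _ _)) (hEle u hu ω) (abs_nonneg _) hB0
  have hpf : Integrable (fun z : ℝ × W.Ω => (a (W.X z.1 z.2) * W.wE a z.1 z.2) * f (W.X t z.2))
      ((volume.restrict (Ioc (0:ℝ) t)).prod W.P) :=
    hprod _ (hp.mul hft) (B * K * Bf) fun u hu ω => by
      rw [abs_mul]
      exact mul_le_mul (hpb u (Ioc_subset_Icc_self hu) ω) (hBf _ (W.range01 _ _)) (abs_nonneg _) (by positivity)
  have hfti : Integrable (fun ω => f (W.X t ω)) W.P :=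
    integrable_of_bdd' (h.mf.comp (W.measX t)) fun ω => hBf _ (W.range01 _ _)
  -- (A)
  have hA : ∫ ω, W.wE a t ω * f (W.X t ω) ∂W.P = ∫ ω, f (W.X t ω) ∂W.P +
      ∫ u in Ioc (0:ℝ) t, ∫ ω, (a (W.X u ω) * W.wE a u ω) * f (W.X t ω) ∂W.P := by
    rw [integral_integral_swap hpf, ← integral_add hfti hpf.integral_prod_right]
    apply integral_congr_ae (ae_of_all _ fun ω => ?_)
    simp only []
    rw [wE_path W ha hB ht ω, integral_mul_const]; ring
  -- (B)
  have hpu : ∀ u, Measurable[W.ℱ u] fun ω => a (W.X u ω) * W.wE a u ω := fun u =>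
    (ha.comp (adX W u)).mul (wE_measF W ha u)
  have hB1 : ∀ u ∈ Ioc 0 t, ∫ ω, (a (W.X u ω) * W.wE a u ω) * f (W.X t ω) ∂W.P =
      ∫ ω, (a (W.X u ω) * W.wE a u ω) * f (W.X u ω) ∂W.P +
      ∫ ω, (a (W.X u ω) * W.wE a u ω) * (∫ v in Ioc u t, l (W.X v ω)) ∂W.P := fun u hu =>
    h.gen u t hu.1.le hu.2 _ (hpu u) ⟨_, hpb u (Ioc_subset_Icc_self hu)⟩
  have hC0 := h.gen 0 t le_rfl ht (fun _ => 1) measurable_const ⟨1, by simp⟩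
  simp only [one_mul] at hC0
  have hpfu : Integrable (fun z : ℝ × W.Ω => (a (W.X z.1 z.2) * W.wE a z.1 z.2) * f (W.X z.1 z.2))
      ((volume.restrict (Ioc (0:ℝ) t)).prod W.P) :=
    hprod _ (hp.mul hfp) (B * K * Bf) fun u hu ω => by
      rw [abs_mul]
      exact mul_le_mul (hpb u (Ioc_subset_Icc_self hu) ω) (hBf _ (W.range01 _ _)) (abs_nonneg _) (by positivity)
  have hint : Measurable fun z : ℝ × W.Ω => ∫ v in Ioc z.1 t, l (W.X v z.2) := by
    have e : (fun z : ℝ × W.Ω => ∫ v in Ioc z.1 t, l (W.X v z.2)) = fun z : ℝ × W.Ω =>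
        ∫ v, ({y : (ℝ × W.Ω) × ℝ | y.2 ∈ Ioc y.1.1 t}.indicator (fun y => l (W.X y.2 y.1.2))) (z, v) := by
      funext z
      rw [← integral_indicator measurableSet_Ioc]
      rfl
    rw [e]
    have hs : MeasurableSet {y : (ℝ × W.Ω) × ℝ | y.2 ∈ Ioc y.1.1 t} :=
      (measurableSet_lt (measurable_fst.comp measurable_fst) measurable_snd).inter
        (measurableSet_le measurable_snd measurable_const)
    have hm : Measurable fun y : (ℝ × W.Ω) × ℝ => l (W.X y.2 y.1.2) :=
      hlp.comp (measurable_snd.prodMk (measurable_snd.comp measurable_fst))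
    exact ((hm.indicator hs).stronglyMeasurable.integral_prod_right' (ν := volume)).measurable
  have hpl : Integrable (fun z : ℝ × W.Ω => (a (W.X z.1 z.2) * W.wE a z.1 z.2) *
      ∫ v in Ioc z.1 t, l (W.X v z.2)) ((volume.restrict (Ioc (0:ℝ) t)).prod W.P) :=
    hprod _ (hp.mul hint) (B * K * (Bl * t)) fun u hu ω => by
      rw [abs_mul]
      refine mul_le_mul (hpb u (Ioc_subset_Icc_self hu) ω) ?_ (abs_nonneg _) (by positivity)
      refine (bound_J hu.2 W.range01 hBl ω).trans ?_
      apply mul_le_mul_of_nonneg_left _ hBl0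
      linarith [hu.1]
  have hB2 : ∫ u in Ioc (0:ℝ) t, ∫ ω, (a (W.X u ω) * W.wE a u ω) * f (W.X t ω) ∂W.P =
      (∫ u in Ioc (0:ℝ) t, ∫ ω, (a (W.X u ω) * W.wE a u ω) * f (W.X u ω) ∂W.P) +
      ∫ u in Ioc (0:ℝ) t, ∫ ω, (a (W.X u ω) * W.wE a u ω) * (∫ v in Ioc u t, l (W.X v ω)) ∂W.P := by
    rw [← integral_add hpfu.integral_prod_left hpl.integral_prod_left]
    exact setIntegral_congr_fun measurableSet_Ioc hB1
  have hEl : Integrable (fun z : ℝ × W.Ω => W.wE a z.1 z.2 * l (W.X z.1 z.2))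
      ((volume.restrict (Ioc (0:ℝ) t)).prod W.P) :=
    hprod _ (hEm.mul hlp) (K * Bl) fun u hu ω => by
      rw [abs_mul]
      exact mul_le_mul (hEle u (Ioc_subset_Icc_self hu) ω) (hBl _ (W.range01 _ _)) (abs_nonneg _) (by positivity)
  have hC1 : (∫ u in Ioc (0:ℝ) t, ∫ ω, (a (W.X u ω) * W.wE a u ω) * (∫ v in Ioc u t, l (W.X v ω)) ∂W.P)
      + ∫ ω, (∫ v in Ioc 0 t, l (W.X v ω)) ∂W.P =
      ∫ v in Ioc (0:ℝ) t, ∫ ω, W.wE a v ω * l (W.X v ω) ∂W.P := by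
    rw [integral_integral_swap hpl, integral_integral_swap (f := fun v ω => W.wE a v ω * l (W.X v ω)) hEl, ← integral_add hpl.integral_prod_right
      (integrable_of_bdd' (meas_J W.contX 0 t (fun u _ => W.measX u) h.ml) (B := Bl * (t - 0))
        (bound_J ht W.range01 hBl))]
    apply integral_congr_ae (ae_of_all _ fun ω => ?_)
    simp only []
    have hcm := (W.contX ω).measurable
    have hpm : Measurable fun u => a (W.X u ω) * W.wE a u ω := hp.comp (measurable_id.prodMk measurable_const)
    rw [triangle (l := fun v => l (W.X v ω)) hpm (h.ml.comp hcm) (B := B * K) (C := Bl)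
      (fun u hu => hpb u (Ioc_subset_Icc_self hu) ω) (fun v => hBl _ (W.range01 _ _))]
    have i2 : IntegrableOn (fun v => l (W.X v ω)) (Ioc 0 t) := integrable_J W.contX h.ml W.range01 hBl ω
    have i3 : IntegrableOn (fun v => W.wE a v ω * l (W.X v ω)) (Ioc 0 t) := by
      apply Measure.integrableOn_of_bounded (M := K * Bl) (by simp)
      · exact ((hEm.mul hlp).comp (measurable_id.prodMk measurable_const)).aestronglyMeasurable
      · refine (ae_restrict_iff' measurableSet_Ioc).2 (ae_of_all _ fun u hu => ?_)
        rw [Real.norm_eq_abs, abs_mul]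
        exact mul_le_mul (hEle u (Ioc_subset_Icc_self hu) ω) (hBl _ (W.range01 _ _)) (abs_nonneg _) (by positivity)
    have e : ∫ v in Ioc 0 t, l (W.X v ω) * ∫ u in Ioc 0 v, a (W.X u ω) * W.wE a u ω =
        ∫ v in Ioc 0 t, (W.wE a v ω * l (W.X v ω) - l (W.X v ω)) := by
      apply setIntegral_congr_fun measurableSet_Ioc
      intro v hv
      simp only []
      rw [wE_path W ha hB hv.1.le ω]; ring
    rw [e, integral_sub i3 i2]; ring
  have hfin : ∫ v in Ioc (0:ℝ) t, ∫ ω, W.wE a v ω * (l (W.X v ω) + a (W.X v ω) * f (W.X v ω)) ∂W.P =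
      (∫ v in Ioc (0:ℝ) t, ∫ ω, W.wE a v ω * l (W.X v ω) ∂W.P) +
      ∫ u in Ioc (0:ℝ) t, ∫ ω, (a (W.X u ω) * W.wE a u ω) * f (W.X u ω) ∂W.P := by
    rw [← integral_add hEl.integral_prod_left hpfu.integral_prod_left]
    apply setIntegral_congr_fun measurableSet_Ioc
    intro v hv
    have hv' := Ioc_subset_Icc_self hv
    have j1 : Integrable (fun ω => W.wE a v ω * l (W.X v ω)) W.P :=
      integrable_of_bdd' ((wE_meas W ha v).mul (h.ml.comp (W.measX v))) (B := K * Bl) fun ω => by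
        rw [abs_mul]
        exact mul_le_mul (hEle v hv' ω) (hBl _ (W.range01 _ _)) (abs_nonneg _) (by positivity)
    have j2 : Integrable (fun ω => (a (W.X v ω) * W.wE a v ω) * f (W.X v ω)) W.P :=
      integrable_of_bdd' (((ha.comp (W.measX v)).mul (wE_meas W ha v)).mul (h.mf.comp (W.measX v)))
        (B := B * K * Bf) fun ω => by
        rw [abs_mul]
        exact mul_le_mul (hpb v hv' ω) (hBf _ (W.range01 _ _)) (abs_nonneg _) (by positivity)
    simp only []
    rw [← integral_add j1 j2]
    apply integral_congr_ae (ae_of_all _ fun ω => ?_)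
    ring
  rw [hA, hB2, hC0, hfin]
  linarith

lemma soft_law (W : WFKilled s σ r μ₀) (hr : Measurable r) (hr0 : ∀ x ∈ Icc (0:ℝ) 1, r x ≤ 0)
    (t : ℝ) {A : Set ℝ} (hA : MeasurableSet A) :
    W.P ({ω | W.X t ω ∈ A} ∩ W.aliveSoft t) =
      ∫⁻ ω in {ω | W.X t ω ∈ A}, ENNReal.ofReal (W.wE r t ω) ∂W.P := by
  let S : W.Ω → ℝ := fun ω => ∫ u in Ioc (0:ℝ) t, (-(r (W.X u ω)))
  let Y : W.Ω → ℝ × ℝ := fun ω => (W.X t ω, S ω)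
  have hYm : Measurable[MeasurableSpace.comap (fun ω t => W.X t ω) MeasurableSpace.pi] Y := by
    have hX : ∀ u, Measurable[MeasurableSpace.comap (fun ω t => W.X t ω) MeasurableSpace.pi] (W.X u) := by
      intro u
      exact (measurable_pi_apply u).comp (comap_measurable (fun ω t => W.X t ω))
    refine Measurable.prodMk (hX t) ?_
    exact meas_J (m := MeasurableSpace.comap (fun ω t => W.X t ω) MeasurableSpace.pi) W.contX 0 t
      (fun u _ => hX u) (g := fun x => -(r x)) hr.neg
  have hpath : Measurable (fun ω t => W.X t ω) := measurable_pi_lambda _ fun t => W.measX t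
  have hY : Measurable Y := hYm.mono hpath.comap_le le_rfl
  have hind : IndepFun Y W.Tkill W.P := by
    have := W.indepT
    rw [IndepFun_iff_Indep] at this ⊢
    exact indep_of_indep_of_le_left this hYm.comap_le
  have hmap := (indepFun_iff_map_prod_eq_prod_map_map hY.aemeasurable W.measT.aemeasurable).1 hind
  have hset : MeasurableSet {z : (ℝ × ℝ) × ℝ | z.1.1 ∈ A ∧ z.1.2 < z.2} :=
    ((measurable_fst.comp measurable_fst) hA).inter
      (measurableSet_lt (measurable_snd.comp measurable_fst) measurable_snd)
  have e1 : W.P ({ω | W.X t ω ∈ A} ∩ W.aliveSoft t) =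
      (W.P.map fun ω => (Y ω, W.Tkill ω)) {z : (ℝ × ℝ) × ℝ | z.1.1 ∈ A ∧ z.1.2 < z.2} := by
    rw [Measure.map_apply (hY.prodMk W.measT) hset]
    rfl
  have hS0 : ∀ ω, 0 ≤ S ω := fun ω => setIntegral_nonneg measurableSet_Ioc fun u _ => by
    have := hr0 _ (W.range01 u ω); linarith
  have hT : ∀ x : ℝ, 0 ≤ x → (W.P.map W.Tkill) (Ioi x) = ENNReal.ofReal (Real.exp (-x)) := by
    intro x hx
    rw [Measure.map_apply W.measT measurableSet_Ioi]
    exact W.expLaw x hx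
  have : IsProbabilityMeasure (W.P.map W.Tkill) := Measure.isProbabilityMeasure_map W.measT.aemeasurable
  rw [e1, hmap, Measure.prod_apply hset, lintegral_map (measurable_measure_prodMk_left hset) hY,
    ← lintegral_indicator (s := {ω | W.X t ω ∈ A}) (W.measX t hA)]
  apply lintegral_congr fun ω => ?_
  by_cases h : W.X t ω ∈ A
  · have : Prod.mk (Y ω) ⁻¹' {z : (ℝ × ℝ) × ℝ | z.1.1 ∈ A ∧ z.1.2 < z.2} = Ioi (S ω) := by
      ext x; simp [Y, h]
    rw [this, hT _ (hS0 ω), indicator_of_mem (by exact h)]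
    simp only [WFKilled.wE, S]
    rw [integral_neg, neg_neg]
  · have : Prod.mk (Y ω) ⁻¹' {z : (ℝ × ℝ) × ℝ | z.1.1 ∈ A ∧ z.1.2 < z.2} = ∅ := by
      ext x; simp [Y, h]
    rw [this, indicator_of_notMem (by exact h)]; simp

lemma noHit0_ae (hs : 0 ≤ s) (hσ : 0 < σ) (W : WFKilled s σ r μ₀) {t : ℝ} (ht : 0 ≤ t) :
    ∀ᵐ ω ∂W.P, (ω ∈ W.noHit0 t ↔ W.X t ω ≠ 0) := by
  filter_upwards [abs0 hs hσ W ht] with ω hω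
  constructor
  · intro h; exact h t ⟨ht, le_rfl⟩
  · intro h u hu hx; exact h (hω ⟨u, hu, hx⟩)

lemma noHit1_ae (hs : 0 ≤ s) (hσ : 0 < σ) (W : WFKilled s σ r μ₀) {t : ℝ} (ht : 0 ≤ t) :
    ∀ᵐ ω ∂W.P, (ω ∈ W.noHit1 t ↔ W.X t ω ≠ 1) := by
  filter_upwards [abs1 hs hσ W ht] with ω hω
  constructor
  · intro h; exact h t ⟨ht, le_rfl⟩
  · intro h u hu hx; exact h (hω ⟨u, hu, hx⟩)

lemma all_law (hs : 0 ≤ s) (hσ : 0 < σ) (W : WFKilled s σ r μ₀) (hr : Measurable r)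
    (hr0 : ∀ x ∈ Icc (0:ℝ) 1, r x ≤ 0) {t : ℝ} (ht : 0 ≤ t) {A : Set ℝ} (hA : MeasurableSet A) :
    W.P ({ω | W.X t ω ∈ A} ∩ W.aliveAll t) =
      ∫⁻ ω in {ω | W.X t ω ∈ A ∩ Ioo 0 1}, ENNReal.ofReal (W.wE r t ω) ∂W.P := by
  rw [← soft_law W hr hr0 t (hA.inter measurableSet_Ioo)]
  apply measure_congr
  filter_upwards [noHit0_ae hs hσ W ht, noHit1_ae hs hσ W ht] with ω h0 h1
  have h2 := Ioo_of_ne (W.range01 t ω)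
  apply propext
  change (W.X t ω ∈ A ∧ ((ω ∈ W.aliveSoft t ∧ ω ∈ W.noHit0 t) ∧ ω ∈ W.noHit1 t)) ↔
    ((W.X t ω ∈ A ∧ W.X t ω ∈ Ioo (0:ℝ) 1) ∧ ω ∈ W.aliveSoft t)
  rw [h0, h1, h2]; tauto

lemma one_law (hs : 0 ≤ s) (hσ : 0 < σ) (W : WFKilled s σ r μ₀) (hr : Measurable r)
    (hr0 : ∀ x ∈ Icc (0:ℝ) 1, r x ≤ 0) {t : ℝ} (ht : 0 ≤ t) {A : Set ℝ} (hA : MeasurableSet A) :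
    W.P ({ω | W.X t ω ∈ A} ∩ (W.aliveSoft t ∩ W.noHit1 t)) =
      ∫⁻ ω in {ω | W.X t ω ∈ A ∩ {1}ᶜ}, ENNReal.ofReal (W.wE r t ω) ∂W.P := by
  rw [← soft_law W hr hr0 t (hA.inter (measurableSet_singleton 1).compl)]
  apply measure_congr
  filter_upwards [noHit1_ae hs hσ W ht] with ω h1
  apply propext
  change (W.X t ω ∈ A ∧ (ω ∈ W.aliveSoft t ∧ ω ∈ W.noHit1 t)) ↔
    ((W.X t ω ∈ A ∧ W.X t ω ≠ 1) ∧ ω ∈ W.aliveSoft t)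
  rw [h1]; tauto

lemma wE_shift (W : WFKilled s σ r μ₀) (hr : Measurable r) {M : ℝ}
    (hM : ∀ x ∈ Icc (0:ℝ) 1, |r x| ≤ M) (ρ : ℝ) {t : ℝ} (ht : 0 ≤ t) (ω : W.Ω) :
    W.wE (fun x => r x + ρ) t ω = Real.exp (ρ * t) * W.wE r t ω := by
  unfold WFKilled.wE
  rw [← Real.exp_add]
  congr 1
  rw [integral_add (integrable_J W.contX hr W.range01 hM ω) (by simp)]
  simp [ht]; ring

lemma qsd_int (hs : 0 ≤ s) (hσ : 0 < σ) (hr : Measurable r) {M : ℝ}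
    (hM : ∀ x ∈ Icc (0:ℝ) 1, |r x| ≤ M)
    (hr0 : ∀ x ∈ Icc (0:ℝ) 1, r x ≤ 0) {α : Measure ℝ} {ρ : ℝ} (hQ : IsQSD s σ r α ρ)
    (W : WFKilled s σ r α) {f : ℝ → ℝ} (hf : Measurable f) (hf0 : f 0 = 0) (hf1 : f 1 = 0)
    {t : ℝ} (ht : 0 < t) :
    ∫ ω, W.wE (fun x => r x + ρ) t ω * f (W.X t ω) ∂W.P = ∫ x, f x ∂α := by
  obtain ⟨_, hα, hq⟩ := hQ
  have hE := wE_meas W hr t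
  have hm : ((W.P.withDensity fun ω => ENNReal.ofReal (W.wE r t ω)).map (W.X t)).restrict (Ioo 0 1) =
      ENNReal.ofReal (Real.exp (-(ρ * t))) • α := by
    ext A hA
    rw [Measure.restrict_apply hA, Measure.map_apply (W.measX t) (hA.inter measurableSet_Ioo),
      withDensity_apply _ (W.measX t (hA.inter measurableSet_Ioo)), Measure.smul_apply, smul_eq_mul,
      ← hq W t ht A hA, all_law hs hσ W hr hr0 ht.le hA]
    rfl
  have h1 : ∫ x, f x ∂(ENNReal.ofReal (Real.exp (-(ρ * t))) • α) = Real.exp (-(ρ * t)) * ∫ x, f x ∂α := by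
    rw [integral_smul_measure, ENNReal.toReal_ofReal (Real.exp_pos _).le, smul_eq_mul]
  have h2 : ∫ x, f x ∂(((W.P.withDensity fun ω => ENNReal.ofReal (W.wE r t ω)).map (W.X t)).restrict (Ioo 0 1))
      = ∫ ω, W.wE r t ω * f (W.X t ω) ∂W.P := by
    rw [← integral_indicator measurableSet_Ioo, integral_map (W.measX t).aemeasurable
      (hf.indicator measurableSet_Ioo).aestronglyMeasurable,
      integral_withDensity_eq_integral_toReal_smul hE.ennreal_ofReal
      (ae_of_all _ fun _ => ENNReal.ofReal_lt_top)]
    apply integral_congr_ae (ae_of_all _ fun ω => ?_)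
    simp only [ENNReal.toReal_ofReal (wE_pos W t ω).le, smul_eq_mul]
    by_cases h : W.X t ω ∈ Ioo (0:ℝ) 1
    · rw [indicator_of_mem h]
    · rw [indicator_of_notMem h]
      rw [Ioo_of_ne (W.range01 t ω)] at h
      have : W.X t ω = 0 ∨ W.X t ω = 1 := by tauto
      rcases this with h | h <;> simp [h, hf0, hf1]
  rw [hm, h1] at h2
  simp_rw [wE_shift W hr hM ρ ht.le, mul_assoc]
  rw [integral_const_mul, ← h2, ← mul_assoc, ← Real.exp_add]
  simp

lemma qsd_gen (hs : 0 ≤ s) (hσ : 0 < σ) (hr : Measurable r) {M : ℝ}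
    (hM : ∀ x ∈ Icc (0:ℝ) 1, |r x| ≤ M)
    (hr0 : ∀ x ∈ Icc (0:ℝ) 1, r x ≤ 0) {α : Measure ℝ} {ρ : ℝ} (hQ : IsQSD s σ r α ρ)
    (W : WFKilled s σ r α) {f l : ℝ → ℝ} (h : GP W f l) (hf0 : f 0 = 0) (hf1 : f 1 = 0)
    (hl0 : l 0 = 0) (hl1 : l 1 = 0) :
    ∫ x, (l x + (r x + ρ) * f x) ∂α = 0 := by
  have ha : Measurable fun x => r x + ρ := hr.add_const ρ
  have hB : ∀ x ∈ Icc (0:ℝ) 1, |r x + ρ| ≤ M + |ρ| := fun x hx =>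
    (abs_add_le _ _).trans (by linarith [hM x hx])
  have h1 := FK W h ha hB (zero_le_one)
  rw [qsd_int hs hσ hr hM hr0 hQ W h.mf hf0 hf1 one_pos] at h1
  have h2 : ∫ ω, f (W.X 0 ω) ∂W.P = ∫ x, f x ∂α := by
    conv_rhs => rw [← W.initLaw]
    rw [integral_map (W.measX 0).aemeasurable h.mf.aestronglyMeasurable]
  have h3 : ∫ v in Ioc (0:ℝ) 1, ∫ ω, W.wE (fun x => r x + ρ) v ω *
      (l (W.X v ω) + (r (W.X v ω) + ρ) * f (W.X v ω)) ∂W.P =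
      ∫ v in Ioc (0:ℝ) 1, ∫ x, (l x + (r x + ρ) * f x) ∂α := by
    apply setIntegral_congr_fun measurableSet_Ioc
    intro v hv
    exact qsd_int hs hσ hr hM hr0 hQ W (f := fun x => l x + (r x + ρ) * f x)
      (h.ml.add (ha.mul h.mf)) (by simp [hl0, hf0]) (by simp [hl1, hf1]) hv.1
  rw [h3, h2] at h1
  simp at h1
  exact h1

lemma gp_C2 (W : WFKilled s σ r μ₀) {f : ℝ → ℝ} (hf : ContDiff ℝ 2 f) : GP W f (LWF s σ f) where
  mf := hf.continuous.measurable
  ml := (LWF_cont hf).measurable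
  bf := by obtain ⟨B, _, h⟩ := bdd_cont hf.continuous; exact ⟨B, h⟩
  bl := by obtain ⟨B, _, h⟩ := bdd_cont (LWF_cont (s := s) (σ := σ) hf); exact ⟨B, h⟩
  gen := fun u t hu hut Z hZ ⟨K, hK⟩ => gen_C2 W hf hu hut hZ hK

lemma wd_integral {Ω : Type*} {m : MeasurableSpace Ω} {P : Measure Ω} {Z : Ω → ℝ}
    (hZm : Measurable Z) (hZ0 : ∀ᵐ ω ∂P, 0 ≤ Z ω) (g : Ω → ℝ) :
    ∫ ω, g ω ∂(P.withDensity fun ω => ENNReal.ofReal (Z ω)) = ∫ ω, Z ω * g ω ∂P := by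
  rw [integral_withDensity_eq_integral_toReal_smul hZm.ennreal_ofReal
    (ae_of_all _ fun _ => ENNReal.ofReal_lt_top)]
  apply integral_congr_ae
  filter_upwards [hZ0] with ω hω
  simp [ENNReal.toReal_ofReal hω]

lemma wG_ne_top {b σ : ℝ} (hb : 0 ≤ b) (hσ : 0 < σ) {q : ℝ → ℝ} {C : ℝ}
    (hC : ∀ x ∈ Icc (0:ℝ) 1, q x ≤ C) (x : ℝ) : wG b σ (fun y => ENNReal.ofReal (q y)) x ≠ ⊤ := by
  refine ne_top_of_le_ne_top ?_ (wG_le_const (c := ENNReal.ofReal C) hb hσ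
    (fun y hy => ENNReal.ofReal_le_ofReal (hC y hy)) x)
  finiteness

lemma wG_toReal_le {b σ : ℝ} (hb : 0 ≤ b) (hσ : 0 < σ) {q : ℝ → ℝ} {C : ℝ} (hC0 : 0 ≤ C)
    (hC : ∀ x ∈ Icc (0:ℝ) 1, q x ≤ C) {x : ℝ} (hx : x ∈ Icc (0:ℝ) 1) :
    (wG b σ (fun y => ENNReal.ofReal (q y)) x).toReal ≤ wK b σ * ww x * C := by
  have h := wG_le_const (c := ENNReal.ofReal C) hb hσ
    (fun y hy => ENNReal.ofReal_le_ofReal (hC y hy)) x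
  have h1 : 0 ≤ wK b σ * ww x := mul_nonneg (wK_pos hb hσ).le (ww_nonneg hx)
  rw [← ENNReal.ofReal_mul h1] at h
  exact ENNReal.toReal_le_of_le_ofReal (by positivity) h

lemma gp_pos_aux (hs : 0 ≤ s) (hσ : 0 < σ) (W : WFKilled s σ r μ₀) {q : ℝ → ℝ} (hq : Measurable q)
    {C : ℝ} (hq0 : ∀ x ∈ Icc (0:ℝ) 1, 0 ≤ q x) (hC : ∀ x ∈ Icc (0:ℝ) 1, q x ≤ C) {u t : ℝ} (hu : 0 ≤ u) (hut : u ≤ t)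
    {Z : W.Ω → ℝ} (hZ : Measurable[W.ℱ u] Z) {K : ℝ} (hZ0 : ∀ ω, 0 ≤ Z ω) (hZb : ∀ ω, Z ω ≤ K) :
    ∫ ω, Z ω * (wG (2 * s / σ ^ 2) σ (fun y => ENNReal.ofReal (q y)) (W.X t ω)).toReal ∂W.P =
      ∫ ω, Z ω * (wG (2 * s / σ ^ 2) σ (fun y => ENNReal.ofReal (q y)) (W.X u ω)).toReal ∂W.P +
      ∫ ω, Z ω * (∫ v in Ioc u t, -(ww (W.X v ω) * q (W.X v ω))) ∂W.P := by
  have hb : 0 ≤ 2 * s / σ ^ 2 := by positivity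
  set b := 2 * s / σ ^ 2 with hbdef
  have hC0 : 0 ≤ C := (hq0 0 (by simp)).trans (hC 0 (by simp))
  have hZm : Measurable Z := hZ.mono (W.ℱ.le u) le_rfl
  have hgood := wgood_of_Z W hu hZ hZ0 hZb
  set Q := W.P.withDensity fun ω => ENNReal.ofReal (Z ω) with hQ
  have := hgood.fin
  have hcore := core hs hσ W hgood (t := u) (u := t) le_rfl hut hq.ennreal_ofReal
  rw [← hbdef] at hcore
  set G : ℝ → ℝ≥0∞ := wG b σ (fun y => ENNReal.ofReal (q y)) with hG
  have hGm : Measurable G := wG_meas b σ hq.ennreal_ofReal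
  have hGt : ∀ x, G x ≠ ⊤ := wG_ne_top hb hσ hC
  have hGi : ∀ v, Integrable (fun ω => (G (W.X v ω)).toReal) Q := fun v =>
    integrable_of_bdd' (hGm.comp (W.measX v)).ennreal_toReal (B := wK b σ * 1 * C) fun ω => by
      rw [abs_of_nonneg ENNReal.toReal_nonneg]
      refine (wG_toReal_le hb hσ hC0 hC (W.range01 v ω)).trans ?_
      have := (wK_pos hb hσ).le
      have := ww_le_one (W.range01 v ω)
      gcongr
  have e1 : ∀ v, ∫⁻ ω, G (W.X v ω) ∂Q = ENNReal.ofReal (∫ ω, (G (W.X v ω)).toReal ∂Q) := by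
    intro v
    rw [ofReal_integral_eq_lintegral_ofReal (hGi v) (ae_of_all _ fun _ => ENNReal.toReal_nonneg)]
    apply lintegral_congr fun ω => ?_
    rw [ENNReal.ofReal_toReal (hGt _)]
  have hXm := meas_uncurry W.contX W.measX
  have hwm : Measurable ww := by unfold ww; fun_prop
  have hwq : Measurable fun x => ww x * q x := hwm.mul hq
  have hwqb : ∀ x ∈ Icc (0:ℝ) 1, |ww x * q x| ≤ 1 * C := fun x hx => by
    rw [abs_of_nonneg (mul_nonneg (ww_nonneg hx) (hq0 x hx))]
    exact mul_le_mul (ww_le_one hx) (hC x hx) (hq0 x hx) zero_le_one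
  have hJm : Measurable fun ω => ∫ v in Ioc u t, ww (W.X v ω) * q (W.X v ω) :=
    meas_J W.contX u t (fun v _ => W.measX v) hwq
  have hJi : Integrable (fun ω => ∫ v in Ioc u t, ww (W.X v ω) * q (W.X v ω)) Q :=
    integrable_of_bdd' hJm (bound_J hut W.range01 hwqb)
  have hJ0 : ∀ ω, 0 ≤ ∫ v in Ioc u t, ww (W.X v ω) * q (W.X v ω) := fun ω =>
    setIntegral_nonneg measurableSet_Ioc fun v _ => mul_nonneg (ww_nonneg (W.range01 _ _)) (hq0 _ (W.range01 _ _))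
  have e2 : ∫⁻ v in Ioc u t, ∫⁻ ω, ENNReal.ofReal (ww (W.X v ω)) * ENNReal.ofReal (q (W.X v ω)) ∂Q =
      ENNReal.ofReal (∫ ω, (∫ v in Ioc u t, ww (W.X v ω) * q (W.X v ω)) ∂Q) := by
    rw [lintegral_lintegral_swap (f := fun v ω => ENNReal.ofReal (ww (W.X v ω)) * ENNReal.ofReal (q (W.X v ω)))
      (((hwm.comp hXm).ennreal_ofReal.mul (hq.comp hXm).ennreal_ofReal).aemeasurable),
      ofReal_integral_eq_lintegral_ofReal hJi (ae_of_all _ hJ0)]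
    apply lintegral_congr fun ω => ?_
    rw [ofReal_integral_eq_lintegral_ofReal (integrable_J W.contX hwq W.range01 hwqb ω)
      (ae_of_all _ fun v => mul_nonneg (ww_nonneg (W.range01 _ _)) (hq0 _ (W.range01 _ _)))]
    apply lintegral_congr fun v => ?_
    rw [ENNReal.ofReal_mul (ww_nonneg (W.range01 _ _))]
  rw [e1, e1, e2, ← ENNReal.ofReal_add (integral_nonneg fun _ => ENNReal.toReal_nonneg)
    (integral_nonneg hJ0), ENNReal.ofReal_eq_ofReal_iff (by
      exact add_nonneg (integral_nonneg fun _ => ENNReal.toReal_nonneg) (integral_nonneg hJ0))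
      (integral_nonneg fun _ => ENNReal.toReal_nonneg)] at hcore
  rw [wd_integral hZm (ae_of_all _ hZ0), wd_integral hZm (ae_of_all _ hZ0),
    wd_integral hZm (ae_of_all _ hZ0)] at hcore
  have e3 : ∫ ω, Z ω * (∫ v in Ioc u t, -(ww (W.X v ω) * q (W.X v ω))) ∂W.P =
      - ∫ ω, Z ω * (∫ v in Ioc u t, (ww (W.X v ω) * q (W.X v ω))) ∂W.P := by
    rw [← integral_neg]
    apply integral_congr_ae (ae_of_all _ fun ω => ?_)
    try simp only []
    rw [integral_neg]; ring
  rw [e3]; linarith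

lemma gp_of_pos (W : WFKilled s σ r μ₀) {f l : ℝ → ℝ} (mf : Measurable f) (ml : Measurable l)
    {Bf Bl : ℝ} (hBf : ∀ x ∈ Icc (0:ℝ) 1, |f x| ≤ Bf) (hBl : ∀ x ∈ Icc (0:ℝ) 1, |l x| ≤ Bl)
    (h : ∀ u t, 0 ≤ u → u ≤ t → ∀ Z : W.Ω → ℝ, Measurable[W.ℱ u] Z → ∀ K, (∀ ω, 0 ≤ Z ω) → (∀ ω, Z ω ≤ K) →
    ∫ ω, Z ω * f (W.X t ω) ∂W.P = ∫ ω, Z ω * f (W.X u ω) ∂W.P +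
      ∫ ω, Z ω * (∫ v in Ioc u t, l (W.X v ω)) ∂W.P) : GP W f l where
  mf := mf
  ml := ml
  bf := ⟨_, hBf⟩
  bl := ⟨_, hBl⟩
  gen := by
    rintro u t hu hut Z hZ ⟨K, hK⟩
    have hZm : Measurable Z := hZ.mono (W.ℱ.le u) le_rfl
    have hne : Nonempty W.Ω := by
      by_contra hne
      rw [not_nonempty_iff] at hne
      have h1 := measure_univ (μ := W.P)
      rw [Measure.eq_zero_of_isEmpty W.P] at h1
      simp at h1
    have hK0 : 0 ≤ K := (abs_nonneg _).trans (hK hne.some)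
    have h1 := h u t hu hut (fun ω => Z ω + K) (hZ.add_const K) (K + K)
      (fun ω => by linarith [neg_abs_le (Z ω), hK ω]) (fun ω => by linarith [le_abs_self (Z ω), hK ω])
    have h2 := h u t hu hut (fun _ => K) measurable_const K (fun _ => hK0) (fun _ => le_rfl)
    have key : ∀ g : W.Ω → ℝ, Measurable g → ∀ B, (∀ ω, |g ω| ≤ B) →
        ∫ ω, Z ω * g ω ∂W.P = ∫ ω, (Z ω + K) * g ω ∂W.P - ∫ ω, K * g ω ∂W.P := by
      intro g hg B hB
      have i0 : Integrable g W.P := integrable_of_bdd' hg hB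
      have i1 : Integrable (fun ω => Z ω * g ω) W.P := i0.bdd_mul hZm.aestronglyMeasurable (ae_of_all _ hK)
      simp_rw [add_mul]
      rw [integral_add i1 (i0.const_mul K)]; ring
    rw [key (fun ω => f (W.X t ω)) (mf.comp (W.measX t)) Bf (fun ω => hBf _ (W.range01 _ _)),
      key (fun ω => f (W.X u ω)) (mf.comp (W.measX u)) Bf (fun ω => hBf _ (W.range01 _ _)),
      key (fun ω => ∫ v in Ioc u t, l (W.X v ω)) (meas_J W.contX u t (fun v _ => W.measX v) ml) _ (bound_J hut W.range01 hBl), h1, h2]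
    ring

lemma gp_pos (hs : 0 ≤ s) (hσ : 0 < σ) (W : WFKilled s σ r μ₀) {q : ℝ → ℝ} (hq : Measurable q)
    {C : ℝ} (hq0 : ∀ x ∈ Icc (0:ℝ) 1, 0 ≤ q x) (hC : ∀ x ∈ Icc (0:ℝ) 1, q x ≤ C) :
    GP W (fun x => (wG (2 * s / σ ^ 2) σ (fun y => ENNReal.ofReal (q y)) x).toReal)
      (fun x => -(ww x * q x)) := by
  have hb : 0 ≤ 2 * s / σ ^ 2 := by positivity
  have hC0 : 0 ≤ C := (hq0 0 (by simp)).trans (hC 0 (by simp))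
  have hwm : Measurable ww := by unfold ww; fun_prop
  refine gp_of_pos W (wG_meas _ _ hq.ennreal_ofReal).ennreal_toReal (hwm.mul hq).neg
    (Bf := wK (2 * s / σ ^ 2) σ * 1 * C) (Bl := 1 * C) ?_ ?_ ?_
  · intro x hx
    rw [abs_of_nonneg ENNReal.toReal_nonneg]
    refine (wG_toReal_le hb hσ hC0 hC hx).trans ?_
    have := (wK_pos hb hσ).le
    have := ww_le_one hx
    gcongr
  · intro x hx
    rw [abs_neg, abs_of_nonneg (mul_nonneg (ww_nonneg hx) (hq0 x hx))]
    exact mul_le_mul (ww_le_one hx) (hC x hx) (hq0 x hx) zero_le_one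
  · intro u t hu hut Z hZ K hZ0 hZK
    exact gp_pos_aux hs hσ W hq hq0 hC hu hut hZ hZ0 hZK

lemma wG_toReal {b σ : ℝ} (hb : 0 ≤ b) (hσ : 0 < σ) {q : ℝ → ℝ} (hq : Measurable q)
    (hq0 : ∀ x ∈ Icc (0:ℝ) 1, 0 ≤ q x) {x : ℝ} (hx : x ∈ Icc (0:ℝ) 1) :
    (wG b σ (fun y => ENNReal.ofReal (q y)) x).toReal = ∫ y in Ioc (0:ℝ) 1, wk b σ x y * q y := by
  have hkx : Continuous fun y => wk b σ x y :=
    ((wk_cont b σ).comp (by fun_prop : Continuous fun y : ℝ => (x, y)))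
  rw [integral_eq_lintegral_of_nonneg_ae]
  · unfold wG
    congr 1
    apply setLIntegral_congr_fun measurableSet_Ioc
    intro y hy
    try simp only []
    rw [ENNReal.ofReal_mul (wk_nonneg hb hσ hx ⟨hy.1.le, hy.2⟩)]
  · refine (ae_restrict_iff' measurableSet_Ioc).2 (ae_of_all _ fun y hy => ?_)
    exact mul_nonneg (wk_nonneg hb hσ hx ⟨hy.1.le, hy.2⟩) (hq0 _ ⟨hy.1.le, hy.2⟩)
  · exact (hkx.measurable.mul hq).aestronglyMeasurable

lemma gp_green (hs : 0 ≤ s) (hσ : 0 < σ) (W : WFKilled s σ r μ₀) {q : ℝ → ℝ} (hq : Measurable q)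
    {C : ℝ} (hC : ∀ x ∈ Icc (0:ℝ) 1, |q x| ≤ C) {f : ℝ → ℝ} (hf : Measurable f)
    (hfq : ∀ x ∈ Icc (0:ℝ) 1, f x = ∫ y in Ioc (0:ℝ) 1, wk (2 * s / σ ^ 2) σ x y * q y) :
    GP W f (fun x => -(ww x * q x)) := by
  have hb : 0 ≤ 2 * s / σ ^ 2 := by positivity
  have hC0 : 0 ≤ C := (abs_nonneg _).trans (hC 0 (by simp))
  have q10 : ∀ x ∈ Icc (0:ℝ) 1, 0 ≤ q x + C := fun x hx => by linarith [neg_abs_le (q x), hC x hx]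
  have g1 := gp_pos hs hσ W (q := fun x => q x + C) (C := C + C) (hq.add_const C)
    q10 (fun x hx => by linarith [le_abs_self (q x), hC x hx])
  have g2 := gp_pos hs hσ W (q := fun _ => C) (C := C) measurable_const (fun _ _ => hC0) (fun _ _ => le_rfl)
  set b := 2 * s / σ ^ 2 with hbdef
  set f1 := fun x => (wG b σ (fun y => ENNReal.ofReal (q y + C)) x).toReal with hf1
  set f2 := fun x => (wG b σ (fun y => ENNReal.ofReal C) x).toReal with hf2
  have hff : ∀ x ∈ Icc (0:ℝ) 1, f x = f1 x - f2 x := by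
    intro x hx
    have hkx : Continuous fun y => wk b σ x y :=
      ((wk_cont b σ).comp (by fun_prop : Continuous fun y : ℝ => (x, y)))
    have hki : IntegrableOn (fun y => wk b σ x y) (Ioc 0 1) :=
      (hkx.integrableOn_Icc).mono_set Ioc_subset_Icc_self
    have i2 : IntegrableOn (fun y => wk b σ x y * C) (Ioc 0 1) := hki.mul_const C
    have i1 : IntegrableOn (fun y => wk b σ x y * (q y + C)) (Ioc 0 1) := by
      refine hki.mul_bdd (c := C + C) (hq.add_const C).aestronglyMeasurable ?_
      refine (ae_restrict_iff' measurableSet_Ioc).2 (ae_of_all _ fun y hy => ?_)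
      rw [Real.norm_eq_abs, abs_le]
      have := abs_le.1 (hC y ⟨hy.1.le, hy.2⟩)
      constructor <;> linarith
    rw [hfq x hx, hf1, hf2]
    try simp only []
    rw [wG_toReal hb hσ (q := fun y => q y + C) (hq.add_const C) q10 hx,
      wG_toReal hb hσ (q := fun _ => C) measurable_const (fun _ _ => hC0) hx, ← integral_sub i1 i2]
    apply integral_congr_ae (ae_of_all _ fun y => ?_)
    try simp only []
    ring
  obtain ⟨B1, hB1⟩ := g1.bf
  obtain ⟨B2, hB2⟩ := g2.bf
  have hwm : Measurable ww := by unfold ww; fun_prop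
  have hlb : ∀ (q : ℝ → ℝ) (C : ℝ), (∀ x ∈ Icc (0:ℝ) 1, |q x| ≤ C) → ∀ x ∈ Icc (0:ℝ) 1, |(-(ww x * q x))| ≤ 1 * C := by
    intro q C hC x hx
    rw [abs_neg, abs_mul, abs_of_nonneg (ww_nonneg hx)]
    exact mul_le_mul (ww_le_one hx) (hC x hx) (abs_nonneg _) zero_le_one
  have hb1 := hlb (fun x => q x + C) (C + C) (fun x hx => (abs_add_le _ _).trans (by
    rw [abs_of_nonneg hC0]; linarith [hC x hx]))
  have hb2 := hlb (fun x => C) C (fun x hx => by rw [abs_of_nonneg hC0])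
  refine ⟨hf, (hwm.mul hq).neg, ⟨B1 + B2, fun x hx => ?_⟩, ⟨_, hlb q C hC⟩, ?_⟩
  · rw [hff x hx]
    exact (abs_sub _ _).trans (add_le_add (hB1 x hx) (hB2 x hx))
  rintro u t hu hut Z hZ ⟨K, hK⟩
  have h1 := g1.gen u t hu hut Z hZ ⟨K, hK⟩
  have h2 := g2.gen u t hu hut Z hZ ⟨K, hK⟩
  have hZm : Measurable Z := hZ.mono (W.ℱ.le u) le_rfl
  have hi : ∀ g : W.Ω → ℝ, Measurable g → ∀ B, (∀ ω, |g ω| ≤ B) → Integrable (fun ω => Z ω * g ω) W.P := by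
    intro g hg B hB
    exact (integrable_of_bdd' hg hB).bdd_mul hZm.aestronglyMeasurable (ae_of_all _ hK)
  have e1 : ∀ v, ∫ ω, Z ω * f (W.X v ω) ∂W.P =
      ∫ ω, Z ω * f1 (W.X v ω) ∂W.P - ∫ ω, Z ω * f2 (W.X v ω) ∂W.P := by
    intro v
    rw [← integral_sub (hi (fun ω => f1 (W.X v ω)) (g1.mf.comp (W.measX v)) B1 (fun ω => hB1 _ (W.range01 _ _)))
      (hi (fun ω => f2 (W.X v ω)) (g2.mf.comp (W.measX v)) B2 (fun ω => hB2 _ (W.range01 _ _)))]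
    apply integral_congr_ae (ae_of_all _ fun ω => ?_)
    try simp only []
    rw [hff _ (W.range01 _ _)]; ring
  have e2 : ∫ ω, Z ω * (∫ v in Ioc u t, -(ww (W.X v ω) * q (W.X v ω))) ∂W.P =
      ∫ ω, Z ω * (∫ v in Ioc u t, -(ww (W.X v ω) * (q (W.X v ω) + C))) ∂W.P -
      ∫ ω, Z ω * (∫ v in Ioc u t, -(ww (W.X v ω) * C)) ∂W.P := by
    rw [← integral_sub (hi (fun ω => ∫ v in Ioc u t, -(ww (W.X v ω) * (q (W.X v ω) + C))) (meas_J W.contX u t (fun v _ => W.measX v) g1.ml) _ (bound_J (g := fun x => -(ww x * (q x + C))) hut W.range01 hb1))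
      (hi (fun ω => ∫ v in Ioc u t, -(ww (W.X v ω) * C)) (meas_J W.contX u t (fun v _ => W.measX v) g2.ml) _ (bound_J (g := fun x => -(ww x * C)) hut W.range01 hb2))]
    apply integral_congr_ae (ae_of_all _ fun ω => ?_)
    try simp only []
    rw [← mul_sub, ← integral_sub (integrable_J W.contX g1.ml W.range01 hb1 ω)
      (integrable_J W.contX g2.ml W.range01 hb2 ω)]
    congr 1
    apply integral_congr_ae (ae_of_all _ fun v => ?_)
    try simp only []
    ring
  rw [e1, e1, e2]
  linarith

/-- eta -/
def wη (b σ : ℝ) (α : Measure ℝ) (a : ℝ → ℝ) (y : ℝ) : ℝ := ∫ x, wc b σ * wkS b x y * a x ∂α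

lemma ww_meas : Measurable ww := by unfold ww; fun_prop

lemma ae_Ioo {α : Measure ℝ} (hα : α (Ioo (0:ℝ) 1)ᶜ = 0) : ∀ᵐ x ∂α, x ∈ Ioo (0:ℝ) 1 := by
  rw [ae_iff]; exact hα

lemma wη_integrand {b σ : ℝ} (hb : 0 ≤ b) (hσ : 0 < σ) {a : ℝ → ℝ} {B : ℝ}
    (hB : ∀ x ∈ Icc (0:ℝ) 1, |a x| ≤ B) {x y : ℝ} (hx : x ∈ Icc (0:ℝ) 1) (hy : y ∈ Icc (0:ℝ) 1) :
    |wc b σ * wkS b x y * a x| ≤ wK b σ * ww y * B := by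
  have h1 := wkS_le hb hx hy
  have h2 := (kap_nonneg hx hy).trans (wkS_ge hb hx hy)
  have h3 := (wc_pos hb hσ).le
  rw [abs_mul, abs_of_nonneg (mul_nonneg h3 h2)]
  have h4 : wc b σ * wkS b x y ≤ wK b σ * ww y := by
    unfold wK
    rw [mul_assoc]
    apply mul_le_mul_of_nonneg_left _ h3
    exact h1.trans (mul_le_mul_of_nonneg_left (kap_le_right hx hy) (by positivity))
  exact mul_le_mul h4 (hB x hx) (abs_nonneg _) (mul_nonneg (wK_pos hb hσ).le (ww_nonneg hy))

lemma wη_bound {b σ : ℝ} (hb : 0 ≤ b) (hσ : 0 < σ) {α : Measure ℝ} [IsProbabilityMeasure α]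
    (hα : α (Ioo (0:ℝ) 1)ᶜ = 0) {a : ℝ → ℝ} {B : ℝ}
    (hB : ∀ x ∈ Icc (0:ℝ) 1, |a x| ≤ B) {y : ℝ} (hy : y ∈ Icc (0:ℝ) 1) :
    |wη b σ α a y| ≤ wK b σ * ww y * B := by
  have := norm_integral_le_of_norm_le_const (μ := α) (f := fun x => wc b σ * wkS b x y * a x)
    (C := wK b σ * ww y * B) (by
      filter_upwards [ae_Ioo hα] with x hx
      exact wη_integrand hb hσ hB (Ioo_subset_Icc_self hx) hy)
  simpa [wη] using this

lemma wη_meas2 (b σ : ℝ) {a : ℝ → ℝ} (ha : Measurable a) :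
    Measurable fun z : ℝ × ℝ => wc b σ * wkS b z.1 z.2 * a z.1 :=
  ((wkS_cont b).measurable.const_mul _).mul (ha.comp measurable_fst)

lemma wη_meas (b σ : ℝ) (α : Measure ℝ) [IsProbabilityMeasure α] {a : ℝ → ℝ} (ha : Measurable a) :
    Measurable (wη b σ α a) :=
  ((wη_meas2 b σ ha).stronglyMeasurable.integral_prod_left (μ := α)).measurable

lemma wη_cont {b σ : ℝ} (hb : 0 ≤ b) (hσ : 0 < σ) {α : Measure ℝ} [IsProbabilityMeasure α]
    (hα : α (Ioo (0:ℝ) 1)ᶜ = 0) {a : ℝ → ℝ} (ha : Measurable a) {B : ℝ}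
    (hB : ∀ x ∈ Icc (0:ℝ) 1, |a x| ≤ B) : ContinuousOn (wη b σ α a) (Icc 0 1) := by
  have hB0 : 0 ≤ B := (abs_nonneg _).trans (hB 0 (by simp))
  apply continuousOn_of_dominated (bound := fun _ => wK b σ * 1 * B)
  · intro y _
    exact ((wη_meas2 b σ ha).comp (measurable_id.prodMk measurable_const)).aestronglyMeasurable
  · intro y hy
    filter_upwards [ae_Ioo hα] with x hx
    refine (wη_integrand hb hσ hB (Ioo_subset_Icc_self hx) hy).trans ?_
    have := (wK_pos hb hσ).le
    have := ww_le_one hy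
    gcongr
  · exact integrable_const _
  · refine ae_of_all _ fun x => Continuous.continuousOn ?_
    have : Continuous fun y => wkS b x y := (wkS_cont b).comp (by fun_prop : Continuous fun y : ℝ => (x, y))
    fun_prop

lemma wη_fub {b σ : ℝ} (hb : 0 ≤ b) (hσ : 0 < σ) {α : Measure ℝ} [IsProbabilityMeasure α]
    (hα : α (Ioo (0:ℝ) 1)ᶜ = 0) {a : ℝ → ℝ} (ha : Measurable a) {B : ℝ}
    (hB : ∀ x ∈ Icc (0:ℝ) 1, |a x| ≤ B) {q : ℝ → ℝ} (hq : Continuous q) :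
    ∫ x, a x * wF b σ q x ∂α = ∫ y in Ioc (0:ℝ) 1, Real.exp (-(b * y)) * wη b σ α a y * q y := by
  obtain ⟨Q, _, hQ⟩ := bdd_cont hq
  have h1 : ∫ x, a x * wF b σ q x ∂α =
      ∫ x, (∫ y in Ioc (0:ℝ) 1, (wc b σ * wkS b x y * a x) * (Real.exp (-(b * y)) * q y)) ∂α := by
    apply integral_congr_ae
    filter_upwards [ae_Ioo hα] with x hx
    rw [wF_eq b σ hq (Ioo_subset_Icc_self hx), ← integral_const_mul]
    apply integral_congr_ae (ae_of_all _ fun y => ?_)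
    simp only [wk]
    ring
  rw [h1, integral_integral_swap]
  · apply integral_congr_ae (ae_of_all _ fun y => ?_)
    try simp only []
    rw [integral_mul_const]
    unfold wη
    ring
  · have hm : Measurable (Function.uncurry fun x y => (wc b σ * wkS b x y * a x) * (Real.exp (-(b * y)) * q y)) := by
      have h2 := hq.measurable
      exact (wη_meas2 b σ ha).mul (by fun_prop)
    refine Integrable.of_bound hm.aestronglyMeasurable (wK b σ * 1 * B * (1 * Q)) ?_
    have e1 := (Measure.quasiMeasurePreserving_fst (μ := α) (ν := volume.restrict (Ioc (0:ℝ) 1))).ae (ae_Ioo hα)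
    have e2 := (Measure.quasiMeasurePreserving_snd (μ := α) (ν := volume.restrict (Ioc (0:ℝ) 1))).ae
      (ae_restrict_mem measurableSet_Ioc)
    filter_upwards [e1, e2] with z h1 h2
    have h2' : z.2 ∈ Icc (0:ℝ) 1 := ⟨h2.1.le, h2.2⟩
    have h4 := wη_integrand hb hσ hB (Ioo_subset_Icc_self h1) h2'
    have h5 : wK b σ * ww z.2 * B ≤ wK b σ * 1 * B := by
      have := (wK_pos hb hσ).le
      have := ww_le_one h2'
      have hB0 : 0 ≤ B := (abs_nonneg _).trans (hB 0 (by simp))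
      gcongr
    have h6 : |Real.exp (-(b * z.2)) * q z.2| ≤ 1 * Q := by
      rw [abs_mul]
      refine mul_le_mul ?_ (hQ _ h2') (abs_nonneg _) zero_le_one
      rw [abs_of_pos (Real.exp_pos _), Real.exp_le_one_iff]
      have := mul_nonneg hb h2'.1
      linarith
    simp only [Function.uncurry, Real.norm_eq_abs]
    rw [abs_mul]
    exact mul_le_mul (h4.trans h5) h6 (abs_nonneg _) ((abs_nonneg _).trans (h4.trans h5))

lemma wη_meas_eq {b σ : ℝ} (hb : 0 ≤ b) (hσ : 0 < σ) {α : Measure ℝ} [IsProbabilityMeasure α]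
    (hα : α (Ioo (0:ℝ) 1)ᶜ = 0) {a : ℝ → ℝ} (ha : Measurable a) {B : ℝ}
    (hB : ∀ x ∈ Icc (0:ℝ) 1, |a x| ≤ B)
    (hid : ∀ q : ℝ → ℝ, Continuous q → ∫ x, ww x * q x ∂α = ∫ x, a x * wF b σ q x ∂α) :
    (∀ y ∈ Icc (0:ℝ) 1, 0 ≤ wη b σ α a y) ∧
    (∀ q : ℝ → ℝ, ∫ x, ww x * q x ∂α = ∫ y in Ioc (0:ℝ) 1, Real.exp (-(b * y)) * wη b σ α a y * q y) := by
  set ν := (volume : Measure ℝ).restrict (Ioc (0:ℝ) 1) with hν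
  set e : ℝ → ℝ := fun y => Real.exp (-(b * y)) * wη b σ α a y with he
  have hem : Measurable e := by
    have := wη_meas b σ α ha
    exact Measurable.mul (by fun_prop) this
  have hB0 : 0 ≤ B := (abs_nonneg _).trans (hB 0 (by simp))
  have hνI : ∀ᵐ y ∂ν, y ∈ Icc (0:ℝ) 1 :=
    (ae_restrict_mem measurableSet_Ioc).mono fun y hy => ⟨hy.1.le, hy.2⟩
  have heb : ∀ y ∈ Icc (0:ℝ) 1, |e y| ≤ wK b σ * B := by
    intro y hy
    rw [he]
    simp only [abs_mul]
    have h1 : |Real.exp (-(b * y))| ≤ 1 := by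
      rw [abs_of_pos (Real.exp_pos _), Real.exp_le_one_iff]
      have := mul_nonneg hb hy.1
      linarith
    have h2 := wη_bound hb hσ hα hB hy
    have h3 : wK b σ * ww y * B ≤ wK b σ * 1 * B := by
      have := (wK_pos hb hσ).le
      have := ww_le_one hy
      gcongr
    calc _ ≤ 1 * |wη b σ α a y| := mul_le_mul_of_nonneg_right h1 (abs_nonneg _)
      _ ≤ _ := by linarith
  have hpm : Measurable fun y => max (e y) 0 := hem.max measurable_const
  have hnm : Measurable fun y => max (-(e y)) 0 := hem.neg.max measurable_const
  have hpb : ∀ᵐ y ∂ν, ‖max (e y) 0‖ ≤ wK b σ * B := hνI.mono fun y hy => by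
    rw [Real.norm_eq_abs, abs_of_nonneg (le_max_right _ _)]
    exact max_le ((le_abs_self _).trans (heb y hy)) ((abs_nonneg _).trans (heb y hy))
  have hnb : ∀ᵐ y ∂ν, ‖max (-(e y)) 0‖ ≤ wK b σ * B := hνI.mono fun y hy => by
    rw [Real.norm_eq_abs, abs_of_nonneg (le_max_right _ _)]
    exact max_le ((neg_le_abs _).trans (heb y hy)) ((abs_nonneg _).trans (heb y hy))
  have hpi : Integrable (fun y => max (e y) 0) ν := Integrable.of_bound hpm.aestronglyMeasurable _ hpb
  have hni : Integrable (fun y => max (-(e y)) 0) ν := Integrable.of_bound hnm.aestronglyMeasurable _ hnb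
  have hwi : Integrable ww α := Integrable.of_bound ww_meas.aestronglyMeasurable 1 (by
    filter_upwards [ae_Ioo hα] with x hx
    rw [Real.norm_eq_abs, abs_of_nonneg (ww_nonneg (Ioo_subset_Icc_self hx))]
    exact ww_le_one (Ioo_subset_Icc_self hx))
  have hw0 : ∀ᵐ x ∂α, 0 ≤ ww x := (ae_Ioo hα).mono fun x hx => ww_nonneg (Ioo_subset_Icc_self hx)
  have f1 : IsFiniteMeasure (α.withDensity fun x => ENNReal.ofReal (ww x)) :=
    isFiniteMeasure_withDensity_ofReal hwi.2
  have f2 : IsFiniteMeasure (ν.withDensity fun x => ENNReal.ofReal (max (-(e x)) 0)) :=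
    isFiniteMeasure_withDensity_ofReal hni.2
  have f3 : IsFiniteMeasure (ν.withDensity fun x => ENNReal.ofReal (max (e x) 0)) :=
    isFiniteMeasure_withDensity_ofReal hpi.2
  have hm : (α.withDensity fun x => ENNReal.ofReal (ww x)) +
      (ν.withDensity fun x => ENNReal.ofReal (max (-(e x)) 0)) =
      ν.withDensity fun x => ENNReal.ofReal (max (e x) 0) := by
    apply ext_of_forall_integral_eq_of_IsFiniteMeasure
    intro f
    rw [integral_add_measure (f.integrable _) (f.integrable _), wd_integral ww_meas hw0,
      wd_integral hnm (ae_of_all _ fun _ => le_max_right _ _),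
      wd_integral hpm (ae_of_all _ fun _ => le_max_right _ _), hid f f.continuous,
      wη_fub hb hσ hα ha hB f.continuous]
    have hfb : ∀ᵐ y ∂ν, ‖f y‖ ≤ ‖f‖ := ae_of_all _ fun y => f.norm_coe_le_norm y
    have i1 : Integrable (fun y => max (e y) 0 * f y) ν :=
      hpi.mul_bdd f.continuous.aestronglyMeasurable hfb
    have i2 : Integrable (fun y => max (-(e y)) 0 * f y) ν :=
      hni.mul_bdd f.continuous.aestronglyMeasurable hfb
    rw [← eq_sub_iff_add_eq, ← integral_sub i1 i2]
    apply integral_congr_ae (ae_of_all _ fun y => ?_)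
    try simp only []
    rw [← sub_mul]
    congr 1
    change e y = _
    rcases le_total 0 (e y) with h | h
    · rw [max_eq_left h, max_eq_right (by linarith)]; ring
    · rw [max_eq_right h, max_eq_left (by linarith)]; ring
  have hneg : ν {y | e y < 0} = 0 := by
    have hN : MeasurableSet {y | e y < 0} := measurableSet_lt hem measurable_const
    have h2 : (ν.withDensity fun x => ENNReal.ofReal (max (e x) 0)) {y | e y < 0} = 0 := by
      rw [withDensity_apply_eq_zero hpm.ennreal_ofReal]
      convert measure_empty (μ := ν)
      ext y
      simp only [mem_inter_iff, mem_setOf_eq, mem_empty_iff_false, iff_false, not_and]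
      intro h h'
      exact h (by rw [max_eq_right h'.le]; simp)
    rw [← hm, Measure.add_apply, add_eq_zero] at h2
    have h3 := h2.2
    rw [withDensity_apply_eq_zero hnm.ennreal_ofReal] at h3
    refine measure_mono_null ?_ h3
    intro y hy
    have hy' : e y < 0 := hy
    refine ⟨?_, hy⟩
    simp only [mem_setOf_eq, ne_eq, ENNReal.ofReal_eq_zero, not_le]
    exact lt_max_of_lt_left (by linarith)
  have hpos : ∀ᵐ y ∂ν, 0 ≤ e y := by
    rw [ae_iff]
    simpa using hneg
  constructor
  · have hc := wη_cont hb hσ hα ha hB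
    have hab : wη b σ α a =ᵐ[volume.restrict (Icc (0:ℝ) 1)] fun y => |wη b σ α a y| := by
      rw [← restrict_Ioc_eq_restrict_Icc]
      filter_upwards [hpos] with y hy
      rw [abs_of_nonneg]
      exact nonneg_of_mul_nonneg_right hy (Real.exp_pos _)
    have := Measure.eqOn_Icc_of_ae_eq (μ := volume) zero_ne_one hab hc hc.abs
    intro y hy
    rw [this hy]
    exact abs_nonneg _
  · intro q
    have hz : (ν.withDensity fun x => ENNReal.ofReal (max (-(e x)) 0)) = 0 := by
      rw [withDensity_eq_zero_iff hnm.ennreal_ofReal.aemeasurable]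
      filter_upwards [hpos] with y hy
      simp [hy]
    rw [hz, add_zero] at hm
    rw [← wd_integral ww_meas hw0, hm, wd_integral hpm (ae_of_all _ fun _ => le_max_right _ _)]
    apply integral_congr_ae
    filter_upwards [hpos] with y hy
    rw [max_eq_left hy]

lemma eta_part (hs : 0 ≤ s) (hσ : 0 < σ) (hr : Measurable r) {M : ℝ}
    (hM : ∀ x ∈ Icc (0:ℝ) 1, |r x| ≤ M)
    (hr0 : ∀ x ∈ Icc (0:ℝ) 1, r x ≤ 0) (hex : WFExists s σ r) {α : Measure ℝ} {ρ : ℝ}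
    (hQ : IsQSD s σ r α ρ) :
    ∃ η : ℝ → ℝ, Measurable η ∧ (∃ C, 0 ≤ C ∧ ∀ x ∈ Icc (0:ℝ) 1, 0 ≤ η x ∧ η x ≤ C * ww x) ∧
      0 < ∫ y in Ioc (0:ℝ) 1, ww y * η y ∧
      ∀ (μ : Measure ℝ) (W : WFKilled s σ r μ) (t : ℝ), 0 ≤ t →
        ∫ ω, W.wE (fun x => r x + ρ) t ω * η (W.X t ω) ∂W.P = ∫ ω, η (W.X 0 ω) ∂W.P := by
  have hb : 0 ≤ 2 * s / σ ^ 2 := by positivity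
  obtain ⟨hp, hα, hq⟩ := id hQ
  have hα' : α (Icc (0:ℝ) 1)ᶜ = 0 :=
    measure_mono_null (compl_subset_compl.2 Ioo_subset_Icc_self) hα
  obtain ⟨W⟩ := hex α hp hα'
  set a : ℝ → ℝ := fun x => r x + ρ with hadef
  have ha : Measurable a := hr.add_const ρ
  have haB : ∀ x ∈ Icc (0:ℝ) 1, |a x| ≤ M + |ρ| := fun x hx =>
    (abs_add_le _ _).trans (by linarith [hM x hx])
  set B := M + |ρ| with hBdef
  have hB0 : 0 ≤ B := (abs_nonneg _).trans (haB 0 (by simp))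
  have hid : ∀ q : ℝ → ℝ, Continuous q →
      ∫ x, ww x * q x ∂α = ∫ x, a x * wF (2 * s / σ ^ 2) σ q x ∂α := by
    intro q hqc
    have hz : ∀ x, (x = 0 ∨ x = 1) → wF (2 * s / σ ^ 2) σ q x = 0 := by
      intro x hx
      have hx' : x ∈ Icc (0:ℝ) 1 := by rcases hx with rfl | rfl <;> simp
      rw [wF_eq _ _ hqc hx']
      apply setIntegral_eq_zero_of_forall_eq_zero
      intro y hy
      rw [wk_zero_left hx ⟨hy.1.le, hy.2⟩, zero_mul]
    have h := qsd_gen hs hσ hr hM hr0 hQ W (gp_C2 W (wF_contDiff (2 * s / σ ^ 2) σ hqc))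
      (hz 0 (Or.inl rfl)) (hz 1 (Or.inr rfl)) (by rw [wF_gen s σ hs hσ hqc]; simp [ww])
      (by rw [wF_gen s σ hs hσ hqc]; simp [ww])
    simp_rw [wF_gen s σ hs hσ hqc] at h
    have c1 : Continuous fun x => ww x * q x := by
      have : Continuous ww := by unfold ww; fun_prop
      exact this.mul hqc
    have c2 : Continuous (wF (2 * s / σ ^ 2) σ q) := (wF_contDiff (2 * s / σ ^ 2) σ hqc).continuous
    obtain ⟨B1, _, hB1⟩ := bdd_cont c1
    obtain ⟨B2, _, hB2⟩ := bdd_cont c2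
    have i1 : Integrable (fun x => -(ww x * q x)) α :=
      Integrable.of_bound c1.neg.aestronglyMeasurable B1 ((ae_Ioo hα).mono fun x hx => by
        rw [norm_neg]; exact hB1 x (Ioo_subset_Icc_self hx))
    have i2 : Integrable (fun x => (r x + ρ) * wF (2 * s / σ ^ 2) σ q x) α :=
      Integrable.of_bound (ha.mul c2.measurable).aestronglyMeasurable (B * B2)
        ((ae_Ioo hα).mono fun x hx => by
        rw [norm_mul]
        exact mul_le_mul (haB x (Ioo_subset_Icc_self hx)) (hB2 x (Ioo_subset_Icc_self hx)) (norm_nonneg _) hB0)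
    rw [integral_add i1 i2, integral_neg] at h
    linarith
  obtain ⟨hpos, hall⟩ := wη_meas_eq hb hσ hα ha haB hid
  set b := 2 * s / σ ^ 2 with hbdef
  set η := wη b σ α a with hη
  have hηm : Measurable η := wη_meas b σ α ha
  have hηb : ∀ x ∈ Icc (0:ℝ) 1, |η x| ≤ wK b σ * ww x * B := fun x hx => wη_bound hb hσ hα haB hx
  have hK := wK_pos hb hσ
  refine ⟨η, hηm, ⟨wK b σ * B, by positivity, fun x hx => ⟨hpos x hx, ?_⟩⟩, ?_, ?_⟩
  · linarith [hηb x hx, le_abs_self (η x)]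
  · have h1 := hall fun y => ww y * Real.exp (b * y)
    have h2 : ∫ y in Ioc (0:ℝ) 1, ww y * η y =
        ∫ y in Ioc (0:ℝ) 1, Real.exp (-(b * y)) * η y * (ww y * Real.exp (b * y)) := by
      apply integral_congr_ae (ae_of_all _ fun y => ?_)
      have : Real.exp (-(b * y)) * Real.exp (b * y) = 1 := by rw [← Real.exp_add]; simp
      calc ww y * η y = (Real.exp (-(b * y)) * Real.exp (b * y)) * (ww y * η y) := by rw [this, one_mul]
        _ = _ := by ring
    rw [h2, ← h1]
    have hwc : Continuous ww := by unfold ww; fun_prop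
    have hc : Continuous fun x => ww x * (ww x * Real.exp (b * x)) := by fun_prop
    obtain ⟨B1, _, hB1⟩ := bdd_cont hc
    have i1 : Integrable (fun x => ww x * (ww x * Real.exp (b * x))) α :=
      Integrable.of_bound hc.aestronglyMeasurable B1 ((ae_Ioo hα).mono fun x hx => hB1 x (Ioo_subset_Icc_self hx))
    rw [integral_pos_iff_support_of_nonneg_ae _ i1]
    · have hsub : Ioo (0:ℝ) 1 ⊆ Function.support fun x => ww x * (ww x * Real.exp (b * x)) := by
        intro x hx
        have := ww_pos hx
        have : 0 < ww x * (ww x * Real.exp (b * x)) := by positivity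
        exact this.ne'
      refine lt_of_lt_of_le ?_ (measure_mono hsub)
      rw [(prob_compl_eq_zero_iff measurableSet_Ioo).1 hα]
      exact one_pos
    · filter_upwards [ae_Ioo hα] with x hx
      have := ww_pos hx
      simp only [Pi.zero_apply]
      positivity
  · intro μ W t ht
    set Qf : ℝ → ℝ := fun x => a x * η x / ww x with hQf
    have hQm : Measurable Qf := (ha.mul hηm).div ww_meas
    have hQb : ∀ x ∈ Icc (0:ℝ) 1, |Qf x| ≤ B * (wK b σ * B) := by
      intro x hx
      rcases (ww_nonneg hx).eq_or_lt with h | h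
      · simp only [hQf, ← h, div_zero, abs_zero]; positivity
      · rw [hQf]
        simp only []
        rw [abs_div, abs_mul, abs_of_pos h, div_le_iff₀ h]
        have := mul_le_mul (haB x hx) (hηb x hx) (abs_nonneg _) hB0
        linarith
    have hη0 : ∀ x ∈ Icc (0:ℝ) 1, ww x = 0 → η x = 0 := fun x hx h => by
      have := hηb x hx
      rw [h] at this
      simpa using this
    have hgreen : ∀ y ∈ Icc (0:ℝ) 1, η y = ∫ x in Ioc (0:ℝ) 1, wk b σ y x * Qf x := by
      intro y hy
      have h1 := hall fun x => wc b σ * wkS b x y * a x / ww x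
      have h2 : ∫ x, ww x * (wc b σ * wkS b x y * a x / ww x) ∂α = η y := by
        rw [hη]
        unfold wη
        apply integral_congr_ae
        filter_upwards [ae_Ioo hα] with x hx
        have := (ww_pos hx).ne'
        field_simp
      rw [← h2, h1]
      apply integral_congr_ae (ae_of_all _ fun x => ?_)
      simp only [wk, hQf]
      rw [wkS_symm b y x]
      ring
    have hgp := gp_green hs hσ W hQm hQb hηm hgreen
    rw [FK W hgp ha haB ht]
    have hz : ∀ v ω, W.wE a v ω * (-(ww (W.X v ω) * Qf (W.X v ω)) + a (W.X v ω) * η (W.X v ω)) = 0 := by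
      intro v ω
      have hx := W.range01 v ω
      rw [mul_eq_zero]
      right
      by_cases h : ww (W.X v ω) = 0
      · rw [hη0 _ hx h, h]; ring
      · simp only [hQf]
        field_simp
        ring
    simp_rw [hz]
    simp

lemma eta_lower (hs : 0 ≤ s) (hσ : 0 < σ) (hr : Measurable r) {M : ℝ}
    (hM : ∀ x ∈ Icc (0:ℝ) 1, |r x| ≤ M) (hex : WFExists s σ r) {ρ : ℝ}
    {η : ℝ → ℝ} (hη : Measurable η) {C : ℝ} (hC0 : 0 ≤ C)
    (hηC : ∀ x ∈ Icc (0:ℝ) 1, 0 ≤ η x ∧ η x ≤ C * ww x)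
    (hI : 0 < ∫ y in Ioc (0:ℝ) 1, ww y * η y)
    (hFK : ∀ (μ : Measure ℝ) (W : WFKilled s σ r μ) (t : ℝ), 0 ≤ t →
        ∫ ω, W.wE (fun x => r x + ρ) t ω * η (W.X t ω) ∂W.P = ∫ ω, η (W.X 0 ω) ∂W.P) :
    ∃ c, 0 < c ∧ ∀ x ∈ Icc (0:ℝ) 1, c * ww x ≤ η x := by
  have hb : 0 ≤ 2 * s / σ ^ 2 := by positivity
  have hK := wK_pos hb hσ
  have hwc := wc_pos hb hσ
  set I := ∫ y in Ioc (0:ℝ) 1, ww y * η y with hIdef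
  set D := (wCD (2 * s / σ ^ 2) σ).toReal with hD
  set c0 := wc (2 * s / σ ^ 2) σ * Real.exp (-(2 * s / σ ^ 2)) with hc0
  have hc0p : 0 < c0 := by positivity
  have hD0 : 0 ≤ D := ENNReal.toReal_nonneg
  set a : ℝ → ℝ := fun x => r x + ρ with hadef
  have ha : Measurable a := hr.add_const ρ
  have haB : ∀ x ∈ Icc (0:ℝ) 1, |a x| ≤ M + |ρ| := fun x hx =>
    (abs_add_le _ _).trans (by linarith [hM x hx])
  set B := M + |ρ| with hBdef
  have hB0 : 0 ≤ B := (abs_nonneg _).trans (haB 0 (by simp))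
  have hηC1 : ∀ x ∈ Icc (0:ℝ) 1, η x ≤ C := fun x hx => (hηC x hx).2.trans (by
    have := ww_le_one hx
    nlinarith)
  set T : ℝ := 2 * (wK (2 * s / σ ^ 2) σ * C * D) / (c0 * I) + 1 with hTdef
  have hT : 0 < T := by positivity
  set T' : ℝ := 0 + 1 + T with hT'
  have hT'0 : 0 < T' := by rw [hT']; linarith
  refine ⟨c0 * I / (2 * (T' * Real.exp (B * T'))), by positivity, fun x hx => ?_⟩
  have hp : IsProbabilityMeasure (Measure.dirac x) := inferInstance
  obtain ⟨W⟩ := hex (Measure.dirac x) hp (by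
    rw [Measure.dirac_apply' _ measurableSet_Icc.compl]; simp [hx.1, hx.2])
  have hwx := ww_nonneg hx
  -- expectation of eta
  have hE : ∀ v, 0 ≤ v → v ≤ T' → ∫⁻ ω, ENNReal.ofReal (η (W.X v ω)) ∂W.P ≤
      ENNReal.ofReal (Real.exp (B * T') * η x) := by
    intro v hv hvT
    have h1 := hFK _ W v hv
    have h2 : ∫ ω, η (W.X 0 ω) ∂W.P = η x := by
      rw [← integral_map (W.measX 0).aemeasurable hη.aestronglyMeasurable, W.initLaw]
      exact integral_dirac' η x hη.stronglyMeasurable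
    have hab : ∀ v ω, |η (W.X v ω)| ≤ C := fun v ω => by
      rw [abs_of_nonneg (hηC _ (W.range01 _ _)).1]; exact hηC1 _ (W.range01 _ _)
    have i1 : Integrable (fun ω => η (W.X v ω)) W.P := integrable_of_bdd' (hη.comp (W.measX v)) (hab v)
    have i2 : Integrable (fun ω => W.wE a v ω * η (W.X v ω)) W.P :=
      i1.bdd_mul (c := Real.exp (B * v)) (wE_meas W ha v).aestronglyMeasurable (ae_of_all _ fun ω => by
        rw [Real.norm_eq_abs, abs_of_pos (wE_pos W v ω)]; exact wE_le W haB hv ω)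
    rw [← ofReal_integral_eq_lintegral_ofReal i1 (ae_of_all _ fun ω => (hηC _ (W.range01 _ _)).1)]
    apply ENNReal.ofReal_le_ofReal
    rw [← h2, ← h1, ← integral_const_mul]
    apply integral_mono i1 (i2.const_mul _)
    intro ω
    simp only []
    have h3 := wE_ge W haB hv ω
    have h4 : 1 ≤ Real.exp (B * T') * W.wE a v ω := by
      calc (1:ℝ) ≤ Real.exp (B * T') * Real.exp (-(B * v)) := by
            rw [← Real.exp_add, Real.one_le_exp_iff]
            nlinarith
        _ ≤ _ := by gcongr
    have h5 := (hηC _ (W.range01 v ω)).1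
    nlinarith
  have hcore := core hs hσ W (wgood_P W le_rfl) (t := 0) (u := T') le_rfl hT'0.le hη.ennreal_ofReal
  have hlD := lemmaD hs hσ W le_rfl (wgood_P W le_rfl) hT.le
  rw [← hT'] at hlD
  have hGm := wG_meas (2 * s / σ ^ 2) σ hη.ennreal_ofReal
  have e0 : ∫⁻ ω, wG (2 * s / σ ^ 2) σ (fun x => ENNReal.ofReal (η x)) (W.X 0 ω) ∂W.P =
      wG (2 * s / σ ^ 2) σ (fun x => ENNReal.ofReal (η x)) x := by
    rw [← lintegral_map hGm (W.measX 0), W.initLaw, lintegral_dirac' _ hGm]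
  have e1 : ∫⁻ ω, ENNReal.ofReal (ww (W.X 0 ω)) ∂W.P = ENNReal.ofReal (ww x) := by
    rw [← lintegral_map (f := fun x => ENNReal.ofReal (ww x)) ww_meas.ennreal_ofReal (W.measX 0), W.initLaw,
      lintegral_dirac' _ ww_meas.ennreal_ofReal]
  rw [e0] at hcore
  rw [e1] at hlD
  set A := {ω | W.X T' ω ∈ Ioo (0:ℝ) 1} with hA
  have hAm : MeasurableSet A := W.measX T' measurableSet_Ioo
  set p := W.P.real A with hp
  have hP : W.P A = ENNReal.ofReal p := by rw [hp, ofReal_measureReal]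
  have hp0 : 0 ≤ p := measureReal_nonneg
  have k1 : T * p ≤ D * ww x := by
    rw [hP, ← ENNReal.ofReal_mul hT.le, ← ENNReal.ofReal_toReal (wCD_ne_top _ _), ← hD,
      ← ENNReal.ofReal_mul hD0, ENNReal.ofReal_le_ofReal_iff (by positivity)] at hlD
    exact hlD
  have k2 : ∫⁻ ω, wG (2 * s / σ ^ 2) σ (fun x => ENNReal.ofReal (η x)) (W.X T' ω) ∂W.P ≤
      ENNReal.ofReal (wK (2 * s / σ ^ 2) σ * C * p) := by
    calc _ ≤ ∫⁻ ω, A.indicator (fun _ => ENNReal.ofReal (wK (2 * s / σ ^ 2) σ * C)) ω ∂W.P := by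
          apply lintegral_mono
          intro ω
          have h1 := wG_le_const (c := ENNReal.ofReal C) hb hσ (q := fun x => ENNReal.ofReal (η x))
            (fun y hy => ENNReal.ofReal_le_ofReal (hηC1 y hy)) (W.X T' ω)
          refine h1.trans ?_
          have hX := W.range01 T' ω
          by_cases h : ω ∈ A
          · rw [indicator_of_mem h, ENNReal.ofReal_mul (q := C) hK.le]
            refine mul_le_mul_left ?_ _
            apply ENNReal.ofReal_le_ofReal
            have := ww_le_one hX
            nlinarith
          · have h' : ¬ (W.X T' ω ≠ 0 ∧ W.X T' ω ≠ 1) := fun h2 => h ((Ioo_of_ne hX).2 h2)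
            have : ww (W.X T' ω) = 0 := by
              unfold ww
              by_cases h0 : W.X T' ω = 0
              · rw [h0]; ring
              · have : W.X T' ω = 1 := by tauto
                rw [this]; ring
            rw [this]; simp
      _ = _ := by
          rw [lintegral_indicator_const hAm, hP, ← ENNReal.ofReal_mul (by positivity)]
  have k3 : ∫⁻ v in Ioc 0 T', ∫⁻ ω, ENNReal.ofReal (ww (W.X v ω)) * ENNReal.ofReal (η (W.X v ω)) ∂W.P ≤
      ENNReal.ofReal (T' * (Real.exp (B * T') * η x)) := by
    calc _ ≤ ∫⁻ v in Ioc 0 T', ENNReal.ofReal (Real.exp (B * T') * η x) := by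
          apply setLIntegral_mono measurable_const
          intro v hv
          refine le_trans ?_ (hE v hv.1.le hv.2)
          apply lintegral_mono
          intro ω
          calc _ ≤ 1 * ENNReal.ofReal (η (W.X v ω)) := by
                refine mul_le_mul_left ?_ _
                exact ENNReal.ofReal_le_one.2 (ww_le_one (W.range01 _ _))
            _ = _ := one_mul _
      _ = _ := by
          rw [setLIntegral_const, Real.volume_Ioc, sub_zero, mul_comm, ← ENNReal.ofReal_mul hT'0.le]
  have k4 : ENNReal.ofReal (c0 * ww x * I) ≤ wG (2 * s / σ ^ 2) σ (fun x => ENNReal.ofReal (η x)) x := by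
    have i1 : IntegrableOn (fun y => ww y * η y) (Ioc 0 1) := by
      by_contra h
      rw [hIdef, integral_undef h] at hI
      exact lt_irrefl _ hI
    rw [ENNReal.ofReal_mul (by positivity), hIdef, ofReal_integral_eq_lintegral_ofReal i1
      ((ae_restrict_mem measurableSet_Ioc).mono fun y hy =>
        mul_nonneg (ww_nonneg ⟨hy.1.le, hy.2⟩) (hηC y ⟨hy.1.le, hy.2⟩).1),
      ← lintegral_const_mul (f := fun y => ENNReal.ofReal (ww y * η y)) _ (ww_meas.mul hη).ennreal_ofReal]
    unfold wG
    apply setLIntegral_mono' measurableSet_Ioc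
    intro y hy
    have hy' : y ∈ Icc (0:ℝ) 1 := ⟨hy.1.le, hy.2⟩
    rw [← ENNReal.ofReal_mul (by positivity), ← ENNReal.ofReal_mul (wk_nonneg hb hσ hx hy')]
    apply ENNReal.ofReal_le_ofReal
    have := mul_le_mul_of_nonneg_right (wk_ge hb hσ hx hy') (hηC y hy').1
    calc _ = c0 * (ww x * ww y) * η y := by ring
      _ ≤ _ := this
  have hη0 := (hηC x hx).1
  have k5 : c0 * ww x * I ≤ wK (2 * s / σ ^ 2) σ * C * p + T' * (Real.exp (B * T') * η x) := by
    rw [← ENNReal.ofReal_le_ofReal_iff (by positivity), ENNReal.ofReal_add (by positivity) (by positivity)]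
    refine k4.trans ?_
    rw [← hcore]
    exact add_le_add k2 k3
  have k6 : wK (2 * s / σ ^ 2) σ * C * p ≤ c0 * I * ww x / 2 := by
    have h1 : wK (2 * s / σ ^ 2) σ * C * (T * p) ≤ wK (2 * s / σ ^ 2) σ * C * (D * ww x) :=
      mul_le_mul_of_nonneg_left k1 (by positivity)
    have h2 : wK (2 * s / σ ^ 2) σ * C * D ≤ c0 * I * T / 2 := by
      have h3 : c0 * I * T = 2 * (wK (2 * s / σ ^ 2) σ * C * D) + c0 * I := by
        rw [hTdef]; field_simp
      have : 0 < c0 * I := by positivity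
      linarith
    have h4 := mul_le_mul_of_nonneg_right h2 hwx
    have h5 : T * (wK (2 * s / σ ^ 2) σ * C * p) ≤ T * (c0 * I * ww x / 2) := by linarith
    exact le_of_mul_le_mul_left h5 hT
  rw [div_mul_eq_mul_div, div_le_iff₀ (by positivity)]
  linarith

lemma ww_le_one_sub {x : ℝ} (hx : x ∈ Icc (0:ℝ) 1) : ww x ≤ 1 - x := by
  unfold ww
  nlinarith [hx.1, hx.2]

lemma int_one_sub (W : WFKilled s σ r μ₀) (t : ℝ) : Integrable (fun ω => 1 - W.X t ω) W.P :=
  integrable_of_bdd' (measurable_const.sub (W.measX t)) (B := 1) fun ω => by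
    have := W.range01 t ω
    rw [abs_le]; constructor <;> linarith [this.1, this.2]

lemma int_ww (W : WFKilled s σ r μ₀) (t : ℝ) : Integrable (fun ω => ww (W.X t ω)) W.P :=
  integrable_of_bdd' (ww_meas.comp (W.measX t)) (B := 1) fun ω => by
    have := W.range01 t ω
    rw [abs_of_nonneg (ww_nonneg this)]; exact ww_le_one this

lemma N_bound (hs : 0 ≤ s) (hσ : 0 < σ) (hr : Measurable r) {M : ℝ}
    (hM : ∀ x ∈ Icc (0:ℝ) 1, |r x| ≤ M) (hr0 : ∀ x ∈ Icc (0:ℝ) 1, r x ≤ 0) {ρ : ℝ}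
    {η : ℝ → ℝ} (hη : Measurable η) {C c : ℝ} (hC0 : 0 ≤ C) (hc : 0 < c)
    (hηC : ∀ x ∈ Icc (0:ℝ) 1, 0 ≤ η x ∧ η x ≤ C * ww x) (hηc : ∀ x ∈ Icc (0:ℝ) 1, c * ww x ≤ η x)
    (hFK : ∀ (μ : Measure ℝ) (W : WFKilled s σ r μ) (t : ℝ), 0 ≤ t →
        ∫ ω, W.wE (fun x => r x + ρ) t ω * η (W.X t ω) ∂W.P = ∫ ω, η (W.X 0 ω) ∂W.P) :
    ∃ K, 0 ≤ K ∧ ∀ (μ : Measure ℝ) (W : WFKilled s σ r μ) (t : ℝ), 2 ≤ t →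
      ∫⁻ ω in {ω | W.X t ω ∈ Ioo (0:ℝ) 1}, ENNReal.ofReal (W.wE r t ω) ∂W.P ≤
        ENNReal.ofReal (K * Real.exp (-(ρ * t)) * ∫ ω, (1 - W.X 0 ω) ∂W.P) := by
  have hb : 0 ≤ 2 * s / σ ^ 2 := by positivity
  set D := (wCD (2 * s / σ ^ 2) σ).toReal with hD
  have hD0 : 0 ≤ D := ENNReal.toReal_nonneg
  refine ⟨D * (C / c) * Real.exp (ρ * 2), by positivity, fun μ W t ht => ?_⟩
  obtain ⟨u, rfl⟩ : ∃ u, t = u + 1 + 1 := ⟨t - 2, by ring⟩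
  have hu : 0 ≤ u := by linarith
  have hZm := wE_meas W hr u
  have hgood := wgood_of_Z W hu (wE_measF W hr u) (K := Real.exp (M * u)) (fun ω => (wE_pos W u ω).le)
    (wE_le W hM hu)
  have hl := lemmaD hs hσ W hu hgood zero_le_one
  have hAm : MeasurableSet {ω | W.X (u + 1 + 1) ω ∈ Ioo (0:ℝ) 1} := W.measX _ measurableSet_Ioo
  rw [ENNReal.ofReal_one, one_mul, withDensity_apply _ hAm] at hl
  have hab : ∀ v ω, |η (W.X v ω)| ≤ C := fun v ω => by
    have hX := W.range01 v ω
    rw [abs_of_nonneg (hηC _ hX).1]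
    refine (hηC _ hX).2.trans ?_
    have := ww_le_one hX
    nlinarith
  have hZb : ∀ᵐ ω ∂W.P, ‖W.wE r u ω‖ ≤ Real.exp (M * u) := ae_of_all _ fun ω => by
    rw [Real.norm_eq_abs, abs_of_pos (wE_pos W u ω)]; exact wE_le W hM hu ω
  have i1 : Integrable (fun ω => η (W.X u ω)) W.P := integrable_of_bdd' (hη.comp (W.measX u)) (hab u)
  have i2 : Integrable (fun ω => W.wE r u ω * η (W.X u ω)) W.P := i1.bdd_mul hZm.aestronglyMeasurable hZb
  have i3 : Integrable (fun ω => W.wE r u ω * ww (W.X u ω)) W.P :=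
    (int_ww W u).bdd_mul hZm.aestronglyMeasurable hZb
  have h1 : ∫⁻ ω, ENNReal.ofReal (ww (W.X u ω)) ∂(W.P.withDensity fun ω => ENNReal.ofReal (W.wE r u ω)) =
      ENNReal.ofReal (∫ ω, W.wE r u ω * ww (W.X u ω) ∂W.P) := by
    have hg : Measurable fun ω => ENNReal.ofReal (ww (W.X u ω)) := (ww_meas.comp (W.measX u)).ennreal_ofReal
    rw [lintegral_withDensity_eq_lintegral_mul _ hZm.ennreal_ofReal
      hg, ofReal_integral_eq_lintegral_ofReal i3
      (ae_of_all _ fun ω => mul_nonneg (wE_pos W u ω).le (ww_nonneg (W.range01 _ _)))]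
    apply lintegral_congr fun ω => ?_
    rw [ENNReal.ofReal_mul (wE_pos W u ω).le]
    rfl
  have h2 : c * ∫ ω, W.wE r u ω * ww (W.X u ω) ∂W.P ≤ ∫ ω, W.wE r u ω * η (W.X u ω) ∂W.P := by
    rw [← integral_const_mul]
    apply integral_mono (i3.const_mul _) i2
    intro ω
    have := mul_le_mul_of_nonneg_left (hηc _ (W.range01 u ω)) (wE_pos (a := r) W u ω).le
    try simp only []
    linarith
  have h3 : Real.exp (ρ * u) * ∫ ω, W.wE r u ω * η (W.X u ω) ∂W.P = ∫ ω, η (W.X 0 ω) ∂W.P := by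
    rw [← hFK μ W u hu, ← integral_const_mul]
    apply integral_congr_ae (ae_of_all _ fun ω => ?_)
    try simp only []
    rw [wE_shift W hr hM ρ hu ω]
    ring
  have h4 : ∫ ω, η (W.X 0 ω) ∂W.P ≤ C * ∫ ω, (1 - W.X 0 ω) ∂W.P := by
    rw [← integral_const_mul]
    apply integral_mono (integrable_of_bdd' (hη.comp (W.measX 0)) (hab 0)) ((int_one_sub W 0).const_mul C)
    intro ω
    refine (hηC _ (W.range01 0 ω)).2.trans ?_
    exact mul_le_mul_of_nonneg_left (ww_le_one_sub (W.range01 0 ω)) hC0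
  set m := ∫ ω, (1 - W.X 0 ω) ∂W.P with hm
  have h5 : ∫ ω, W.wE r u ω * ww (W.X u ω) ∂W.P ≤ C / c * Real.exp (-(ρ * u)) * m := by
    have e : Real.exp (-(ρ * u)) * Real.exp (ρ * u) = 1 := by rw [← Real.exp_add]; simp
    have h6 : ∫ ω, W.wE r u ω * η (W.X u ω) ∂W.P ≤ Real.exp (-(ρ * u)) * (C * m) := by
      calc _ = Real.exp (-(ρ * u)) * (Real.exp (ρ * u) * ∫ ω, W.wE r u ω * η (W.X u ω) ∂W.P) := by
            rw [← mul_assoc, e, one_mul]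
        _ ≤ _ := by
            rw [h3]; exact mul_le_mul_of_nonneg_left h4 (Real.exp_pos _).le
    have h7 : C / c * Real.exp (-(ρ * u)) * m = Real.exp (-(ρ * u)) * (C * m) / c := by ring
    rw [h7, le_div_iff₀ hc]
    linarith
  have hmono : ∀ ω, W.wE r (u + 1 + 1) ω ≤ W.wE r u ω := by
    intro ω
    unfold WFKilled.wE
    apply Real.exp_le_exp.2
    have hneg : ∀ x ∈ Ioc 0 (u+1+1), 0 ≤ -(r (W.X x ω)) := fun x _ => by
      linarith [hr0 _ (W.range01 x ω)]
    have := setIntegral_mono_set (s := Ioc 0 u) (t := Ioc 0 (u + 1 + 1)) (f := fun v => -(r (W.X v ω))) (μ := volume)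
      (integrable_J W.contX hr W.range01 hM ω).neg
      ((ae_restrict_mem measurableSet_Ioc).mono hneg)
      (Ioc_subset_Ioc_right (by linarith)).eventuallyLE
    rw [integral_neg, integral_neg] at this
    linarith
  calc _ ≤ ∫⁻ ω in {ω | W.X (u + 1 + 1) ω ∈ Ioo (0:ℝ) 1}, ENNReal.ofReal (W.wE r u ω) ∂W.P :=
        lintegral_mono fun ω => ENNReal.ofReal_le_ofReal (hmono ω)
    _ ≤ _ := hl
    _ ≤ _ := by
        rw [h1, ← ENNReal.ofReal_toReal (wCD_ne_top _ _), ← hD, ← ENNReal.ofReal_mul hD0]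
        apply ENNReal.ofReal_le_ofReal
        refine (mul_le_mul_of_nonneg_left h5 hD0).trans (le_of_eq ?_)
        have : Real.exp (-(ρ * u)) = Real.exp (ρ * 2) * Real.exp (-(ρ * (u + 1 + 1))) := by
          rw [← Real.exp_add]; congr 1; ring
        rw [this]; ring

lemma zero_prob (hs : 0 ≤ s) (hσ : 0 < σ) (r : ℝ → ℝ) :
    ∃ t₀ c : ℝ, 2 ≤ t₀ ∧ 0 < c ∧ ∀ (μ : Measure ℝ) (W : WFKilled s σ r μ),
      c * ∫ ω, (1 - W.X 0 ω) ∂W.P ≤ W.P.real {ω | W.X t₀ ω = 0} := by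
  have hb : 0 ≤ 2 * s / σ ^ 2 := by positivity
  have hp1 := wp_one_pos hb
  set D := (wCD (2 * s / σ ^ 2) σ).toReal with hD
  have hD0 : 0 ≤ D := ENNReal.toReal_nonneg
  set T : ℝ := 2 * (wp (2 * s / σ ^ 2) 1 * D) + 1 with hTdef
  have hT1 : 1 ≤ T := by
    have : 0 ≤ wp (2 * s / σ ^ 2) 1 * D := mul_nonneg (by linarith) hD0
    linarith
  have hT : 0 < T := by linarith
  refine ⟨0 + 1 + T, 1 / (2 * wp (2 * s / σ ^ 2) 1), by linarith, by positivity, fun μ W => ?_⟩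
  have hlD := lemmaD hs hσ W le_rfl (wgood_P W le_rfl) hT.le
  set t₀ := 0 + 1 + T with ht₀
  have ht0 : 0 ≤ t₀ := by linarith
  set m := ∫ ω, (1 - W.X 0 ω) ∂W.P with hm
  have hm0 : 0 ≤ m := integral_nonneg fun ω => by
    have := (W.range01 0 ω).2
    simp only [Pi.zero_apply]; linarith
  set A := {ω | W.X t₀ ω ∈ Ioo (0:ℝ) 1} with hA
  have hAm : MeasurableSet A := W.measX t₀ measurableSet_Ioo
  set Z := {ω | W.X t₀ ω = 0} with hZ
  have hZm : MeasurableSet Z := W.measX t₀ (measurableSet_singleton 0)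
  have k1 : T * W.P.real A ≤ D * m := by
    rw [← ofReal_integral_eq_lintegral_ofReal (int_ww W 0) (ae_of_all _ fun ω => ww_nonneg (W.range01 _ _)),
      ← ofReal_measureReal (s := A), ← ENNReal.ofReal_mul hT.le,
      ← ENNReal.ofReal_toReal (wCD_ne_top _ _), ← hD, ← ENNReal.ofReal_mul hD0,
      ENNReal.ofReal_le_ofReal_iff (mul_nonneg hD0 (integral_nonneg fun ω => ww_nonneg (W.range01 _ _)))] at hlD
    refine hlD.trans (mul_le_mul_of_nonneg_left ?_ hD0)
    exact integral_mono (int_ww W 0) (int_one_sub W 0) fun ω => ww_le_one_sub (W.range01 0 ω)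
  have hmart := setInt_mart W (wp_contDiff (2 * s / σ ^ 2)) (fun x _ => wp_gen s σ hσ x) le_rfl ht0
    (MeasurableSet.univ)
  rw [setIntegral_univ, setIntegral_univ] at hmart
  set b := 2 * s / σ ^ 2 with hbdef
  have hwpi : ∀ v, Integrable (fun ω => wp b (W.X v ω)) W.P := fun v => by
    obtain ⟨B, _, hB⟩ := bdd_cont (wp_cont b)
    exact integrable_of_bdd' ((wp_cont b).measurable.comp (W.measX v)) fun ω => hB _ (W.range01 v ω)
  have k2 : m ≤ ∫ ω, (wp b 1 - wp b (W.X 0 ω)) ∂W.P := by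
    apply integral_mono (int_one_sub W 0) ((integrable_const _).sub (hwpi 0))
    intro ω
    exact wp_sub_lower hb (W.range01 0 ω).1 (W.range01 0 ω).2
  have k3 : ∫ ω, (wp b 1 - wp b (W.X 0 ω)) ∂W.P = ∫ ω, (wp b 1 - wp b (W.X t₀ ω)) ∂W.P := by
    rw [integral_sub (integrable_const _) (hwpi 0), integral_sub (integrable_const _) (hwpi t₀), hmart]
  have k4 : ∫ ω, (wp b 1 - wp b (W.X t₀ ω)) ∂W.P ≤ wp b 1 * W.P.real Z + wp b 1 * W.P.real A := by
    have iZ : Integrable (Z.indicator fun _ => wp b 1) W.P := (integrable_const _).indicator hZm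
    have iA : Integrable (A.indicator fun _ => wp b 1) W.P := (integrable_const _).indicator hAm
    have e : wp b 1 * W.P.real Z + wp b 1 * W.P.real A =
        ∫ ω, (Z.indicator (fun _ => wp b 1) ω + A.indicator (fun _ => wp b 1) ω) ∂W.P := by
      rw [integral_add iZ iA, integral_indicator_const _ hZm, integral_indicator_const _ hAm]
      simp only [smul_eq_mul]; ring
    rw [e]
    apply integral_mono ((integrable_const _).sub (hwpi t₀)) (iZ.add iA)
    intro ω
    have hX := W.range01 t₀ ω
    have hwp0 : 0 ≤ wp b (W.X t₀ ω) := by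
      have := wp_mono b hX.1
      rwa [wp_zero] at this
    have n1 : 0 ≤ Z.indicator (fun _ => wp b 1) ω := indicator_nonneg (fun _ _ => by linarith) ω
    have n2 : 0 ≤ A.indicator (fun _ => wp b 1) ω := indicator_nonneg (fun _ _ => by linarith) ω
    change wp b 1 - wp b (W.X t₀ ω) ≤ Z.indicator (fun _ => wp b 1) ω + A.indicator (fun _ => wp b 1) ω
    by_cases h0 : W.X t₀ ω = 0
    · rw [indicator_of_mem (show ω ∈ Z from h0)]; linarith
    · by_cases h1 : W.X t₀ ω = 1
      · rw [h1]; linarith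
      · rw [indicator_of_mem (show ω ∈ A from (Ioo_of_ne hX).2 ⟨h0, h1⟩)]; linarith
  have k5 : wp b 1 * W.P.real A ≤ m / 2 := by
    have h1 : wp b 1 * (T * W.P.real A) ≤ wp b 1 * (D * m) := mul_le_mul_of_nonneg_left k1 (by linarith)
    have h2 : T * (wp b 1 * W.P.real A) ≤ T * (m / 2) := by
      have : T * (m / 2) = wp b 1 * (D * m) + m / 2 := by rw [hTdef]; ring
      linarith
    exact le_of_mul_le_mul_left h2 hT
  rw [one_div, inv_mul_le_iff₀ (by positivity)]
  linarith

lemma stay0 (hs : 0 ≤ s) (hσ : 0 < σ) (W : WFKilled s σ r μ₀) {t₀ : ℝ} (ht₀ : 0 ≤ t₀) :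
    ∀ᵐ ω ∂W.P, W.X t₀ ω = 0 → ∀ v, t₀ ≤ v → W.X v ω = 0 := by
  have h : ∀ q : ℚ, ∀ᵐ ω ∂W.P, t₀ ≤ (q:ℝ) → W.X t₀ ω = 0 → W.X (q:ℝ) ω = 0 := by
    intro q
    by_cases hq : t₀ ≤ (q:ℝ)
    · filter_upwards [abs0 hs hσ W (ht₀.trans hq)] with ω hω _ h0
      exact hω ⟨t₀, ⟨ht₀, hq⟩, h0⟩
    · exact ae_of_all _ fun ω h' => absurd h' hq
  filter_upwards [ae_all_iff.2 h] with ω hω h0 v hv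
  by_contra hne
  have hopen : IsOpen {u | W.X u ω ≠ 0} := isOpen_ne.preimage (W.contX ω)
  obtain ⟨ε, hε, hball⟩ := Metric.isOpen_iff.1 hopen v hne
  obtain ⟨q, hq1, hq2⟩ := exists_rat_btwn (show v < v + ε by linarith)
  have : (q:ℝ) ∈ Metric.ball v ε := by
    rw [Metric.mem_ball, Real.dist_eq, abs_of_pos (by linarith)]; linarith
  exact hball this (hω q (hv.trans hq1.le) h0)

lemma D_bound (hs : 0 ≤ s) (hσ : 0 < σ) (hr : Measurable r) {M : ℝ}
    (hM : ∀ x ∈ Icc (0:ℝ) 1, |r x| ≤ M) (hr0 : ∀ x ∈ Icc (0:ℝ) 1, r x ≤ 0) :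
    ∃ t₀ c : ℝ, 2 ≤ t₀ ∧ 0 < c ∧ ∀ (μ : Measure ℝ) (W : WFKilled s σ r μ) (t : ℝ), t₀ ≤ t →
      ENNReal.ofReal (c * Real.exp (r 0 * t) * ∫ ω, (1 - W.X 0 ω) ∂W.P) ≤
      ∫⁻ ω in {ω | W.X t ω ∈ univ ∩ {1}ᶜ}, ENNReal.ofReal (W.wE r t ω) ∂W.P := by
  obtain ⟨t₀, c, ht₀, hc, h⟩ := zero_prob hs hσ r
  refine ⟨t₀, c * Real.exp (-(M * t₀)), ht₀, by positivity, fun μ W t ht => ?_⟩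
  have ht00 : 0 ≤ t₀ := by linarith
  have hr00 : r 0 ≤ 0 := hr0 0 (by simp)
  set m := ∫ ω, (1 - W.X 0 ω) ∂W.P with hm
  set Z := {ω | W.X t₀ ω = 0} with hZ
  have hZm : MeasurableSet Z := W.measX t₀ (measurableSet_singleton 0)
  have hst := stay0 hs hσ W ht00
  set k := Real.exp (-(M * t₀)) * Real.exp (r 0 * t) with hk
  have hk0 : 0 ≤ k := by positivity
  calc _ ≤ ENNReal.ofReal (k * W.P.real Z) := by
        apply ENNReal.ofReal_le_ofReal
        have := mul_le_mul_of_nonneg_left (h μ W) hk0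
        calc _ = k * (c * m) := by rw [hk]; ring
          _ ≤ _ := this
    _ = ∫⁻ ω in Z, ENNReal.ofReal k ∂W.P := by
        rw [setLIntegral_const, ENNReal.ofReal_mul hk0, ofReal_measureReal]
    _ ≤ ∫⁻ ω in Z, ENNReal.ofReal (W.wE r t ω) ∂W.P := by
        apply lintegral_mono_ae
        rw [ae_restrict_iff' hZm]
        filter_upwards [hst] with ω hω hz
        apply ENNReal.ofReal_le_ofReal
        have hX := hω hz
        have hsp : ∫ v in Ioc 0 t, r (W.X v ω) =
            (∫ v in Ioc 0 t₀, r (W.X v ω)) + ∫ v in Ioc t₀ t, r (W.X v ω) := by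
          rw [← setIntegral_union (by
            rw [Set.disjoint_left]; rintro x ⟨_, h1⟩ ⟨h2, _⟩; linarith) measurableSet_Ioc
            (integrable_J W.contX hr W.range01 hM ω) (integrable_J W.contX hr W.range01 hM ω),
            Ioc_union_Ioc_eq_Ioc ht00 ht]
        have hcst : ∫ v in Ioc t₀ t, r (W.X v ω) = (t - t₀) * r 0 := by
          rw [setIntegral_congr_fun (g := fun _ => r 0) measurableSet_Ioc (fun v hv => by
            simp only []; rw [hX v hv.1.le])]
          simp [ht]
        unfold WFKilled.wE
        rw [hk, ← Real.exp_add]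
        apply Real.exp_le_exp.2
        rw [hsp, hcst]
        have := abs_le.1 (bound_J ht00 W.range01 hM ω)
        nlinarith [this.1]
    _ ≤ _ := by
        apply lintegral_mono' _ le_rfl
        apply Measure.restrict_mono_ae
        filter_upwards [hst] with ω hω hz
        change W.X t ω ∈ univ ∩ {1}ᶜ
        rw [hω hz t ht]
        simp

lemma m_pos {μ : Measure ℝ} [IsProbabilityMeasure μ] (hμ : μ (Icc (0:ℝ) 1)ᶜ = 0)
    (h1 : μ ≠ Measure.dirac (1:ℝ)) (W : WFKilled s σ r μ) : 0 < ∫ ω, (1 - W.X 0 ω) ∂W.P := by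
  have h0 : ∀ ω, 0 ≤ 1 - W.X 0 ω := fun ω => by linarith [(W.range01 0 ω).2]
  refine lt_of_le_of_ne (integral_nonneg h0) fun h => h1 ?_
  have h2 := (integral_eq_zero_iff_of_nonneg h0 (int_one_sub W 0)).1 h.symm
  have h3 : W.X 0 =ᵐ[W.P] fun _ => 1 := by
    filter_upwards [h2] with ω hω
    have : 1 - W.X 0 ω = 0 := hω
    linarith
  have := W.probP
  rw [← W.initLaw, Measure.map_congr h3, Measure.map_const, measure_univ, one_smul]

lemma tv_le {ν : Measure ℝ} (h1 : ν univ ≤ 1) : tvDist ν (Measure.dirac (0:ℝ)) ≤ 1 := by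
  unfold tvDist
  apply ciSup_le
  intro A
  have a1 : (ν A).toReal ≤ 1 := ENNReal.toReal_le_of_le_ofReal zero_le_one (by
    rw [ENNReal.ofReal_one]; exact (measure_mono (subset_univ A)).trans h1)
  have a2 : (Measure.dirac (0:ℝ) A).toReal ≤ 1 := ENNReal.toReal_le_of_le_ofReal zero_le_one (by
    rw [ENNReal.ofReal_one]; exact prob_le_one)
  have a3 : 0 ≤ (ν A).toReal := ENNReal.toReal_nonneg
  have a4 : 0 ≤ (Measure.dirac (0:ℝ) A).toReal := ENNReal.toReal_nonneg
  rw [abs_le]; constructor <;> linarith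

lemma tv_le' {ν : Measure ℝ} (h1 : ν univ = 1) {e : ℝ} (he : 0 ≤ e)
    (h : ν {0}ᶜ ≤ ENNReal.ofReal e) : tvDist ν (Measure.dirac (0:ℝ)) ≤ e := by
  unfold tvDist
  have : IsProbabilityMeasure ν := ⟨h1⟩
  apply ciSup_le
  intro A
  have hr : ν.real {0}ᶜ ≤ e := ENNReal.toReal_le_of_le_ofReal he h
  by_cases h0 : (0:ℝ) ∈ A
  · rw [Measure.dirac_apply_of_mem h0]
    have e1 : ν.real {0} ≤ ν.real A := measureReal_mono (singleton_subset_iff.2 h0)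
    have e2 : ν.real A ≤ 1 := measureReal_le_one
    have e3 : ν.real {0}ᶜ = 1 - ν.real {0} := probReal_compl_eq_one_sub (measurableSet_singleton 0)
    change |ν.real A - _| ≤ e
    rw [abs_le]; simp only [ENNReal.toReal_one]; constructor <;> linarith
  · rw [Measure.dirac_apply, indicator_of_notMem h0]
    have e1 : ν.real A ≤ ν.real {0}ᶜ := measureReal_mono fun x hx hx0 => h0 (by
      have : x = 0 := hx0
      rwa [this] at hx)
    have e2 : 0 ≤ ν.real A := measureReal_nonneg
    change |ν.real A - _| ≤ e
    rw [abs_le]; simp only [ENNReal.toReal_zero]; constructor <;> linarith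

theorem wf_conditioned_avoiding_one_to_zero
    (s σ : ℝ) (hs : 0 ≤ s) (hσ : 0 < σ)
    (r : ℝ → ℝ) (hrMeas : Measurable r) (hrBdd : ∃ M, ∀ x ∈ Icc (0:ℝ) 1, |r x| ≤ M)
    (hrNonpos : ∀ x ∈ Icc (0:ℝ) 1, r x ≤ 0)
    (hex : WFExists s σ r)
    (α : Measure ℝ) (ρα : ℝ)
    (hQSD : IsQSD s σ r α ρα)
    (hQSDuniq : ∀ (α' : Measure ℝ) (ρ' : ℝ), IsQSD s σ r α' ρ' → α' = α ∧ ρ' = ρα)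
    (hrate : -r 0 < ρα) :
    ∃ C : ℝ, 0 < C ∧
      ∀ μ : Measure ℝ, IsProbabilityMeasure μ → μ (Icc (0:ℝ) 1)ᶜ = 0 →
        μ ≠ Measure.dirac (1:ℝ) →
        ∀ W : WFKilled s σ r μ, ∀ t : ℝ, 0 ≤ t →
          tvDist (W.condLaw (W.aliveSoft t ∩ W.noHit1 t) t) (Measure.dirac (0:ℝ))
            ≤ C * Real.exp (-(ρα - (-r 0)) * t) := by
  obtain ⟨M, hM⟩ := hrBdd
  obtain ⟨η, hη, ⟨C, hC0, hηC⟩, hI, hFK⟩ := eta_part hs hσ hrMeas hM hrNonpos hex hQSD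
  obtain ⟨c, hc, hηc⟩ := eta_lower hs hσ hrMeas hM hex hη hC0 hηC hI hFK
  obtain ⟨K, hK0, hN⟩ := N_bound hs hσ hrMeas hM hrNonpos hη hC0 hc hηC hηc hFK
  obtain ⟨t₀, d, ht₀, hd, hD⟩ := D_bound hs hσ hrMeas hM hrNonpos
  set δ := ρα - (-r 0) with hδ
  have hδ0 : 0 < δ := by linarith
  refine ⟨K / d + Real.exp (δ * t₀), by positivity, fun μ hμp hμ hμ1 W t ht => ?_⟩
  have hPp := W.probP
  set E := W.aliveSoft t ∩ W.noHit1 t with hE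
  set ν := W.condLaw E t with hν
  have huniv : ν univ = (W.P E)⁻¹ * W.P E := by
    rw [hν]
    unfold WFKilled.condLaw
    rw [Measure.smul_apply, Measure.map_apply (W.measX t) MeasurableSet.univ, preimage_univ,
      Measure.restrict_apply_univ, smul_eq_mul]
  rcases lt_or_ge t t₀ with hlt | hge
  · refine (tv_le (by rw [huniv]; exact ENNReal.inv_mul_le_one _)).trans ?_
    have h1 : 1 ≤ Real.exp (δ * t₀) * Real.exp (-δ * t) := by
      rw [← Real.exp_add, Real.one_le_exp_iff]
      nlinarith
    have h2 : 0 ≤ K / d * Real.exp (-δ * t) := by positivity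
    linarith
  · have hm := m_pos hμ hμ1 W
    have hPE := one_law hs hσ W hrMeas hrNonpos ht MeasurableSet.univ
    have hset : {ω | W.X t ω ∈ univ} ∩ (W.aliveSoft t ∩ W.noHit1 t) = E := by
      rw [hE]; simp
    rw [hset] at hPE
    have hDt := hD μ W t hge
    rw [← hPE] at hDt
    have hNt := hN μ W t (ht₀.trans hge)
    have hP0 := one_law hs hσ W hrMeas hrNonpos ht (measurableSet_singleton (0:ℝ)).compl
    have hset2 : {ω | W.X t ω ∈ ({0}ᶜ : Set ℝ) ∩ {1}ᶜ} = {ω | W.X t ω ∈ Ioo (0:ℝ) 1} := by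
      ext ω
      exact (Ioo_of_ne (W.range01 t ω)).symm
    rw [hset2] at hP0
    rw [← hP0] at hNt
    set m := ∫ ω, (1 - W.X 0 ω) ∂W.P with hmdef
    have hdp : 0 < d * Real.exp (r 0 * t) * m := by positivity
    have hPEpos : W.P E ≠ 0 := by
      intro h0
      rw [h0] at hDt
      exact absurd hDt (by simpa using hdp)
    have hPEtop : W.P E ≠ ⊤ := measure_ne_top _ _
    have hν1 : ν univ = 1 := by rw [huniv, ENNReal.inv_mul_cancel hPEpos hPEtop]
    have hν0 : ν {0}ᶜ ≤ ENNReal.ofReal (K / d * Real.exp (-δ * t)) := by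
      have e1 : ν {0}ᶜ = (W.P E)⁻¹ * W.P ({ω | W.X t ω ∈ ({0}ᶜ : Set ℝ)} ∩ E) := by
        rw [hν]
        unfold WFKilled.condLaw
        have hms : MeasurableSet ({0}ᶜ : Set ℝ) := (measurableSet_singleton (0:ℝ)).compl
        rw [Measure.smul_apply, Measure.map_apply (W.measX t) hms,
          Measure.restrict_apply (W.measX t hms), smul_eq_mul]
        rfl
      rw [e1]
      calc _ ≤ (ENNReal.ofReal (d * Real.exp (r 0 * t) * m))⁻¹ *
            ENNReal.ofReal (K * Real.exp (-(ρα * t)) * m) :=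
            mul_le_mul' (ENNReal.inv_le_inv.2 hDt) hNt
        _ = _ := by
            rw [← ENNReal.ofReal_inv_of_pos hdp, ← ENNReal.ofReal_mul (by positivity)]
            congr 1
            have : Real.exp (-δ * t) = Real.exp (-(ρα * t)) / Real.exp (r 0 * t) := by
              rw [← Real.exp_sub]; congr 1; rw [hδ]; ring
            rw [this]
            field_simp
    refine (tv_le' hν1 (by positivity) hν0).trans ?_
    have : 0 ≤ Real.exp (δ * t₀) * Real.exp (-δ * t) := by positivity
    linarith

end
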